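/- arXiv:2004.12931 — 4 statements merged into one kernel-verified Lean document; each statement's English description precedes it below -/
import Mathlib

section
/- Assume the time-reversal symmetric case (T_0 real, all h_j real) and d ≤ 2. Suppose λ attains a local minimum (respectively local maximum) at α° ∈ ℝ^d, λ(α°) is a simple eigenvalue of T(α°), and its unit eigenvector f° is non-vanishing on crossing edges. Then λ(α°) ≤ λ(α) (respectively λ(α) ≤ λ(α°)) for all α ∈ ℝ^d, i.e. the local extremum is a global extremum. -/
noncomputable section

open Matrix Complex
open scoped ComplexOrder

/-- Eigenvalues of a square complex matrix, sorted in increasing order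
(junk value `0` if the matrix is not Hermitian). -/
noncomputable def sortedEigs {n : ℕ} (A : Matrix (Fin n) (Fin n) ℂ) : Fin n → ℝ :=
  if hA : A.IsHermitian then hA.eigenvalues ∘ Tuple.sort hA.eigenvalues else 0

/-- The Moore–Penrose pseudoinverse of a Hermitian matrix (junk value `0` otherwise). -/
noncomputable def pinvH {m : Type*} [Fintype m] [DecidableEq m] (A : Matrix m m ℂ) :
    Matrix m m ℂ :=
  if hA : A.IsHermitian then
    (hA.eigenvectorUnitary : Matrix m m ℂ) *
      Matrix.diagonal (fun i => if hA.eigenvalues i = 0 then 0 else ((hA.eigenvalues i : ℂ))⁻¹) *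
      star (hA.eigenvectorUnitary : Matrix m m ℂ)
  else 0

/-- The orthogonal projection onto the null space of a Hermitian matrix. -/
noncomputable def nullProj {m : Type*} [Fintype m] [DecidableEq m] (A : Matrix m m ℂ) :
    Matrix m m ℂ :=
  1 - pinvH A * A

/-- The number of positive eigenvalues (with multiplicity) of a Hermitian matrix. -/
noncomputable def iPos {m : Type*} [Fintype m] [DecidableEq m] (A : Matrix m m ℂ) : ℕ :=
  if hA : A.IsHermitian then Nat.card {i // 0 < hA.eigenvalues i} else 0

/-- The number of negative eigenvalues (with multiplicity) of a Hermitian matrix. -/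
noncomputable def iNeg {m : Type*} [Fintype m] [DecidableEq m] (A : Matrix m m ℂ) : ℕ :=
  if hA : A.IsHermitian then Nat.card {i // hA.eigenvalues i < 0} else 0

/-- The number of zero eigenvalues (with multiplicity) of a Hermitian matrix. -/
noncomputable def iZero {m : Type*} [Fintype m] [DecidableEq m] (A : Matrix m m ℂ) : ℕ :=
  if hA : A.IsHermitian then Nat.card {i // hA.eigenvalues i = 0} else 0

/-- The real quadratic form attached to a square complex matrix. -/
def quadForm {m : Type*} [Fintype m] (M : Matrix m m ℂ) (x : m → ℂ) : ℝ :=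
  (star x ⬝ᵥ M *ᵥ x).re

/-- `U` is a unitary matrix diagonalizing `M`, with eigenvalues `μ` in increasing order. -/
structure Diagonalizes {N : ℕ} (U M : Matrix (Fin N) (Fin N) ℂ) (μ : Fin N → ℝ) : Prop where
  isometry : Uᴴ * U = 1
  factor : M = U * Matrix.diagonal (fun i => (μ i : ℂ)) * Uᴴ
  mono : Monotone μ

/-- Every subspace of dimension larger than `n` contains a nonzero vector on which the
quadratic form of `M` is nonnegative. -/
def NegIndexLE {N : ℕ} (M : Matrix (Fin N) (Fin N) ℂ) (n : ℕ) : Prop :=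
  ∀ V : Submodule ℂ (Fin N → ℂ), n < Module.finrank ℂ V →
    ∃ x ∈ V, x ≠ 0 ∧ 0 ≤ quadForm M x

section Spectral

variable {N : ℕ} {U M : Matrix (Fin N) (Fin N) ℂ} {μ : Fin N → ℝ}

lemma quadForm_add {m : Type*} [Fintype m] (A B : Matrix m m ℂ) (x : m → ℂ) :
    quadForm (A + B) x = quadForm A x + quadForm B x := by
  simp [quadForm, Matrix.add_mulVec]

lemma quadForm_congr {m k : Type*} [Fintype m] [Fintype k] (A : Matrix k k ℂ)
    (Φ : Matrix k m ℂ) (x : m → ℂ) :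
    quadForm (Φᴴ * A * Φ) x = quadForm A (Φ *ᵥ x) := by
  simp only [quadForm, Matrix.star_mulVec, ← Matrix.mulVec_mulVec, Matrix.dotProduct_mulVec,
    Matrix.vecMul_vecMul]

lemma quadForm_real_smul {m : Type*} [Fintype m] (r : ℝ) (A : Matrix m m ℂ) (x : m → ℂ) :
    quadForm (r • A) x = r * quadForm A x := by
  simp [quadForm, Matrix.smul_mulVec]

lemma quadForm_smul_vec {m : Type*} [Fintype m] (A : Matrix m m ℂ) (c : ℂ) (x : m → ℂ) :
    quadForm A (c • x) = Complex.normSq c * quadForm A x := by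
  have : star (c • x) ⬝ᵥ A *ᵥ (c • x) = (Complex.normSq c : ℂ) * (star x ⬝ᵥ A *ᵥ x) := by
    rw [Matrix.mulVec_smul, star_smul, smul_dotProduct, dotProduct_smul, smul_smul, smul_eq_mul,
      Complex.normSq_eq_conj_mul_self]
    rfl
  rw [quadForm, this, Complex.re_ofReal_mul, quadForm]

lemma quadForm_diagonal (x : Fin N → ℂ) :
    quadForm (Matrix.diagonal (fun i => (μ i : ℂ))) x = ∑ i, μ i * Complex.normSq (x i) := by
  rw [quadForm, dotProduct, Complex.re_sum]
  refine Finset.sum_congr rfl fun i _ => ?_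
  simp [Matrix.mulVec_diagonal, Complex.normSq_apply]
  ring

namespace Diagonalizes

lemma mul_conjTranspose (hU : Diagonalizes U M μ) : U * Uᴴ = 1 :=
  mul_eq_one_comm.mp hU.isometry

lemma mulVec_conj (hU : Diagonalizes U M μ) (x : Fin N → ℂ) : U *ᵥ (Uᴴ *ᵥ x) = x := by
  rw [Matrix.mulVec_mulVec, hU.mul_conjTranspose, Matrix.one_mulVec]

lemma conj_mulVec (hU : Diagonalizes U M μ) (x : Fin N → ℂ) : Uᴴ *ᵥ (U *ᵥ x) = x := by
  rw [Matrix.mulVec_mulVec, hU.isometry, Matrix.one_mulVec]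

lemma quadForm_eq (hU : Diagonalizes U M μ) (x : Fin N → ℂ) :
    quadForm M x = ∑ i, μ i * Complex.normSq ((Uᴴ *ᵥ x) i) := by
  rw [← quadForm_diagonal, ← quadForm_congr, Matrix.conjTranspose_conjTranspose, ← hU.factor]

lemma coord_mulVec (hU : Diagonalizes U M μ) (x : Fin N → ℂ) (i : Fin N) :
    (Uᴴ *ᵥ (M *ᵥ x)) i = μ i * (Uᴴ *ᵥ x) i := by
  rw [hU.factor, ← Matrix.mulVec_mulVec, ← Matrix.mulVec_mulVec, hU.conj_mulVec,
    Matrix.mulVec_diagonal]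

lemma sub_scalar (hU : Diagonalizes U M μ) (c : ℝ) :
    Diagonalizes U (M - (c : ℂ) • (1 : Matrix (Fin N) (Fin N) ℂ)) (fun i => μ i - c) := by
  refine ⟨hU.isometry, ?_, fun i j hij => sub_le_sub_right (hU.mono hij) c⟩
  have : Matrix.diagonal (fun i => ((μ i - c : ℝ) : ℂ))
      = Matrix.diagonal (fun i => (μ i : ℂ)) - (c : ℂ) • (1 : Matrix (Fin N) (Fin N) ℂ) := by
    ext i j
    by_cases hij : i = j <;> simp [hij]
  rw [this, mul_sub, sub_mul, ← hU.factor, Matrix.mul_smul, Matrix.smul_mul, mul_one,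
    hU.mul_conjTranspose]

lemma neg_rev (hU : Diagonalizes U M μ) :
    Diagonalizes (U.submatrix id Fin.rev) (-M) (fun i => -μ i.rev) := by
  have hrev : Function.Bijective (Fin.rev : Fin N → Fin N) := Fin.rev_bijective
  refine ⟨?_, ?_, fun i j hij => neg_le_neg (hU.mono (Fin.rev_le_rev.mpr hij))⟩
  · rw [Matrix.conjTranspose_submatrix, Matrix.submatrix_mul _ _ _ _ _ Function.bijective_id |>.symm,
      hU.isometry, Matrix.submatrix_one _ hrev.1]
  · have hD : Matrix.diagonal (fun i : Fin N => ((-μ i.rev : ℝ) : ℂ))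
        = (-Matrix.diagonal (fun i => (μ i : ℂ))).submatrix Fin.rev Fin.rev := by
      ext i j
      by_cases hij : i = j <;> simp [hij]
    rw [hD, Matrix.conjTranspose_submatrix, ← Matrix.submatrix_mul _ _ _ _ _ hrev,
      ← Matrix.submatrix_mul _ _ _ _ _ hrev]
    rw [mul_neg, neg_mul, ← hU.factor, Matrix.submatrix_id_id]

/-- Vectors whose image under `Φ` has no component along eigenvectors beyond the `n`-th. -/
lemma exists_lower_subspace (U Φ : Matrix (Fin N) (Fin N) ℂ) (n : Fin N) :
    ∃ V : Submodule ℂ (Fin N → ℂ), (n : ℕ) < Module.finrank ℂ V ∧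
      ∀ x ∈ V, ∀ i, n < i → (Uᴴ *ᵥ (Φ *ᵥ x)) i = 0 := by
  let g : (Fin N → ℂ) →ₗ[ℂ] ({i : Fin N // n < i} → ℂ) :=
    LinearMap.funLeft ℂ ℂ Subtype.val ∘ₗ (Uᴴ * Φ).mulVecLin
  refine ⟨LinearMap.ker g, ?_, fun x hx i hi => ?_⟩
  · have h1 := LinearMap.finrank_range_add_finrank_ker g
    have h2 : Module.finrank ℂ (LinearMap.range g) ≤ N - 1 - n := by
      refine (Submodule.finrank_le _).trans ?_
      rw [Module.finrank_fintype_fun_eq_card, Fintype.card_subtype, Finset.filter_lt_eq_Ioi, Fin.card_Ioi]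
    rw [Module.finrank_fin_fun] at h1
    have := n.isLt
    omega
  · have := congrFun (LinearMap.mem_ker.mp hx) ⟨i, hi⟩
    simpa [g, LinearMap.funLeft_apply, Matrix.mulVec_mulVec] using this

lemma nonneg_iff (hU : Diagonalizes U M μ) (n : Fin N) : 0 ≤ μ n ↔ NegIndexLE M n := by
  constructor
  · intro h V hV
    let g : V →ₗ[ℂ] ({i : Fin N // i < n} → ℂ) :=
      LinearMap.funLeft ℂ ℂ Subtype.val ∘ₗ Uᴴ.mulVecLin ∘ₗ V.subtype
    have hg : LinearMap.ker g ≠ ⊥ := by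
      apply LinearMap.ker_ne_bot_of_finrank_lt
      rw [Module.finrank_fintype_fun_eq_card, Fintype.card_subtype, Finset.filter_gt_eq_Iio, Fin.card_Iio]
      exact hV
    obtain ⟨x, hx, hx0⟩ := (Submodule.ne_bot_iff _).mp hg
    refine ⟨x, x.2, fun h0 => hx0 (Subtype.ext h0), ?_⟩
    rw [hU.quadForm_eq]
    refine Finset.sum_nonneg fun i _ => ?_
    rcases lt_or_ge i n with hi | hi
    · have := congrFun (LinearMap.mem_ker.mp hx) ⟨i, hi⟩
      have h0 : (Uᴴ *ᵥ (x : Fin N → ℂ)) i = 0 := by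
        simpa [g, LinearMap.funLeft_apply] using this
      simp [h0]
    · exact mul_nonneg (h.trans (hU.mono hi)) (Complex.normSq_nonneg _)
  · intro h
    by_contra! hn
    obtain ⟨V, hV, hV0⟩ := exists_lower_subspace U 1 n
    obtain ⟨x, hxV, hx0, hx⟩ := h V hV
    rw [hU.quadForm_eq] at hx
    have hle : ∀ i ∈ Finset.univ, μ i * Complex.normSq ((Uᴴ *ᵥ x) i) ≤ 0 := fun i _ => by
      rcases lt_or_ge n i with hi | hi
      · have := hV0 x hxV i hi
        rw [Matrix.one_mulVec] at this
        simp [this]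
      · exact mul_nonpos_of_nonpos_of_nonneg ((hU.mono hi).trans hn.le) (Complex.normSq_nonneg _)
    have hz := (Finset.sum_eq_zero_iff_of_nonpos hle).mp
      (le_antisymm (Finset.sum_nonpos hle) hx)
    apply hx0
    rw [← hU.mulVec_conj x]
    have : Uᴴ *ᵥ x = 0 := by
      ext i
      rcases lt_or_ge n i with hi | hi
      · simpa using hV0 x hxV i hi
      · have h1 := hz i (Finset.mem_univ i)
        have h2 : μ i ≠ 0 := ((hU.mono hi).trans_lt hn).ne
        simpa [h2] using h1
    rw [this, Matrix.mulVec_zero]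

lemma unique {U' : Matrix (Fin N) (Fin N) ℂ} {ν : Fin N → ℝ} (hU : Diagonalizes U M μ)
    (hU' : Diagonalizes U' M ν) : μ = ν := by
  ext n
  have key : ∀ c : ℝ, c ≤ μ n ↔ c ≤ ν n := fun c => by
    rw [← sub_nonneg, (hU.sub_scalar c).nonneg_iff n, ← (hU'.sub_scalar c).nonneg_iff n,
      sub_nonneg]
  exact le_antisymm ((key _).mp le_rfl) ((key _).mpr le_rfl)

end Diagonalizes

lemma exists_diagonalizes (hM : M.IsHermitian) : ∃ U, Diagonalizes U M (sortedEigs M) := by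
  set σ := Tuple.sort hM.eigenvalues
  set E : Matrix (Fin N) (Fin N) ℂ := (hM.eigenvectorUnitary : Matrix (Fin N) (Fin N) ℂ)
  have hs : sortedEigs M = hM.eigenvalues ∘ σ := by rw [sortedEigs, dif_pos hM]
  have hEE : Eᴴ * E = 1 := Unitary.coe_star_mul_self hM.eigenvectorUnitary
  refine ⟨E.submatrix id σ, ?_, ?_, ?_⟩
  · rw [Matrix.conjTranspose_submatrix, ← Matrix.submatrix_mul _ _ _ _ _ Function.bijective_id,
      hEE, Matrix.submatrix_one _ σ.injective]
  · have hD : Matrix.diagonal (fun i : Fin N => (sortedEigs M i : ℂ))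
        = (Matrix.diagonal (fun i => (hM.eigenvalues i : ℂ))).submatrix σ σ := by
      rw [hs]
      ext i j
      by_cases hij : i = j <;> simp [hij]
    rw [hD, Matrix.conjTranspose_submatrix, ← Matrix.submatrix_mul _ _ _ _ _ σ.bijective,
      ← Matrix.submatrix_mul _ _ _ _ _ σ.bijective, Matrix.submatrix_id_id]
    have := hM.spectral_theorem
    rw [Unitary.conjStarAlgAut_apply] at this
    exact this
  · rw [hs]
    exact Tuple.monotone_sort _

lemma sortedEigs_neg_rev (hM : M.IsHermitian) (n : Fin N) :
    sortedEigs (-M) n.rev = -sortedEigs M n := by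
  obtain ⟨U, hU⟩ := exists_diagonalizes hM
  obtain ⟨U', hU'⟩ := exists_diagonalizes hM.neg
  simp only [hU'.unique hU.neg_rev, Fin.rev_rev]

end Spectral

section LocalAnalysis

open Filter Topology

variable {N : ℕ} {A U : Matrix (Fin N) (Fin N) ℂ} {μ : Fin N → ℝ}

lemma continuous_quadForm {m : Type*} [Fintype m] :
    Continuous fun q : Matrix m m ℂ × (m → ℂ) => quadForm q.1 q.2 := by
  unfold quadForm
  fun_prop

lemma tendsto_quadForm {ι m : Type*} [Fintype m] {l : Filter ι} {M : ι → Matrix m m ℂ}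
    {x : ι → m → ℂ} {M₀ : Matrix m m ℂ} {x₀ : m → ℂ} (hM : Tendsto M l (𝓝 M₀))
    (hx : Tendsto x l (𝓝 x₀)) :
    Tendsto (fun t => quadForm (M t) (x t)) l (𝓝 (quadForm M₀ x₀)) := by
  have h := continuous_quadForm.tendsto (M₀, x₀)
  simpa only [Function.comp_def] using h.comp (hM.prodMk_nhds hx)

/-- On vectors without components beyond the `n`-th eigenvector, the form is nonpositive. -/
lemma Diagonalizes.quadForm_nonpos_of_lower (hU : Diagonalizes U A μ) {n : Fin N} (hn : μ n = 0)
    {x : Fin N → ℂ} (hx : ∀ i, n < i → (Uᴴ *ᵥ x) i = 0) :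
    (∀ i ∈ Finset.univ, μ i * Complex.normSq ((Uᴴ *ᵥ x) i) ≤ 0) ∧ quadForm A x ≤ 0 := by
  have hterm : ∀ i ∈ Finset.univ, μ i * Complex.normSq ((Uᴴ *ᵥ x) i) ≤ 0 := fun i _ => by
    rcases lt_or_ge n i with hi | hi
    · simp [hx i hi]
    · exact mul_nonpos_of_nonpos_of_nonneg (hn ▸ hU.mono hi) (Complex.normSq_nonneg _)
  exact ⟨hterm, by rw [hU.quadForm_eq]; exact Finset.sum_nonpos hterm⟩

lemma Diagonalizes.mulVec_eq_zero_of_lower (hU : Diagonalizes U A μ) {n : Fin N} (hn : μ n = 0)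
    {x : Fin N → ℂ} (hx : ∀ i, n < i → (Uᴴ *ᵥ x) i = 0) (h0 : 0 ≤ quadForm A x) :
    A *ᵥ x = 0 := by
  obtain ⟨hterm, hle⟩ := hU.quadForm_nonpos_of_lower hn hx
  have hsum := le_antisymm hle h0
  rw [hU.quadForm_eq] at hsum
  have hz := (Finset.sum_eq_zero_iff_of_nonpos hterm).mp hsum
  have : Uᴴ *ᵥ (A *ᵥ x) = 0 := by
    ext i
    rw [hU.coord_mulVec]
    rcases mul_eq_zero.mp (hz i (Finset.mem_univ i)) with h | h
    · simp [h]
    · simp [Complex.normSq_eq_zero.mp h]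
  rw [← hU.mulVec_conj (A *ᵥ x), this, Matrix.mulVec_zero]

lemma NegIndexLE.exists_unit_lower {Φ G : Matrix (Fin N) (Fin N) ℂ} {n : Fin N} {r : ℝ}
    (h : NegIndexLE (Φᴴ * A * Φ + r • G) n) (U : Matrix (Fin N) (Fin N) ℂ) :
    ∃ x : Fin N → ℂ, ‖x‖ = 1 ∧ (∀ i, n < i → (Uᴴ *ᵥ (Φ *ᵥ x)) i = 0) ∧
      0 ≤ quadForm A (Φ *ᵥ x) + r * quadForm G x := by
  obtain ⟨V, hV, hV0⟩ := Diagonalizes.exists_lower_subspace U Φ n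
  obtain ⟨x, hxV, hx0, hx⟩ := h V hV
  refine ⟨((‖x‖⁻¹ : ℝ) : ℂ) • x, ?_, hV0 _ (V.smul_mem _ hxV), ?_⟩
  · rw [norm_smul, Complex.norm_real, norm_inv, norm_norm,
      inv_mul_cancel₀ (norm_ne_zero_iff.mpr hx0)]
  · rw [quadForm_add, quadForm_congr, quadForm_real_smul] at hx
    rw [Matrix.mulVec_smul, quadForm_smul_vec, quadForm_smul_vec, mul_left_comm, ← mul_add]
    exact mul_nonneg (Complex.normSq_nonneg _) hx

/-- First-order trial-vector inequality: if `λₙ(A) = 0` is simple with eigenvector `f`, and the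
`n`-th eigenvalue of a small perturbation of `A` stays nonnegative, then the leading part of the
perturbation is nonnegative at `f`. -/
lemma quadForm_nonneg_of_tendsto (hU : Diagonalizes U A μ) {n : Fin N} (hn : μ n = 0)
    {f : Fin N → ℂ} (hker : ∀ x, A *ᵥ x = 0 → ∃ c : ℂ, x = c • f)
    {Φ G : ℝ → Matrix (Fin N) (Fin N) ℂ} {G₀ : Matrix (Fin N) (Fin N) ℂ} {k : ℕ} (hk : k ≠ 0)
    (hΦ : Tendsto Φ (𝓝[>] 0) (𝓝 1)) (hG : Tendsto G (𝓝[>] 0) (𝓝 G₀))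
    (hF : ∀ᶠ t in 𝓝[>] (0 : ℝ), NegIndexLE ((Φ t)ᴴ * A * Φ t + t ^ k • G t) n) :
    0 ≤ quadForm G₀ f := by
  obtain ⟨x, hx⟩ := (hF.mono fun t ht => ht.exists_unit_lower U).choice
  obtain ⟨F, hFle⟩ := Ultrafilter.exists_le (𝓝[>] (0 : ℝ))
  have hxF := hx.filter_mono hFle
  have hpos : ∀ᶠ t in (F : Filter ℝ), t ∈ Set.Ioi 0 :=
    (eventually_mem_nhdsWithin (a := (0 : ℝ))).filter_mono hFle
  obtain ⟨x₀, hx₀, hlim⟩ := (isCompact_sphere (0 : Fin N → ℂ) 1).ultrafilter_le_nhds (F.map x) (by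
    rw [Ultrafilter.coe_map, le_principal_iff, mem_map]
    filter_upwards [hxF] with t ht
    simpa using ht.1)
  have hxlim : Tendsto x F (𝓝 x₀) := hlim
  have hΦF := hΦ.mono_left hFle
  have hGF := hG.mono_left hFle
  have hΦx : Tendsto (fun t => Φ t *ᵥ x t) F (𝓝 x₀) := by
    have hc : Continuous fun q : Matrix (Fin N) (Fin N) ℂ × (Fin N → ℂ) => q.1 *ᵥ q.2 := by
      fun_prop
    have := (hc.tendsto (1, x₀)).comp (hΦF.prodMk_nhds hxlim)
    rwa [Matrix.one_mulVec] at this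
  have hcoord : ∀ i, Tendsto (fun t => (Uᴴ *ᵥ (Φ t *ᵥ x t)) i) F (𝓝 ((Uᴴ *ᵥ x₀) i)) := fun i => by
    have hc : Continuous fun y : Fin N → ℂ => (Uᴴ *ᵥ y) i := by fun_prop
    exact (hc.tendsto x₀).comp hΦx
  have hupper : ∀ i, n < i → (Uᴴ *ᵥ x₀) i = 0 := fun i hi =>
    tendsto_nhds_unique (hcoord i)
      (tendsto_const_nhds.congr' (hxF.mono fun t ht => (ht.2.1 i hi).symm))
  have hGx : Tendsto (fun t => quadForm (G t) (x t)) F (𝓝 (quadForm G₀ x₀)) :=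
    tendsto_quadForm hGF hxlim
  have hAx : Tendsto (fun t => quadForm A (Φ t *ᵥ x t)) F (𝓝 (quadForm A x₀)) :=
    tendsto_quadForm tendsto_const_nhds hΦx
  have hGnonneg : 0 ≤ quadForm G₀ x₀ := by
    refine ge_of_tendsto hGx ?_
    filter_upwards [hxF, hpos] with t ht ht0
    have h1 := (hU.quadForm_nonpos_of_lower hn ht.2.1).2
    have h2 := ht.2.2
    exact nonneg_of_mul_nonneg_right (by linarith) (pow_pos (Set.mem_Ioi.mp ht0) k)
  have hAnonneg : 0 ≤ quadForm A x₀ := by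
    have ht : Tendsto (fun t : ℝ => t) F (𝓝 0) :=
      tendsto_id'.mpr (hFle.trans nhdsWithin_le_nhds)
    have h1 := hAx.add ((ht.pow k).mul hGx)
    rw [zero_pow hk, zero_mul, add_zero] at h1
    exact ge_of_tendsto h1 (hxF.mono fun t ht => ht.2.2)
  obtain ⟨c, rfl⟩ := hker x₀ (hU.mulVec_eq_zero_of_lower hn hupper hAnonneg)
  have hc : c ≠ 0 := by
    rintro rfl
    simp at hx₀
  rw [quadForm_smul_vec] at hGnonneg
  exact nonneg_of_mul_nonneg_right hGnonneg (Complex.normSq_pos.mpr hc)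

end LocalAnalysis

section LinearAlgebra

variable {N : ℕ} {A U : Matrix (Fin N) (Fin N) ℂ} {μ : Fin N → ℝ}

lemma NegIndexLE.of_congr {M Φ : Matrix (Fin N) (Fin N) ℂ} {n : ℕ} (hA : NegIndexLE A n)
    (h : ∀ x, quadForm A (Φ *ᵥ x) ≤ quadForm M x) : NegIndexLE M n := by
  intro V hV
  by_contra! hneg
  have hinj : Function.Injective (Φ.mulVecLin.domRestrict V) := by
    rw [← LinearMap.ker_eq_bot, LinearMap.ker_eq_bot']
    intro x hx
    by_contra hx0
    have h1 := hneg x x.2 fun h0 => hx0 (Subtype.ext h0)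
    have h2 := h x
    have h3 : Φ *ᵥ (x : Fin N → ℂ) = 0 := hx
    rw [h3] at h2
    simp [quadForm] at h2 h1
    linarith
  obtain ⟨_, ⟨x, rfl⟩, hx0, hx⟩ := hA (LinearMap.range (Φ.mulVecLin.domRestrict V))
    (by rwa [LinearMap.finrank_range_of_inj hinj])
  have h1 := hneg x x.2 fun h0 => hx0 (by
    have : x = 0 := Subtype.ext h0
    rw [this, map_zero])
  exact absurd (hx.trans (h x)) (not_le.mpr h1)

namespace Diagonalizes

variable {n : Fin N} {f : Fin N → ℂ}

lemma exists_smul_of_mulVec_eq_zero (hU : Diagonalizes U A μ) (hne : ∀ i, i ≠ n → μ i ≠ 0)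
    (hf : A *ᵥ f = 0) (hf0 : f ≠ 0) {x : Fin N → ℂ} (hx : A *ᵥ x = 0) : ∃ c : ℂ, x = c • f := by
  have hcoord : ∀ y : Fin N → ℂ, A *ᵥ y = 0 → ∀ i, i ≠ n → (Uᴴ *ᵥ y) i = 0 := fun y hy i hi => by
    have := hU.coord_mulVec y i
    rw [hy, Matrix.mulVec_zero] at this
    simpa [hne i hi] using this.symm
  have hfn : (Uᴴ *ᵥ f) n ≠ 0 := fun h0 => hf0 <| by
    rw [← hU.mulVec_conj f]
    have : Uᴴ *ᵥ f = 0 := by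
      ext i
      by_cases hi : i = n
      · rw [hi, h0, Pi.zero_apply]
      · exact hcoord f hf i hi
    rw [this, Matrix.mulVec_zero]
  refine ⟨(Uᴴ *ᵥ x) n / (Uᴴ *ᵥ f) n, ?_⟩
  have hUx : Uᴴ *ᵥ x = ((Uᴴ *ᵥ x) n / (Uᴴ *ᵥ f) n) • (Uᴴ *ᵥ f) := by
    ext i
    by_cases hi : i = n
    · subst hi
      simp [hfn]
    · simp [hcoord x hx i hi, hcoord f hf i hi]
  calc x = U *ᵥ (Uᴴ *ᵥ x) := (hU.mulVec_conj x).symm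
    _ = ((Uᴴ *ᵥ x) n / (Uᴴ *ᵥ f) n) • f := by rw [hUx, Matrix.mulVec_smul, hU.mulVec_conj, ← hUx]

lemma exists_mulVec_eq (hU : Diagonalizes U A μ) (hn : μ n = 0) (hne : ∀ i, i ≠ n → μ i ≠ 0)
    (hf : A *ᵥ f = 0) (hf0 : f ≠ 0) {b : Fin N → ℂ} (hb : star f ⬝ᵥ b = 0) :
    ∃ x, A *ᵥ x = b := by
  have hcol : A *ᵥ (U *ᵥ Pi.single n 1) = 0 := by
    rw [← hU.mulVec_conj (A *ᵥ _)]
    have : Uᴴ *ᵥ (A *ᵥ (U *ᵥ Pi.single n 1)) = 0 := by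
      ext i
      rw [hU.coord_mulVec, hU.conj_mulVec]
      by_cases hi : i = n
      · simp [hi, hn]
      · simp [hi]
    rw [this, Matrix.mulVec_zero]
  obtain ⟨c, hc⟩ := hU.exists_smul_of_mulVec_eq_zero hne hf hf0 hcol
  have hbn : (Uᴴ *ᵥ b) n = 0 := by
    have : (Uᴴ *ᵥ b) n = star (U *ᵥ Pi.single n 1) ⬝ᵥ b := by
      rw [Matrix.star_mulVec, ← Matrix.dotProduct_mulVec, Pi.star_single, star_one,
        single_dotProduct, one_mul]
    rw [this, hc, star_smul, smul_dotProduct, hb, smul_zero]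
  refine ⟨U *ᵥ fun i => (Uᴴ *ᵥ b) i / μ i, ?_⟩
  rw [← hU.mulVec_conj b, ← hU.mulVec_conj (A *ᵥ _)]
  congr 1
  ext i
  rw [hU.coord_mulVec, hU.conj_mulVec, hU.conj_mulVec]
  by_cases hi : i = n
  · rw [hi, hbn, hn]
    simp
  · have : (μ i : ℂ) ≠ 0 := by exact_mod_cast hne i hi
    field_simp

end Diagonalizes

end LinearAlgebra

section Edge

open Filter Topology

variable {N : ℕ}

/-- The matrix of a crossing edge `(u, v)` with complex weight `p`, twisted by the phase `δ`. -/
def edgeMatrix (u v : Fin N) (p : ℂ) (δ : ℝ) : Matrix (Fin N) (Fin N) ℂ :=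
  Matrix.single u v (p * Complex.exp (Complex.I * (δ : ℂ))) +
    Matrix.single v u ((starRingEnd ℂ) p * Complex.exp (-(Complex.I * (δ : ℂ))))

/-- The derivative of `edgeMatrix u v p` at phase zero, applied to `f`. -/
def edgeDeriv (u v : Fin N) (p : ℂ) (f : Fin N → ℂ) : Fin N → ℂ :=
  Pi.single u (Complex.I * p * f v) - Pi.single v (Complex.I * (starRingEnd ℂ) p * f u)

/-- The hopping term `p * conj (f u) * f v` of the edge `(u, v)` in the state `f`. -/
def edgeFlux (u v : Fin N) (p : ℂ) (f : Fin N → ℂ) : ℂ :=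
  p * (starRingEnd ℂ) (f u) * f v

/-- The family `ℓ` exhibits the variation of the edge matrix as a completed square built from
`edgeDeriv` and `edgeFlux`. -/
structure EdgeFactor (u v : Fin N) (p : ℂ) (f : Fin N → ℂ) (ℓ : ℝ → Fin N → ℂ)
    (w : Fin N → ℂ) : Prop where
  factor : ∀ δ, edgeMatrix u v p δ - edgeMatrix u v p 0 =
    Matrix.vecMulVec (edgeDeriv u v p f) (star (ℓ δ)) +
      Matrix.vecMulVec (ℓ δ) (star (edgeDeriv u v p f)) -
      edgeFlux u v p f • Matrix.vecMulVec (ℓ δ) (star (ℓ δ))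
  pairing : star w ⬝ᵥ f = 1
  slope : ∀ c : ℝ, Tendsto (fun t : ℝ => t⁻¹ • ℓ (t * c)) (𝓝[>] 0) (𝓝 (c • w))
  conj_pairing : ∀ δ : ℝ, p * Complex.exp (Complex.I * (δ : ℂ)) = (starRingEnd ℂ) p →
    star (edgeDeriv u v p f) ⬝ᵥ star f = edgeFlux u v p f * (star (ℓ δ) ⬝ᵥ star f)
  phase_eq_one : ∀ δ : ℝ, star (ℓ δ) ⬝ᵥ star f = 0 → Complex.exp (Complex.I * (δ : ℂ)) = 1

lemma vecMulVec_single_single (i j : Fin N) (a b : ℂ) :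
    Matrix.vecMulVec (Pi.single i a) (Pi.single j b) = Matrix.single i j (a * b) := by
  ext k l
  rw [Matrix.vecMulVec_apply, Matrix.single_apply, Pi.single_apply, Pi.single_apply]
  split_ifs <;> simp_all

lemma single_sub (i j : Fin N) (a b : ℂ) :
    Matrix.single i j (a - b) = Matrix.single i j a - Matrix.single i j b := by
  rw [eq_sub_iff_add_eq, ← Matrix.single_add, sub_add_cancel]

lemma tendsto_slope_exp (a : ℂ) (c : ℝ) :
    Tendsto (fun t : ℝ => t⁻¹ • (Complex.exp (a * ((t * c : ℝ) : ℂ)) - 1)) (𝓝[>] 0)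
      (𝓝 (a * c)) := by
  have h1 : HasDerivAt (fun t : ℝ => Complex.exp (a * ((t * c : ℝ) : ℂ))) (a * c) 0 := by
    have h0 : HasDerivAt (fun t : ℝ => a * ((t * c : ℝ) : ℂ)) (a * c) 0 := by
      have := ((hasDerivAt_id (0 : ℝ)).mul_const c).ofReal_comp.const_mul a
      simpa using this
    simpa using h0.cexp
  have h2 := h1.tendsto_slope_zero_right
  simpa using h2

lemma conj_exp_I_mul (δ : ℝ) : (starRingEnd ℂ) (Complex.exp (Complex.I * (δ : ℂ)))
    = Complex.exp (-(Complex.I * (δ : ℂ))) := by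
  rw [← Complex.exp_conj]
  simp

lemma exp_I_mul_mul_neg (δ : ℝ) : Complex.exp (Complex.I * (δ : ℂ))
    * Complex.exp (-(Complex.I * (δ : ℂ))) = 1 := by
  rw [← Complex.exp_add, add_neg_cancel, Complex.exp_zero]

lemma exists_edgeFactor_of_ne_zero_right (u v : Fin N) (p : ℂ) (f : Fin N → ℂ)
    (hρ : (starRingEnd ℂ) (edgeFlux u v p f) = edgeFlux u v p f) (hv : f v ≠ 0) :
    ∃ ℓ w, EdgeFactor u v p f ℓ w := by
  have hv' : (starRingEnd ℂ) (f v) ≠ 0 := (map_ne_zero _).mpr hv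
  let κ : ℝ → ℂ := fun δ => -Complex.I * (Complex.exp (Complex.I * (δ : ℂ)) - 1)
  have hκ : ∀ δ : ℝ, (starRingEnd ℂ) (κ δ)
      = Complex.I * (Complex.exp (-(Complex.I * (δ : ℂ))) - 1) := fun δ => by
    simp only [κ, map_mul, map_sub, map_neg, Complex.conj_I, neg_neg, conj_exp_I_mul, map_one]
  refine ⟨fun δ => Pi.single v ((starRingEnd ℂ) (κ δ) / (starRingEnd ℂ) (f v)),
    Pi.single v (1 / (starRingEnd ℂ) (f v)), ?_, ?_, ?_, ?_, ?_⟩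
  · intro δ
    have hstar : star (edgeDeriv u v p f) = Pi.single u (-Complex.I * (starRingEnd ℂ) p *
        (starRingEnd ℂ) (f v)) - Pi.single v (-Complex.I * p * (starRingEnd ℂ) (f u)) := by
      simp [edgeDeriv]
    have hstar' : star (Pi.single v ((starRingEnd ℂ) (κ δ) / (starRingEnd ℂ) (f v)) : Fin N → ℂ)
        = Pi.single v (κ δ / f v) := by
      simp
    rw [hstar, hstar', edgeDeriv, Matrix.sub_vecMulVec, Matrix.vecMulVec_sub,
      vecMulVec_single_single, vecMulVec_single_single, vecMulVec_single_single,
      vecMulVec_single_single, vecMulVec_single_single, Matrix.smul_single, hκ]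
    have hee := exp_I_mul_mul_neg δ
    simp only [edgeMatrix, κ, Complex.ofReal_zero, mul_zero, neg_zero, Complex.exp_zero, mul_one]
    simp only [edgeFlux, map_mul, Complex.conj_conj] at hρ
    set E := Complex.exp (Complex.I * (δ : ℂ))
    set E' := Complex.exp (-(Complex.I * (δ : ℂ)))
    have e1 : Complex.I * p * f v * (-Complex.I * (E - 1) / f v) = p * E - p := by
      field_simp
      linear_combination (-(p * (E - 1))) * Complex.I_sq
    have e2 : Complex.I * (E' - 1) / (starRingEnd ℂ) (f v) *
        (-Complex.I * (starRingEnd ℂ) p * (starRingEnd ℂ) (f v))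
        = (starRingEnd ℂ) p * E' - (starRingEnd ℂ) p := by
      field_simp
      linear_combination (-((starRingEnd ℂ) p * (E' - 1))) * Complex.I_sq
    have e3 : Complex.I * (starRingEnd ℂ) p * f u * (-Complex.I * (E - 1) / f v) +
        Complex.I * (E' - 1) / (starRingEnd ℂ) (f v) * (-Complex.I * p * (starRingEnd ℂ) (f u)) +
        edgeFlux u v p f • (Complex.I * (E' - 1) / (starRingEnd ℂ) (f v) *
          (-Complex.I * (E - 1) / f v)) = 0 := by
      rw [edgeFlux, smul_eq_mul]
      have hsum : (starRingEnd ℂ) p * f u * (starRingEnd ℂ) (f v) * (E - 1) +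
          p * (starRingEnd ℂ) (f u) * f v * (E' - 1) +
          p * (starRingEnd ℂ) (f u) * f v * (E' - 1) * (E - 1) = 0 := by
        linear_combination (E - 1) * hρ + p * (starRingEnd ℂ) (f u) * f v * hee
      calc _ = (Complex.I * -Complex.I) *
            ((starRingEnd ℂ) p * f u * (starRingEnd ℂ) (f v) * (E - 1) +
            p * (starRingEnd ℂ) (f u) * f v * (E' - 1) +
            p * (starRingEnd ℂ) (f u) * f v * (E' - 1) * (E - 1)) /
            (f v * (starRingEnd ℂ) (f v)) := by
              field_simp
              ring
        _ = 0 := by rw [hsum, mul_zero, zero_div]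
    have e4 := congrArg (Matrix.single v v) e3
    rw [Matrix.single_add, Matrix.single_add, Matrix.single_zero] at e4
    rw [e1, e2, single_sub, single_sub, eq_neg_of_add_eq_zero_right e4]
    abel
  · simp [hv]
  · intro c
    have h := (tendsto_slope_exp (-Complex.I) c).const_mul (Complex.I / (starRingEnd ℂ) (f v))
    have h2 := ((continuous_single (A := fun _ : Fin N => ℂ) v).tendsto _).comp h
    convert h2 using 2
    · simp only [Function.comp_def, hκ, ← Pi.single_smul]
      congr 1
      simp
      ring
    · simp only [← Pi.single_smul]
      congr 1
      simp
      field_simp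
      simp
  · intro δ hδ
    simp [edgeDeriv, edgeFlux, κ, sub_dotProduct]
    field_simp
    linear_combination (starRingEnd ℂ) (f u) * hδ
  · intro δ hδ
    simpa [hv, κ, sub_eq_zero] using hδ

lemma edgeMatrix_swap (u v : Fin N) (p : ℂ) (δ : ℝ) :
    edgeMatrix v u ((starRingEnd ℂ) p) (-δ) = edgeMatrix u v p δ := by
  rw [edgeMatrix, edgeMatrix, add_comm]
  simp

lemma edgeDeriv_swap (u v : Fin N) (p : ℂ) (f : Fin N → ℂ) :
    edgeDeriv v u ((starRingEnd ℂ) p) f = -edgeDeriv u v p f := by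
  simp [edgeDeriv]

lemma exists_edgeFactor (u v : Fin N) (p : ℂ) (f : Fin N → ℂ)
    (hρ : (starRingEnd ℂ) (edgeFlux u v p f) = edgeFlux u v p f) (hnv : f u ≠ 0 ∨ f v ≠ 0) :
    ∃ ℓ w, EdgeFactor u v p f ℓ w := by
  by_cases hv : f v ≠ 0
  · exact exists_edgeFactor_of_ne_zero_right u v p f hρ hv
  have hu := hnv.resolve_right hv
  have hswap : edgeFlux v u ((starRingEnd ℂ) p) f = edgeFlux u v p f := by
    rw [← hρ]
    simp only [edgeFlux, map_mul, Complex.conj_conj]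
    ring
  obtain ⟨ℓ, w, h⟩ := exists_edgeFactor_of_ne_zero_right v u ((starRingEnd ℂ) p) f
    (by rw [hswap, hρ]) hu
  refine ⟨fun δ => -ℓ (-δ), w, ?_, h.pairing, ?_, ?_, ?_⟩
  · intro δ
    have := h.factor (-δ)
    rw [edgeMatrix_swap, ← neg_zero, edgeMatrix_swap, edgeDeriv_swap, hswap] at this
    simpa [Matrix.vecMulVec_neg, Matrix.neg_vecMulVec] using this
  · intro c
    simpa using (h.slope (-c)).neg
  · intro δ hδ
    have h1 := h.conj_pairing (-δ) (by
      have hee := exp_I_mul_mul_neg δ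
      push_cast
      rw [Complex.conj_conj, mul_neg, ← hδ]
      linear_combination p * hee)
    rw [edgeDeriv_swap, hswap] at h1
    simpa [neg_dotProduct, neg_eq_iff_eq_neg] using h1
  · intro δ hδ
    have h1 := h.phase_eq_one (-δ) (by simpa [neg_dotProduct] using hδ)
    have hee := exp_I_mul_mul_neg δ
    push_cast at h1
    rw [mul_neg] at h1
    rwa [h1, mul_one] at hee

end Edge

section SmallDimension

lemma quadForm_eq_re_add_im {m : Type*} [Fintype m] {W : Matrix m m ℂ}
    (hW : ∀ i j, (W i j).im = 0) (z : m → ℂ) :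
    quadForm W z = quadForm W (fun j => ((z j).re : ℂ)) + quadForm W (fun j => ((z j).im : ℂ)) := by
  simp only [quadForm, dotProduct, Matrix.mulVec, Finset.mul_sum, Complex.re_sum,
    ← Finset.sum_add_distrib]
  refine Finset.sum_congr rfl fun i _ => Finset.sum_congr rfl fun j _ => ?_
  simp [hW i j]

lemma two_by_two_form_nonneg {a b r s : ℝ} (ha : 0 ≤ a) (hb : 0 ≤ b) (hdet : a * b = r ^ 2 + s ^ 2)
    (x₀ y₀ x₁ y₁ : ℝ) :
    0 ≤ a * (x₀ ^ 2 + y₀ ^ 2) + b * (x₁ ^ 2 + y₁ ^ 2) +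
      2 * (r * (x₀ * x₁ + y₀ * y₁) + s * (y₀ * x₁ - x₀ * y₁)) := by
  rcases ha.eq_or_lt with rfl | ha
  · have hr : r = 0 := by nlinarith [sq_nonneg r, sq_nonneg s]
    have hs : s = 0 := by nlinarith [sq_nonneg r, sq_nonneg s]
    subst hr hs
    have := mul_nonneg hb (add_nonneg (sq_nonneg x₁) (sq_nonneg y₁))
    linarith
  · refine nonneg_of_mul_nonneg_right (a := a) ?_ ha
    have h : a * (a * (x₀ ^ 2 + y₀ ^ 2) + b * (x₁ ^ 2 + y₁ ^ 2) +
        2 * (r * (x₀ * x₁ + y₀ * y₁) + s * (y₀ * x₁ - x₀ * y₁)))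
        = (a * x₀ + r * x₁ - s * y₁) ^ 2 + (a * y₀ + r * y₁ + s * x₁) ^ 2 := by
      linear_combination (x₁ ^ 2 + y₁ ^ 2) * hdet
    rw [h]
    positivity

/-- In dimension at most two, a Hermitian matrix that is nonnegative on real vectors and is either
real or singular is positive semidefinite. -/
lemma quadForm_nonneg_of_real {d : ℕ} (hd : d ≤ 2) {W : Matrix (Fin d) (Fin d) ℂ}
    (hW : W.IsHermitian) (hreal : ∀ c : Fin d → ℝ, 0 ≤ quadForm W (fun j => (c j : ℂ)))
    {y : Fin d → ℂ} (hy : W *ᵥ y = 0) (hy0 : y = 0 → ∀ i j, (W i j).im = 0) (z : Fin d → ℂ) :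
    0 ≤ quadForm W z := by
  by_cases hyz : y = 0
  · rw [quadForm_eq_re_add_im (hy0 hyz)]
    exact add_nonneg (hreal _) (hreal _)
  have hdiag : ∀ i, (W i i).im = 0 := fun i => by
    have := congrArg Complex.im (hW.apply i i)
    simp at this
    linarith
  interval_cases d
  · simp [quadForm]
  · rw [quadForm_eq_re_add_im (fun i j => by rw [Subsingleton.elim j i]; exact hdiag i)]
    exact add_nonneg (hreal _) (hreal _)
  · have h10 : W 1 0 = (starRingEnd ℂ) (W 0 1) := (hW.apply 1 0).symm
    have hW0 : W 0 0 = ((W 0 0).re : ℂ) := Complex.ext rfl (by simp [hdiag 0])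
    have hW1 : W 1 1 = ((W 1 1).re : ℂ) := Complex.ext rfl (by simp [hdiag 1])
    have ha : 0 ≤ (W 0 0).re := by
      simpa [quadForm, dotProduct, Matrix.mulVec, Fin.sum_univ_two] using hreal ![1, 0]
    have hb : 0 ≤ (W 1 1).re := by
      simpa [quadForm, dotProduct, Matrix.mulVec, Fin.sum_univ_two] using hreal ![0, 1]
    have e0 : W 0 0 * y 0 + W 0 1 * y 1 = 0 := by
      simpa [Matrix.mulVec, dotProduct, Fin.sum_univ_two] using congrFun hy 0
    have e1 : (starRingEnd ℂ) (W 0 1) * y 0 + W 1 1 * y 1 = 0 := by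
      simpa [Matrix.mulVec, dotProduct, Fin.sum_univ_two, h10] using congrFun hy 1
    have hdetC : W 0 0 * W 1 1 - W 0 1 * (starRingEnd ℂ) (W 0 1) = 0 := by
      by_cases h1 : y 1 = 0
      · have h0 : y 0 ≠ 0 := fun h0 => hyz (by ext i; fin_cases i <;> simp [h0, h1])
        refine (mul_eq_zero.mp ?_).resolve_right h0
        linear_combination W 1 1 * e0 - W 0 1 * e1
      · refine (mul_eq_zero.mp ?_).resolve_right h1
        linear_combination W 0 0 * e1 - (starRingEnd ℂ) (W 0 1) * e0
    have hdet : (W 0 0).re * (W 1 1).re = (W 0 1).re ^ 2 + (W 0 1).im ^ 2 := by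
      rw [hW0, hW1, Complex.mul_conj, Complex.normSq_apply] at hdetC
      have := congrArg Complex.re hdetC
      simp at this
      linarith
    have := two_by_two_form_nonneg ha hb hdet (z 0).re (z 0).im (z 1).re (z 1).im
    convert this using 1
    simp [quadForm, dotProduct, Matrix.mulVec, Fin.sum_univ_two, h10, hdiag]
    ring

end SmallDimension

section Core

open Filter Topology

variable {N d : ℕ}

lemma tendsto_slope_edgeMatrix (u v : Fin N) (p : ℂ) (s : ℝ) :
    Tendsto (fun t : ℝ => t⁻¹ • (edgeMatrix u v p (t * s) - edgeMatrix u v p 0)) (𝓝[>] 0)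
      (𝓝 (Matrix.single u v (Complex.I * s * p) +
        Matrix.single v u (-Complex.I * s * (starRingEnd ℂ) p))) := by
  have hc : ∀ i j : Fin N, Continuous fun z : ℂ => Matrix.single i j z := fun i j => by
    refine continuous_matrix fun k l => ?_
    simp only [Matrix.single_apply]
    split_ifs
    · exact continuous_id
    · exact continuous_const
  have h1 := ((hc u v).tendsto _).comp ((tendsto_slope_exp Complex.I s).mul_const p)
  have h2 := ((hc v u).tendsto _).comp
    ((tendsto_slope_exp (-Complex.I) s).mul_const ((starRingEnd ℂ) p))
  refine (h1.add h2).congr fun t => ?_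
  simp only [Function.comp_apply, edgeMatrix, Complex.ofReal_zero, mul_zero, neg_zero,
    Complex.exp_zero, mul_one, smul_sub, smul_add, Matrix.smul_single, sub_mul, single_sub]
  simp only [smul_mul_assoc, one_mul, mul_comm p, mul_comm ((starRingEnd ℂ) p), neg_mul]
  abel

lemma quadForm_edge_slope (u v : Fin N) (p : ℂ) (s : ℝ) (f : Fin N → ℂ) :
    quadForm (Matrix.single u v (Complex.I * s * p) +
        Matrix.single v u (-Complex.I * s * (starRingEnd ℂ) p)) f
      = -2 * s * (edgeFlux u v p f).im := by
  simp [quadForm, Matrix.add_mulVec, Matrix.single_mulVec_eq, dotProduct_add, edgeFlux]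
  ring

end Core

section Core

open Filter Topology

variable {N d : ℕ}

lemma Diagonalizes.isHermitian {U A : Matrix (Fin N) (Fin N) ℂ} {μ : Fin N → ℝ}
    (hU : Diagonalizes U A μ) : A.IsHermitian := by
  have hD : (Matrix.diagonal fun i => (μ i : ℂ)).IsHermitian :=
    Matrix.isHermitian_diagonal_of_self_adjoint _ (by ext i; simp)
  rw [hU.factor]
  exact Matrix.isHermitian_mul_mul_conjTranspose U hD

lemma dotProduct_edgeDeriv (u v : Fin N) (p : ℂ) (f : Fin N → ℂ) :
    star f ⬝ᵥ edgeDeriv u v p f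
      = Complex.I * (edgeFlux u v p f - (starRingEnd ℂ) (edgeFlux u v p f)) := by
  simp [edgeDeriv, edgeFlux, dotProduct_sub]
  ring

lemma edgeDeriv_smul (u v : Fin N) (p c : ℂ) (f : Fin N → ℂ) :
    edgeDeriv u v p (c • f) = c • edgeDeriv u v p f := by
  simp only [edgeDeriv, smul_sub, ← Pi.single_smul, Pi.smul_apply, smul_eq_mul]
  congr 2 <;> ring

lemma star_edgeDeriv (u v : Fin N) {p : ℂ} (hp : (starRingEnd ℂ) p = p) (f : Fin N → ℂ) :
    star (edgeDeriv u v p f) = -edgeDeriv u v p (star f) := by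
  simp [edgeDeriv, hp, Pi.single_neg]
  abel

lemma mulVec_star_of_real {A : Matrix (Fin N) (Fin N) ℂ} (hA : ∀ i k, (A i k).im = 0)
    (x : Fin N → ℂ) : A *ᵥ star x = star (A *ᵥ x) := by
  ext i
  simp only [Matrix.mulVec, dotProduct, Pi.star_apply, star_sum, star_mul']
  refine Finset.sum_congr rfl fun k _ => ?_
  rw [show star (A i k) = A i k from Complex.conj_eq_iff_im.mpr (hA i k)]

/-- For a real matrix `A` with kernel spanned by `f` and real edge weights, the second-order
coupling of the edges is real. -/
lemma dotProduct_im_eq_zero_of_real {A : Matrix (Fin N) (Fin N) ℂ} {f : Fin N → ℂ}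
    (hA : ∀ i k, (A i k).im = 0) (hf : A *ᵥ f = 0) (hf0 : f ≠ 0)
    (hker : ∀ x, A *ᵥ x = 0 → ∃ c : ℂ, x = c • f) {u₁ v₁ u₂ v₂ : Fin N} {p₁ p₂ : ℂ}
    (hp₁ : (starRingEnd ℂ) p₁ = p₁) (hp₂ : (starRingEnd ℂ) p₂ = p₂) {x : Fin N → ℂ}
    (hx : A *ᵥ x = edgeDeriv u₁ v₁ p₁ f) (hb : star f ⬝ᵥ edgeDeriv u₂ v₂ p₂ f = 0) :
    (star x ⬝ᵥ edgeDeriv u₂ v₂ p₂ f).im = 0 := by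
  obtain ⟨ω, hω⟩ := hker (star f) (by rw [mulVec_star_of_real hA, hf, star_zero])
  have hω1 : ω * star ω = 1 := by
    have h1 : f = (ω * star ω) • f := by
      conv_lhs => rw [← star_star f, hω, star_smul, hω, smul_smul, mul_comm]
    by_contra hne
    have h2 : (ω * star ω - 1) • f = 0 := by rw [sub_smul, ← h1, one_smul, sub_self]
    exact (smul_eq_zero.mp h2).elim (fun h => hne (sub_eq_zero.mp h)) hf0
  obtain ⟨κ, hκ⟩ := hker (star x + ω • x) (by
    rw [Matrix.mulVec_add, Matrix.mulVec_smul, mulVec_star_of_real hA, hx,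
      star_edgeDeriv _ _ hp₁, hω, edgeDeriv_smul, neg_add_cancel])
  have hxs : x = star κ • star f - star ω • star x := by
    have := congrArg star hκ
    rw [star_add, star_star, star_smul, star_smul] at this
    rw [← this, add_sub_cancel_right]
  have hxb : x ⬝ᵥ edgeDeriv u₂ v₂ p₂ f = -(star ω * (star x ⬝ᵥ edgeDeriv u₂ v₂ p₂ f)) := by
    conv_lhs => rw [hxs]
    rw [sub_dotProduct, smul_dotProduct, smul_dotProduct, hb, smul_zero, zero_sub, smul_eq_mul]
  rw [← Complex.conj_eq_iff_im]
  change star _ = _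
  have hstar : star (star x ⬝ᵥ edgeDeriv u₂ v₂ p₂ f) = x ⬝ᵥ star (edgeDeriv u₂ v₂ p₂ f) := by
    rw [Matrix.star_dotProduct, star_star, dotProduct_comm]
  rw [hstar, star_edgeDeriv _ _ hp₂, hω, edgeDeriv_smul, dotProduct_neg, dotProduct_smul, hxb,
    smul_eq_mul]
  linear_combination (star x ⬝ᵥ edgeDeriv u₂ v₂ p₂ f) * hω1

/-- A simple eigenvalue whose index stays constrained for all small phases satisfies the same
constraint for all phases, when there are at most two edges and the family is invariant under
complex conjugation. -/
theorem negIndexLE_of_eventually (hd : d ≤ 2) {A U : Matrix (Fin N) (Fin N) ℂ} {μ : Fin N → ℝ}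
    (hU : Diagonalizes U A μ) {n : Fin N} (hn : μ n = 0) (hne : ∀ i, i ≠ n → μ i ≠ 0)
    {f : Fin N → ℂ} (hf : A *ᵥ f = 0) (hf0 : f ≠ 0) {u v : Fin d → Fin N} {p : Fin d → ℂ}
    (hnv : ∀ j, f (u j) ≠ 0 ∨ f (v j) ≠ 0) {F : (Fin d → ℝ) → Matrix (Fin N) (Fin N) ℂ}
    (hF : ∀ δ, F δ = A + ∑ j, (edgeMatrix (u j) (v j) (p j) (δ j) - edgeMatrix (u j) (v j) (p j) 0))
    (hloc : ∀ᶠ δ in 𝓝 0, NegIndexLE (F δ) n) {δ' : Fin d → ℝ}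
    (hδ' : ∀ j, p j * Complex.exp (Complex.I * (δ' j : ℂ)) = (starRingEnd ℂ) (p j))
    (hFδ' : F δ' *ᵥ star f = 0)
    (hreal : (∀ j, Complex.exp (Complex.I * (δ' j : ℂ)) = 1) → ∀ i k, (A i k).im = 0)
    (δ : Fin d → ℝ) : NegIndexLE (F δ) n := by
  have hA := hU.isHermitian
  have hker : ∀ x, A *ᵥ x = 0 → ∃ c : ℂ, x = c • f := fun x hx =>
    hU.exists_smul_of_mulVec_eq_zero hne hf hf0 hx
  -- criticality: the flux through every edge is real
  have hslope : ∀ j, ∀ s : ℝ, 0 ≤ -2 * s * (edgeFlux (u j) (v j) (p j) f).im := fun j s => by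
    rw [← quadForm_edge_slope]
    refine quadForm_nonneg_of_tendsto hU hn hker (Φ := fun _ => 1) one_ne_zero tendsto_const_nhds
      (tendsto_slope_edgeMatrix (u j) (v j) (p j) s) ?_
    have hlim : Tendsto (fun t : ℝ => (Pi.single j (t * s) : Fin d → ℝ)) (𝓝[>] 0) (𝓝 0) := by
      have hc : Continuous fun t : ℝ => (Pi.single j (t * s) : Fin d → ℝ) :=
        (continuous_single (A := fun _ : Fin d => ℝ) j).comp (continuous_id.mul continuous_const)
      have := hc.tendsto 0
      simp only [zero_mul, Pi.single_zero] at this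
      exact this.mono_left nhdsWithin_le_nhds
    filter_upwards [hlim.eventually hloc, self_mem_nhdsWithin] with t ht ht0
    have ht0' : t ≠ 0 := (Set.mem_Ioi.mp ht0).ne'
    rw [hF, Finset.sum_eq_single j (fun k _ hk => by simp [hk]) (by simp)] at ht
    simpa [ht0'] using ht
  have hρ : ∀ j, (starRingEnd ℂ) (edgeFlux (u j) (v j) (p j) f)
      = edgeFlux (u j) (v j) (p j) f := fun j => by
    rw [Complex.conj_eq_iff_im]
    linarith [hslope j 1, hslope j (-1)]
  choose ℓ w hedge using fun j => exists_edgeFactor (u j) (v j) (p j) f (hρ j) (hnv j)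
  have hb : ∀ j, star f ⬝ᵥ edgeDeriv (u j) (v j) (p j) f = 0 := fun j => by
    rw [dotProduct_edgeDeriv, hρ, sub_self, mul_zero]
  choose x hx using fun j => hU.exists_mulVec_eq hn hne hf hf0 (hb j)
  let B : Matrix (Fin N) (Fin d) ℂ := Matrix.of fun i j => edgeDeriv (u j) (v j) (p j) f i
  let X : Matrix (Fin N) (Fin d) ℂ := Matrix.of fun i j => x j i
  let R : Matrix (Fin d) (Fin d) ℂ := Matrix.diagonal fun j => edgeFlux (u j) (v j) (p j) f
  let L : (Fin d → ℝ) → Matrix (Fin d) (Fin N) ℂ := fun δ => Matrix.of fun j i => star (ℓ j (δ j) i)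
  let W : Matrix (Fin d) (Fin d) ℂ := -R - Xᴴ * A * X
  have hAX : A * X = B := by
    ext i j
    exact congrFun (hx j) i
  have hXA : Xᴴ * A = Bᴴ := by rw [← hAX, Matrix.conjTranspose_mul, hA.eq]
  have hRH : R.IsHermitian :=
    Matrix.isHermitian_diagonal_of_self_adjoint _ (by ext j; exact hρ j)
  have hWH : W.IsHermitian := hRH.neg.sub (Matrix.isHermitian_conjTranspose_mul_mul X hA)
  have hFL : ∀ δ, F δ = A + (B * L δ + (L δ)ᴴ * Bᴴ - (L δ)ᴴ * R * L δ) := fun δ => by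
    rw [hF]
    congr 1
    rw [Finset.sum_congr rfl fun j _ => (hedge j).factor (δ j)]
    ext i k
    simp only [Matrix.sum_apply, Matrix.sub_apply, Matrix.add_apply, Matrix.smul_apply,
      Matrix.vecMulVec_apply, Matrix.mul_apply, Matrix.diagonal_apply, R, B, L, Matrix.of_apply,
      Matrix.conjTranspose_apply, Finset.sum_sub_distrib, Finset.sum_add_distrib, Pi.star_apply,
      star_star, smul_eq_mul, mul_ite, mul_zero, Finset.sum_ite_eq', Finset.mem_univ, if_true]
    congr 1
    exact Finset.sum_congr rfl fun j _ => by ring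
  have hsquare : ∀ δ, F δ = (1 + X * L δ)ᴴ * A * (1 + X * L δ) + (L δ)ᴴ * W * L δ := fun δ => by
    have h1 : (L δ)ᴴ * Xᴴ * A * (X * L δ) = (L δ)ᴴ * (Xᴴ * A * X) * L δ := by
      simp only [Matrix.mul_assoc]
    have h2 : A * (X * L δ) = B * L δ := by rw [← Matrix.mul_assoc, hAX]
    have h3 : (L δ)ᴴ * Xᴴ * A = (L δ)ᴴ * Bᴴ := by rw [Matrix.mul_assoc, hXA]
    rw [hFL, Matrix.conjTranspose_add, Matrix.conjTranspose_one, Matrix.conjTranspose_mul,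
      Matrix.add_mul, Matrix.add_mul, Matrix.mul_add, Matrix.mul_add, Matrix.one_mul,
      Matrix.mul_one, Matrix.mul_one, h1, h2, h3]
    simp only [W, Matrix.mul_sub, Matrix.sub_mul, Matrix.mul_neg, Matrix.neg_mul]
    abel
  -- the Hessian is nonnegative on real directions
  have hWreal : ∀ c : Fin d → ℝ, 0 ≤ quadForm W (fun j => (c j : ℂ)) := fun c => by
    let L₀ : Matrix (Fin d) (Fin N) ℂ := Matrix.of fun j i => star ((c j • w j) i)
    have hL₀ : L₀ *ᵥ f = fun j => (c j : ℂ) := by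
      ext j
      have : (L₀ *ᵥ f) j = star (c j • w j) ⬝ᵥ f := rfl
      rw [this, star_smul, smul_dotProduct, (hedge j).pairing]
      simp
    have hLlim : Tendsto (fun t : ℝ => t⁻¹ • L (t • c)) (𝓝[>] 0) (𝓝 L₀) := by
      refine tendsto_pi_nhds.mpr fun j => tendsto_pi_nhds.mpr fun i => ?_
      have := (tendsto_pi_nhds.mp ((hedge j).slope (c j)) i).star
      refine this.congr fun t => ?_
      simp [L]
    have hid : Tendsto (fun t : ℝ => t) (𝓝[>] 0) (𝓝 0) := nhdsWithin_le_nhds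
    have hΦ : Tendsto (fun t : ℝ => 1 + X * (t • (t⁻¹ • L (t • c)))) (𝓝[>] 0) (𝓝 1) := by
      have hcont : Continuous fun Y : Matrix (Fin d) (Fin N) ℂ => 1 + X * Y := by fun_prop
      have := (hcont.tendsto _).comp (hid.smul hLlim)
      simpa only [zero_smul, Matrix.mul_zero, add_zero, Function.comp_def] using this
    have hG : Tendsto (fun t : ℝ => (t⁻¹ • L (t • c))ᴴ * W * (t⁻¹ • L (t • c))) (𝓝[>] 0)
        (𝓝 (L₀ᴴ * W * L₀)) := by
      have hcont : Continuous fun Y : Matrix (Fin d) (Fin N) ℂ => Yᴴ * W * Y := by fun_prop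
      exact (hcont.tendsto _).comp hLlim
    have key := quadForm_nonneg_of_tendsto hU hn hker two_ne_zero hΦ hG (by
      have hlim : Tendsto (fun t : ℝ => t • c) (𝓝[>] 0) (𝓝 0) := by
        have := hid.smul_const c
        rwa [zero_smul] at this
      filter_upwards [hlim.eventually hloc, self_mem_nhdsWithin] with t ht ht0
      have ht0' : t ≠ 0 := (Set.mem_Ioi.mp ht0).ne'
      rw [hsquare] at ht
      have e1 : t • t⁻¹ • L (t • c) = L (t • c) := smul_inv_smul₀ ht0' _
      have e2 : t ^ 2 • ((t⁻¹ • L (t • c))ᴴ * W * (t⁻¹ • L (t • c)))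
          = (L (t • c))ᴴ * W * L (t • c) := by
        rw [Matrix.conjTranspose_smul, star_trivial, Matrix.smul_mul, Matrix.smul_mul,
          Matrix.mul_smul, smul_smul, smul_smul]
        rw [show t ^ 2 * t⁻¹ * t⁻¹ = 1 by field_simp, one_smul]
      rwa [e1, e2])
    rwa [quadForm_congr, hL₀] at key
  -- complex conjugation yields a null vector of `W`
  let y : Fin d → ℂ := L δ' *ᵥ star f
  have hy : ∀ j, y j = star (ℓ j (δ' j)) ⬝ᵥ star f := fun j => rfl
  have hBy : Bᴴ *ᵥ star f = R *ᵥ y := by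
    ext j
    rw [Matrix.mulVec_diagonal, hy, ← (hedge j).conj_pairing (δ' j) (hδ' j)]
    rfl
  have hAy : A *ᵥ star f + B *ᵥ y = 0 := by
    have := hFδ'
    rw [hFL, Matrix.add_mulVec, Matrix.sub_mulVec, Matrix.add_mulVec, ← Matrix.mulVec_mulVec,
      ← Matrix.mulVec_mulVec, ← Matrix.mulVec_mulVec, ← Matrix.mulVec_mulVec, hBy] at this
    simpa [y] using this
  have hWy : W *ᵥ y = 0 := by
    have h1 : (Xᴴ * A * X) *ᵥ y = -(Bᴴ *ᵥ star f) := by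
      rw [Matrix.mul_assoc, hAX, ← Matrix.mulVec_mulVec, eq_neg_of_add_eq_zero_right hAy,
        Matrix.mulVec_neg, Matrix.mulVec_mulVec, hXA]
    rw [Matrix.sub_mulVec, h1, hBy, Matrix.neg_mulVec, sub_neg_eq_add, neg_add_cancel]
  have hW0 : y = 0 → ∀ i j, (W i j).im = 0 := fun hy0 i j => by
    have hphase : ∀ j, Complex.exp (Complex.I * (δ' j : ℂ)) = 1 := fun j =>
      (hedge j).phase_eq_one (δ' j) (by rw [← hy, hy0, Pi.zero_apply])
    have hp : ∀ j, (starRingEnd ℂ) (p j) = p j := fun j => by rw [← hδ' j, hphase, mul_one]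
    have h1 := dotProduct_im_eq_zero_of_real (hreal hphase) hf hf0 hker (hp i) (hp j) (hx i) (hb j)
    have h2 : (Xᴴ * A * X) i j = star (x i) ⬝ᵥ edgeDeriv (u j) (v j) (p j) f := by
      rw [Matrix.mul_assoc, hAX]
      rfl
    have h3 : (R i j).im = 0 := by
      by_cases hij : i = j
      · subst hij
        simp only [R, Matrix.diagonal_apply_eq]
        exact Complex.conj_eq_iff_im.mp (hρ i)
      · simp only [R, Matrix.diagonal_apply_ne _ hij, Complex.zero_im]
    simp [W, h2, h1, h3]
  refine NegIndexLE.of_congr ((hU.nonneg_iff n).mp hn.ge) (Φ := 1 + X * L δ) fun z => ?_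
  rw [hsquare δ, quadForm_add, quadForm_congr, quadForm_congr]
  exact le_add_of_nonneg_right (quadForm_nonneg_of_real hd hWH hWreal hWy hW0 _)

end Core

section Band

open Filter Topology

variable {N d : ℕ}

lemma edgeMatrix_mul_exp (u v : Fin N) (p : ℂ) (a δ : ℝ) :
    edgeMatrix u v (p * Complex.exp (Complex.I * (a : ℂ))) δ = edgeMatrix u v p (a + δ) := by
  have h1 : p * Complex.exp (Complex.I * (a : ℂ)) * Complex.exp (Complex.I * (δ : ℂ))
      = p * Complex.exp (Complex.I * ((a + δ : ℝ) : ℂ)) := by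
    rw [mul_assoc, ← Complex.exp_add, Complex.ofReal_add, mul_add]
  have h2 : (starRingEnd ℂ) (p * Complex.exp (Complex.I * (a : ℂ))) *
      Complex.exp (-(Complex.I * (δ : ℂ)))
      = (starRingEnd ℂ) p * Complex.exp (-(Complex.I * ((a + δ : ℝ) : ℂ))) := by
    rw [map_mul, conj_exp_I_mul, mul_assoc, ← Complex.exp_add, Complex.ofReal_add, mul_add,
      neg_add]
  rw [edgeMatrix, edgeMatrix, h1, h2]

lemma edgeMatrix_isHermitian (u v : Fin N) (p : ℂ) (δ : ℝ) : (edgeMatrix u v p δ).IsHermitian := by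
  rw [Matrix.IsHermitian, edgeMatrix, Matrix.conjTranspose_add, Matrix.conjTranspose_single,
    Matrix.conjTranspose_single, add_comm, ← conj_exp_I_mul]
  simp

lemma edgeMatrix_neg_phase (u v : Fin N) {p : ℂ} (hp : (starRingEnd ℂ) p = p) (δ : ℝ) :
    edgeMatrix u v p (-δ) = (edgeMatrix u v p δ).map star := by
  change _ = (edgeMatrix u v p δ).map (starRingEnd ℂ)
  rw [edgeMatrix, edgeMatrix, Matrix.map_add _ (map_add _), Matrix.map_single, Matrix.map_single]
  simp [hp, ← Complex.exp_conj]

lemma edgeMatrix_neg_weight (u v : Fin N) (p : ℂ) (δ : ℝ) :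
    edgeMatrix u v (-p) δ = -edgeMatrix u v p δ := by
  simp [edgeMatrix, Matrix.single_neg, add_comm]

/-- The Hermitian matrix `T₀` perturbed by the crossing edges with phases `α`. -/
def twistedMatrix (T₀ : Matrix (Fin N) (Fin N) ℂ) (u v : Fin d → Fin N) (h : Fin d → ℂ)
    (α : Fin d → ℝ) : Matrix (Fin N) (Fin N) ℂ :=
  T₀ + ∑ j, edgeMatrix (u j) (v j) (h j) (α j)

lemma twistedMatrix_isHermitian {T₀ : Matrix (Fin N) (Fin N) ℂ} (hT₀ : T₀.IsHermitian)
    (u v : Fin d → Fin N) (h : Fin d → ℂ) (α : Fin d → ℝ) :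
    (twistedMatrix T₀ u v h α).IsHermitian := by
  refine hT₀.add ?_
  rw [Matrix.IsHermitian, Matrix.conjTranspose_sum]
  exact Finset.sum_congr rfl fun j _ => edgeMatrix_isHermitian _ _ _ _

lemma twistedMatrix_neg (T₀ : Matrix (Fin N) (Fin N) ℂ) (u v : Fin d → Fin N) (h : Fin d → ℂ)
    (α : Fin d → ℝ) :
    twistedMatrix (-T₀) u v (fun j => -h j) α = -twistedMatrix T₀ u v h α := by
  simp only [twistedMatrix, edgeMatrix_neg_weight, Finset.sum_neg_distrib, neg_add]

lemma twistedMatrix_neg_phase {T₀ : Matrix (Fin N) (Fin N) ℂ} (hT₀ : ∀ i k, (T₀ i k).im = 0)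
    (u v : Fin d → Fin N) {h : Fin d → ℂ} (hh : ∀ j, (h j).im = 0) (α : Fin d → ℝ) :
    twistedMatrix T₀ u v h (-α) = (twistedMatrix T₀ u v h α).map star := by
  ext i k
  simp only [twistedMatrix, Pi.neg_apply, Matrix.map_apply, Matrix.add_apply, Matrix.sum_apply,
    star_add, star_sum, edgeMatrix_neg_phase _ _ (Complex.conj_eq_iff_im.mpr (hh _))]
  rw [show star (T₀ i k) = T₀ i k from Complex.conj_eq_iff_im.mpr (hT₀ i k)]

lemma map_star_mulVec_star (M : Matrix (Fin N) (Fin N) ℂ) (x : Fin N → ℂ) :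
    M.map star *ᵥ star x = star (M *ᵥ x) := by
  ext i
  simp [Matrix.mulVec, dotProduct]

/-- A nondegenerate local minimum of a band with at most two crossing edges is global. -/
theorem sortedEigs_le_of_eventually_le (hd : d ≤ 2) {u v : Fin d → Fin N} {h : Fin d → ℂ}
    {T₀ : Matrix (Fin N) (Fin N) ℂ} (hT₀ : T₀.IsHermitian) {n : Fin N}
    (hT₀real : ∀ i k, (T₀ i k).im = 0) (hhreal : ∀ j, (h j).im = 0)
    {α₀ : Fin d → ℝ} {f : Fin N → ℂ} (hf0 : f ≠ 0)
    (hsimple : ∀ i, sortedEigs (twistedMatrix T₀ u v h α₀) i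
      = sortedEigs (twistedMatrix T₀ u v h α₀) n → i = n)
    (heig : twistedMatrix T₀ u v h α₀ *ᵥ f
      = ((sortedEigs (twistedMatrix T₀ u v h α₀) n : ℝ) : ℂ) • f)
    (hnv : ∀ j, f (u j) ≠ 0 ∨ f (v j) ≠ 0)
    (hloc : ∀ᶠ α in 𝓝 α₀, sortedEigs (twistedMatrix T₀ u v h α₀) n
      ≤ sortedEigs (twistedMatrix T₀ u v h α) n) (α : Fin d → ℝ) :
    sortedEigs (twistedMatrix T₀ u v h α₀) n ≤ sortedEigs (twistedMatrix T₀ u v h α) n := by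
  set T := twistedMatrix T₀ u v h with hTdef
  set e : ℝ := sortedEigs (T α₀) n with he
  have hherm : ∀ β, (T β).IsHermitian := twistedMatrix_isHermitian hT₀ u v h
  have hindex : ∀ β, e ≤ sortedEigs (T β) n ↔ NegIndexLE (T β - (e : ℂ) • 1) n := fun β => by
    obtain ⟨U, hU⟩ := exists_diagonalizes (hherm β)
    rw [← (hU.sub_scalar e).nonneg_iff n, sub_nonneg]
  obtain ⟨U, hU⟩ := exists_diagonalizes (hherm α₀)
  have hstar : T (-α₀) = (T α₀).map star := twistedMatrix_neg_phase hT₀real u v hhreal α₀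
  rw [hindex, ← add_sub_cancel α₀ α]
  refine negIndexLE_of_eventually hd (hU.sub_scalar e) (n := n) (sub_self _)
    (fun i hi h0 => hi (hsimple i (sub_eq_zero.mp h0))) (f := f)
    (by rw [Matrix.sub_mulVec, heig, Matrix.smul_mulVec, Matrix.one_mulVec, sub_self]) hf0
    (u := u) (v := v) (p := fun j => h j * Complex.exp (Complex.I * (α₀ j : ℂ))) hnv
    (F := fun δ => T (α₀ + δ) - (e : ℂ) • 1) (fun δ => ?_) ?_
    (δ' := fun j => -α₀ j - α₀ j) (fun j => ?_) ?_ (fun hphase i k => ?_) (α - α₀)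
  · simp only [edgeMatrix_mul_exp, add_zero, Finset.sum_sub_distrib, hTdef, twistedMatrix,
      Pi.add_apply]
    abel
  · have hlim : Tendsto (fun δ : Fin d → ℝ => α₀ + δ) (𝓝 0) (𝓝 α₀) := by
      have hc : Continuous fun δ : Fin d → ℝ => α₀ + δ := by fun_prop
      simpa using hc.tendsto 0
    exact (hlim.eventually hloc).mono fun δ hδ => (hindex _).mp hδ
  · rw [map_mul, conj_exp_I_mul, Complex.conj_eq_iff_im.mpr (hhreal j), mul_assoc,
      ← Complex.exp_add]
    congr 2
    push_cast
    ring
  · have hα : (α₀ + fun j => -α₀ j - α₀ j) = -α₀ := by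
      ext j
      simp
    simp only [hα, hstar, Matrix.sub_mulVec, map_star_mulVec_star, heig, Matrix.smul_mulVec,
      Matrix.one_mulVec, star_smul]
    simp
  · have hTβ : T (-α₀) = T α₀ := by
      simp only [hTdef, twistedMatrix]
      congr 1
      refine Finset.sum_congr rfl fun j _ => ?_
      have h1 : Complex.exp (Complex.I * ((-α₀ j : ℝ) : ℂ))
          = Complex.exp (Complex.I * (α₀ j : ℂ)) := by
        have : Complex.I * ((-α₀ j : ℝ) : ℂ)
            = Complex.I * ((-α₀ j - α₀ j : ℝ) : ℂ) + Complex.I * (α₀ j : ℂ) := by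
          push_cast
          ring
        rw [this, Complex.exp_add, hphase, one_mul]
      rw [edgeMatrix, edgeMatrix, Pi.neg_apply, h1, ← conj_exp_I_mul, ← conj_exp_I_mul, h1]
    have h2 : star (T α₀ i k) = T α₀ i k := by
      have := congrFun (congrFun (hstar.symm.trans hTβ) i) k
      simpa using this
    have h3 : (T α₀ i k).im = 0 := Complex.conj_eq_iff_im.mp h2
    rw [Matrix.sub_apply, Complex.sub_im, h3, Matrix.smul_apply, Matrix.one_apply]
    split_ifs <;> simp

end Band

/-- Theorem 1.5(2) of the paper: in the time-reversal symmetric case with `d ≤ 2`, any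
local extremum of the band (simple eigenvalue, eigenvector non-vanishing on crossing
edges) is a global extremum. -/
theorem local_extremum_is_global_dim_le_two
    (d N : ℕ) (hd : 0 < d) (hN : 0 < N)
    (u v : Fin d → Fin N) (h : Fin d → ℂ) (hh : ∀ j, h j ≠ 0)
    (T0 : Matrix (Fin N) (Fin N) ℂ) (hT0 : T0.IsHermitian)
    (T : (Fin d → ℝ) → Matrix (Fin N) (Fin N) ℂ)
    (hT : ∀ α : Fin d → ℝ, T α = T0 + ∑ j : Fin d,
      (Matrix.single (u j) (v j) (h j * Complex.exp (Complex.I * (α j : ℂ))) +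
       Matrix.single (v j) (u j)
         ((starRingEnd ℂ) (h j) * Complex.exp (-(Complex.I * (α j : ℂ))))))
    (n : Fin N)
    (hT0real : ∀ i j, (T0 i j).im = 0) (hhreal : ∀ j, (h j).im = 0)
    (α0 : Fin d → ℝ) (f : Fin N → ℂ)
    (hsimple : Nat.card {i : Fin N // sortedEigs (T α0) i = sortedEigs (T α0) n} = 1)
    (hunit : star f ⬝ᵥ f = (1 : ℂ))
    (heig : (T α0).mulVec f = ((sortedEigs (T α0) n : ℝ) : ℂ) • f)
    (hnv : ∀ j, f (u j) ≠ 0 ∨ f (v j) ≠ 0)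
    (lam : (Fin d → ℝ) → ℝ) (hlam : ∀ α, lam α = sortedEigs (T α) n)
    (hdim : d ≤ 2) :
    (IsLocalMin lam α0 → ∀ α : Fin d → ℝ, lam α0 ≤ lam α) ∧
    (IsLocalMax lam α0 → ∀ α : Fin d → ℝ, lam α ≤ lam α0) := by
  obtain rfl : T = twistedMatrix T0 u v h := funext hT
  obtain rfl : lam = fun α => sortedEigs (twistedMatrix T0 u v h α) n := funext hlam
  have hf0 : f ≠ 0 := by
    rintro rfl
    simp at hunit
  have hsimple' : ∀ i, sortedEigs (twistedMatrix T0 u v h α0) i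
      = sortedEigs (twistedMatrix T0 u v h α0) n → i = n := fun i hi =>
    congrArg Subtype.val (@Subsingleton.elim _ (Nat.card_eq_one_iff_unique.mp hsimple).1
      ⟨i, hi⟩ ⟨n, rfl⟩)
  refine ⟨fun hmin => sortedEigs_le_of_eventually_le hdim hT0 hT0real hhreal hf0 hsimple' heig
    hnv hmin, fun hmax α => ?_⟩
  have hneg : ∀ β i, sortedEigs (twistedMatrix (-T0) u v (fun j => -h j) β) i.rev
      = -sortedEigs (twistedMatrix T0 u v h β) i := fun β i => by
    rw [twistedMatrix_neg, sortedEigs_neg_rev (twistedMatrix_isHermitian hT0 u v h β)]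
  have key := sortedEigs_le_of_eventually_le (n := n.rev) (α₀ := α0) (f := f) hdim hT0.neg
    (u := u) (v := v) (h := fun j => -h j) (fun i k => by simp [hT0real]) (fun j => by simp [hhreal])
    hf0 (fun i hi => ?_) ?_ hnv ?_ α
  · simpa only [hneg, neg_le_neg_iff] using key
  · rw [← Fin.rev_rev i, hneg, hneg, neg_inj] at hi
    rw [← hsimple' _ hi, Fin.rev_rev]
  · rw [hneg, twistedMatrix_neg, Matrix.neg_mulVec, heig, Complex.ofReal_neg, neg_smul]
  · filter_upwards [hmax] with β hβ
    simpa only [hneg, neg_le_neg_iff] using hβ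
end
end

section
/- Assume the time-reversal symmetric case (T_0 real, all h_j real) and d = 3. Suppose λ attains a non-degenerate local minimum at α° ∈ ℝ^3 (i.e. a local minimum at which the Hessian of λ is positive definite), λ(α°) is a simple eigenvalue of T(α°), and its unit eigenvector f° is non-vanishing on crossing edges. Then λ(α°) ≤ λ(α) for all α ∈ ℝ^3; the analogous statement holds for non-degenerate local maxima. -/
noncomputable section

open Matrix Complex
open scoped ComplexOrder

/-- `U` unitarily diagonalizes `M`, with eigenvalues `D` listed in increasing order. -/
structure IsSortedDiagonalization {N : ℕ} (M : Matrix (Fin N) (Fin N) ℂ) (D : Fin N → ℝ)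
    (U : Matrix (Fin N) (Fin N) ℂ) : Prop where
  mono : Monotone D
  star_mul : Uᴴ * U = 1
  mul_star : U * Uᴴ = 1
  eq : M = U * diagonal (fun i => (D i : ℂ)) * Uᴴ

theorem exists_isSortedDiagonalization {N : ℕ} {M : Matrix (Fin N) (Fin N) ℂ}
    (hM : M.IsHermitian) : ∃ U, IsSortedDiagonalization M (sortedEigs M) U := by
  set σ := Tuple.sort hM.eigenvalues with hσ
  set V : Matrix (Fin N) (Fin N) ℂ := ↑hM.eigenvectorUnitary with hV
  have hVV : V * Vᴴ = 1 := Unitary.coe_mul_star_self hM.eigenvectorUnitary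
  have hspec : M = V * diagonal (fun i => (hM.eigenvalues i : ℂ)) * Vᴴ := by
    conv_lhs => rw [hM.spectral_theorem, Unitary.conjStarAlgAut_apply]
    rfl
  have hsort : sortedEigs M = hM.eigenvalues ∘ σ := by simp [sortedEigs, hM, hσ]
  have hmul : V.submatrix id σ * (V.submatrix id σ)ᴴ = 1 := by
    rw [conjTranspose_submatrix, submatrix_mul_equiv, hVV, submatrix_id_id]
  refine ⟨V.submatrix id σ, ?_, mul_eq_one_comm.mp hmul, hmul, ?_⟩
  · rw [hsort]; exact Tuple.monotone_sort _
  · have hd : diagonal (fun i => (sortedEigs M i : ℂ)) =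
        (diagonal (fun i => (hM.eigenvalues i : ℂ))).submatrix σ σ := by
      rw [submatrix_diagonal_equiv, hsort]; rfl
    rw [hd, conjTranspose_submatrix, submatrix_mul_equiv, submatrix_mul_equiv, submatrix_id_id]
    exact hspec

namespace IsSortedDiagonalization

variable {N : ℕ} {M : Matrix (Fin N) (Fin N) ℂ} {D : Fin N → ℝ} {U : Matrix (Fin N) (Fin N) ℂ}

theorem neg (hU : IsSortedDiagonalization M D U) :
    IsSortedDiagonalization (-M) (fun i => -D i.rev) (U.submatrix id Fin.revPerm) := by
  have hmul : U.submatrix id Fin.revPerm * (U.submatrix id Fin.revPerm)ᴴ = 1 := by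
    rw [conjTranspose_submatrix, submatrix_mul_equiv, hU.mul_star, submatrix_id_id]
  refine ⟨fun i j hij => neg_le_neg (hU.mono (Fin.rev_le_rev.mpr hij)),
    mul_eq_one_comm.mp hmul, hmul, ?_⟩
  have hd : diagonal (fun i : Fin N => ((-D i.rev : ℝ) : ℂ)) =
      -(diagonal (fun i => (D i : ℂ))).submatrix Fin.revPerm Fin.revPerm := by
    rw [submatrix_diagonal_equiv, diagonal_neg]
    congr 1
    ext i
    simp
  rw [hd, Matrix.mul_neg, Matrix.neg_mul, conjTranspose_submatrix, submatrix_mul_equiv,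
    submatrix_mul_equiv, submatrix_id_id, ← hU.eq]

theorem mulVec_coord (hU : IsSortedDiagonalization M D U) (x : Fin N → ℂ) (i : Fin N) :
    (Uᴴ *ᵥ (M *ᵥ x)) i = D i * (Uᴴ *ᵥ x) i := by
  have : Uᴴ * M = diagonal (fun i => (D i : ℂ)) * Uᴴ := by
    rw [hU.eq, ← Matrix.mul_assoc, ← Matrix.mul_assoc, hU.star_mul, Matrix.one_mul]
  rw [mulVec_mulVec, this, ← mulVec_mulVec, mulVec_diagonal]

theorem coord_injective (hU : IsSortedDiagonalization M D U) {x y : Fin N → ℂ}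
    (hxy : Uᴴ *ᵥ x = Uᴴ *ᵥ y) : x = y := by
  have := congrArg (fun z => U *ᵥ z) hxy
  simpa [mulVec_mulVec, hU.mul_star] using this

theorem star_dotProduct_eq (hU : IsSortedDiagonalization M D U) (x y : Fin N → ℂ) :
    star x ⬝ᵥ y = star (Uᴴ *ᵥ x) ⬝ᵥ (Uᴴ *ᵥ y) := by
  rw [star_mulVec, conjTranspose_conjTranspose, ← dotProduct_mulVec, mulVec_mulVec, hU.mul_star,
    one_mulVec]

theorem re_star_dotProduct_self (hU : IsSortedDiagonalization M D U) (x : Fin N → ℂ) :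
    (star x ⬝ᵥ x).re = ∑ i, normSq ((Uᴴ *ᵥ x) i) := by
  rw [hU.star_dotProduct_eq, dotProduct, re_sum]
  refine Finset.sum_congr rfl fun i _ => ?_
  simp [normSq_apply]

theorem re_quadForm (hU : IsSortedDiagonalization M D U) (x : Fin N → ℂ) :
    (star x ⬝ᵥ M *ᵥ x).re = ∑ i, D i * normSq ((Uᴴ *ᵥ x) i) := by
  rw [hU.star_dotProduct_eq, dotProduct, re_sum]
  refine Finset.sum_congr rfl fun i _ => ?_
  rw [hU.mulVec_coord]
  simp [normSq_apply]
  ring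

theorem eigenvalue_mem (hU : IsSortedDiagonalization M D U) {x : Fin N → ℂ} {μ : ℂ} (hx : x ≠ 0)
    (h : M *ᵥ x = μ • x) : ∃ i, (D i : ℂ) = μ := by
  by_contra! hne
  refine hx (hU.coord_injective ?_)
  ext i
  have := hU.mulVec_coord x i
  rw [h, mulVec_smul, Pi.smul_apply, smul_eq_mul] at this
  have h0 : (μ - D i) * (Uᴴ *ᵥ x) i = 0 := by rw [sub_mul, this, sub_self]
  rcases mul_eq_zero.mp h0 with h1 | h1
  · exact absurd (sub_eq_zero.mp h1).symm (hne i)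
  · rw [h1, mulVec_zero, Pi.zero_apply]

/-- Courant–Fischer bound: if the quadratic form of `M` is at least `μ` on the kernel of at most
`n` linear constraints, then the eigenvalue of index `n` (counted from `0`) is at least `μ`. -/
theorem le_of_forall_ker (hU : IsSortedDiagonalization M D U) (n : Fin N) {μ : ℝ}
    (Φ : (Fin N → ℂ) →ₗ[ℂ] (Fin n → ℂ))
    (h : ∀ x, Φ x = 0 → μ * (star x ⬝ᵥ x).re ≤ (star x ⬝ᵥ M *ᵥ x).re) : μ ≤ D n := by
  let ι : Fin (n + 1) → Fin N := Fin.castLE n.isLt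
  let E : (Fin (n + 1) → ℂ) →ₗ[ℂ] (Fin N → ℂ) :=
    { toFun := fun a => fun i => if hi : (i : ℕ) < n + 1 then a ⟨i, hi⟩ else 0
      map_add' := fun a b => by ext i; simp only [Pi.add_apply]; split <;> simp
      map_smul' := fun c a => by ext i; simp only [Pi.smul_apply]; split <;> simp }
  obtain ⟨a, ha, ha0⟩ := (Submodule.ne_bot_iff _).mp
    (LinearMap.ker_ne_bot_of_finrank_lt (f := Φ ∘ₗ U.mulVecLin ∘ₗ E) (by simp))
  have hker : Φ (U *ᵥ E a) = 0 := by simpa using ha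
  have hco : Uᴴ *ᵥ (U *ᵥ E a) = E a := by rw [mulVec_mulVec, hU.star_mul, one_mulVec]
  have hle := h _ hker
  rw [hU.re_quadForm, hU.re_star_dotProduct_self, hco] at hle
  have hterm : ∀ i, D i * normSq (E a i) ≤ D n * normSq (E a i) := by
    intro i
    by_cases hi : (i : ℕ) < n + 1
    · exact mul_le_mul_of_nonneg_right (hU.mono (Fin.le_def.mpr (Nat.lt_succ_iff.mp hi)))
        (normSq_nonneg _)
    · have : E a i = 0 := dif_neg hi
      simp [this]
  have hpos : 0 < ∑ i, normSq (E a i) := by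
    obtain ⟨k, hk⟩ := Function.ne_iff.mp ha0
    refine Finset.sum_pos' (fun i _ => normSq_nonneg _) ⟨ι k, Finset.mem_univ _, ?_⟩
    have : E a (ι k) = a k := dif_pos k.isLt
    rw [this]
    exact normSq_pos.mpr hk
  have := hle.trans ((Finset.sum_le_sum fun i _ => hterm i).trans_eq (Finset.mul_sum _ _ _).symm)
  exact le_of_mul_le_mul_right this hpos

/-- The quadratic form of `M` dominates its eigenvalue of index `n` on vectors orthogonal to the
lower eigenvectors. -/
theorem quadForm_ge (hU : IsSortedDiagonalization M D U) (n : Fin N) {x : Fin N → ℂ}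
    (hx : ∀ i, i < n → (Uᴴ *ᵥ x) i = 0) :
    D n * (star x ⬝ᵥ x).re ≤ (star x ⬝ᵥ M *ᵥ x).re := by
  rw [hU.re_quadForm, hU.re_star_dotProduct_self, Finset.mul_sum]
  refine Finset.sum_le_sum fun i _ => ?_
  by_cases hi : i < n
  · simp [hx i hi]
  · exact mul_le_mul_of_nonneg_right (hU.mono (not_lt.mp hi)) (normSq_nonneg _)

/-- Weyl's perturbation inequality with an entrywise bound. -/
theorem eigenvalue_le_add {M' : Matrix (Fin N) (Fin N) ℂ} {D' : Fin N → ℝ}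
    {U' : Matrix (Fin N) (Fin N) ℂ} (hU : IsSortedDiagonalization M D U)
    (hU' : IsSortedDiagonalization M' D' U') {ε : ℝ} (h : ∀ i j, ‖M i j - M' i j‖ ≤ ε)
    (n : Fin N) : D n ≤ D' n + ε * N := by
  have key : D n - ε * N ≤ D' n := by
    let ι : Fin n → Fin N := Fin.castLE n.isLt.le
    refine hU'.le_of_forall_ker n (LinearMap.funLeft ℂ ℂ ι ∘ₗ Uᴴ.mulVecLin) fun x hx => ?_
    have h1 := hU.quadForm_ge n (x := x) fun i hi => by
      simpa [ι, LinearMap.funLeft] using congrFun hx ⟨i, hi⟩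
    have h2 : (star x ⬝ᵥ M *ᵥ x).re - (star x ⬝ᵥ M' *ᵥ x).re ≤ ε * N * (star x ⬝ᵥ x).re := by
      have hxx : (star x ⬝ᵥ x).re = ∑ i, ‖x i‖ ^ 2 := by
        rw [dotProduct, re_sum]
        refine Finset.sum_congr rfl fun i _ => ?_
        rw [← normSq_eq_norm_sq]
        simp [normSq_apply]
      have hε : 0 ≤ ε := (norm_nonneg _).trans (h n n)
      rw [← sub_re, ← dotProduct_sub, ← sub_mulVec, hxx]
      refine (re_le_norm _).trans ?_
      calc ‖star x ⬝ᵥ (M - M') *ᵥ x‖ ≤ ∑ i, ∑ j, ‖x i‖ * (ε * ‖x j‖) := by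
            rw [dotProduct]
            refine (norm_sum_le _ _).trans (Finset.sum_le_sum fun i _ => ?_)
            rw [norm_mul, Pi.star_apply, norm_star, ← Finset.mul_sum]
            refine mul_le_mul_of_nonneg_left ?_ (norm_nonneg _)
            rw [mulVec, dotProduct]
            refine (norm_sum_le _ _).trans (Finset.sum_le_sum fun j _ => ?_)
            rw [norm_mul]
            exact mul_le_mul_of_nonneg_right (h i j) (norm_nonneg _)
        _ = ε * (∑ i, ‖x i‖) ^ 2 := by
            rw [sq, Finset.sum_mul_sum, Finset.mul_sum]
            refine Finset.sum_congr rfl fun i _ => ?_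
            rw [Finset.mul_sum]
            exact Finset.sum_congr rfl fun j _ => by ring
        _ ≤ ε * (N * ∑ i, ‖x i‖ ^ 2) := by
            refine mul_le_mul_of_nonneg_left ?_ hε
            simpa using sq_sum_le_card_mul_sum_sq (s := Finset.univ) (f := fun i => ‖x i‖)
        _ = _ := by ring
    nlinarith
  linarith

end IsSortedDiagonalization

theorem star_quadForm_swap {ι : Type*} [Fintype ι] {W : Matrix ι ι ℂ} (hW : W.IsHermitian)
    (x y : ι → ℂ) : star (star x ⬝ᵥ W *ᵥ y) = star y ⬝ᵥ W *ᵥ x := by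
  rw [star_dotProduct, star_star, star_mulVec, hW.eq, dotProduct_mulVec]

/-- A Hermitian form whose restriction to real vectors is nonnegative and whose matrix is real is
nonnegative. -/
theorem quadForm_nonneg_of_real_s13 {ι : Type*} [Fintype ι] {W : Matrix ι ι ℂ}
    (hreal : ∀ i j, (W i j).im = 0)
    (hpos : ∀ t : ι → ℝ, 0 ≤ (star (fun i => (t i : ℂ)) ⬝ᵥ W *ᵥ fun i => (t i : ℂ)).re)
    (y : ι → ℂ) : 0 ≤ (star y ⬝ᵥ W *ᵥ y).re := by
  have h := add_nonneg (hpos fun i => (y i).re) (hpos fun i => (y i).im)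
  refine h.trans_eq ?_
  simp only [dotProduct, mulVec, re_sum, ← Finset.sum_add_distrib, Finset.mul_sum]
  refine Finset.sum_congr rfl fun i _ => Finset.sum_congr rfl fun j _ => ?_
  simp [hreal i j]

theorem quadForm_add_add_sub {ι : Type*} [Fintype ι] (W : Matrix ι ι ℂ) (a b : ι → ℂ) :
    star (a + Complex.I • b) ⬝ᵥ W *ᵥ (a + Complex.I • b) +
      star (a - Complex.I • b) ⬝ᵥ W *ᵥ (a - Complex.I • b) =
    2 * (star a ⬝ᵥ W *ᵥ a) + 2 * (star b ⬝ᵥ W *ᵥ b) := by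
  simp only [star_add, star_sub, star_smul, mulVec_add, mulVec_sub, mulVec_smul, add_dotProduct,
    sub_dotProduct, dotProduct_add, dotProduct_sub, smul_dotProduct, dotProduct_smul, smul_eq_mul,
    Complex.star_def, conj_I]
  linear_combination (-2 * (star b ⬝ᵥ W *ᵥ b)) * I_mul_I

/-- A singular `3 × 3` Hermitian form that is positive on nonzero real vectors is nonnegative. -/
theorem quadForm_nonneg_of_mulVec_eq_zero {W : Matrix (Fin 3) (Fin 3) ℂ} (hW : W.IsHermitian)
    (hpos : ∀ t : Fin 3 → ℝ, t ≠ 0 →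
      0 < (star (fun i => (t i : ℂ)) ⬝ᵥ W *ᵥ fun i => (t i : ℂ)).re)
    {c : Fin 3 → ℂ} (hc0 : c ≠ 0) (hc : W *ᵥ c = 0) (y : Fin 3 → ℂ) :
    0 ≤ (star y ⬝ᵥ W *ᵥ y).re := by
  have hpos' : ∀ t : Fin 3 → ℝ,
      0 ≤ (star (fun i => (t i : ℂ)) ⬝ᵥ W *ᵥ fun i => (t i : ℂ)).re := by
    intro t
    by_cases ht : t = 0
    · subst ht
      simp [dotProduct]
    · exact (hpos t ht).le
  have hconj : ∀ i j, (W i j).im = -(W j i).im := fun i j => by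
    have := congrArg Complex.im (hW.apply i j)
    simpa using this.symm
  have hdiag : ∀ i, (W i i).im = 0 := fun i => by linarith [hconj i i]
  set k : Fin 3 → ℝ := ![(W 1 2).im, -(W 0 2).im, (W 0 1).im] with hk
  by_cases hk0 : k = 0
  · refine quadForm_nonneg_of_real_s13 ?_ hpos' y
    have e0 : (W 1 2).im = 0 := by simpa [hk] using congrFun hk0 0
    have e1 : (W 0 2).im = 0 := by simpa [hk] using congrFun hk0 1
    have e2 : (W 0 1).im = 0 := by simpa [hk] using congrFun hk0 2
    intro i j
    fin_cases i <;> fin_cases j <;> simp [hdiag, e0, e1, e2, hconj 1 0, hconj 2 0, hconj 2 1]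
  set K : Fin 3 → ℂ := fun i => (k i : ℂ) with hK
  have hWK : star (W *ᵥ K) = W *ᵥ K := by
    ext i
    rw [Pi.star_apply, Complex.star_def, conj_eq_iff_im]
    simp only [mulVec, dotProduct, Fin.sum_univ_three, hK, hk]
    fin_cases i <;> simp [hdiag, hconj 1 0, hconj 2 0, hconj 2 1] <;> ring
  have hqK : 0 < (star K ⬝ᵥ W *ᵥ K).re := hpos k hk0
  have hcl : ∀ x, star c ⬝ᵥ W *ᵥ x = 0 := fun x => by
    rw [← star_quadForm_swap hW, hc, dotProduct_zero, star_zero]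
  have hqc : 0 < (star (star c) ⬝ᵥ W *ᵥ star c).re := by
    set a : Fin 3 → ℝ := fun i => (c i).re with ha
    set b : Fin 3 → ℝ := fun i => (c i).im with hb
    have hcab : c = (fun i => (a i : ℂ)) + Complex.I • fun i => (b i : ℂ) := by
      ext i
      apply Complex.ext <;> simp [ha, hb]
    have hcab' : star c = (fun i => (a i : ℂ)) - Complex.I • fun i => (b i : ℂ) := by
      ext i
      apply Complex.ext <;> simp [ha, hb]
    have h := congrArg Complex.re
      (quadForm_add_add_sub W (fun i => (a i : ℂ)) (fun i => (b i : ℂ)))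
    rw [← hcab, ← hcab', hcl, zero_add] at h
    rw [h]
    have h2 : a ≠ 0 ∨ b ≠ 0 := by
      by_contra! hab
      apply hc0
      rw [hcab, hab.1, hab.2]
      ext i
      simp
    have ha' := hpos' a
    have hb' := hpos' b
    simp only [add_re, mul_re, re_ofNat, im_ofNat, zero_mul, sub_zero]
    rcases h2 with h2 | h2
    · linarith [hpos a h2]
    · linarith [hpos b h2]
  have hKc : star (star c) ⬝ᵥ W *ᵥ K = 0 := by
    have := congrArg star (hcl K)
    rwa [star_zero, star_dotProduct, star_star, hWK, dotProduct_comm, ← star_star c] at this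
  have hcK : star K ⬝ᵥ W *ᵥ star c = 0 := by rw [← star_quadForm_swap hW, hKc, star_zero]
  have hli : LinearIndependent ℂ ![c, star c, K] := by
    rw [Fintype.linearIndependent_iff]
    intro g hg
    rw [Fin.sum_univ_three] at hg
    simp only [cons_val_zero, cons_val_one, cons_val_two, tail_cons, head_cons] at hg
    have h1 : g 1 = 0 := by
      have := congrArg (fun x => star (star c) ⬝ᵥ W *ᵥ x) hg
      simp only [mulVec_add, mulVec_smul, dotProduct_add, dotProduct_smul, hc, hKc] at this
      simp only [dotProduct_zero, mul_zero, zero_add, add_zero, mulVec_zero, smul_eq_mul,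
        mul_eq_zero] at this
      rcases this with h | h
      · exact h
      · exact absurd hqc (by rw [h]; simp)
    have h2 : g 2 = 0 := by
      have := congrArg (fun x => star K ⬝ᵥ W *ᵥ x) hg
      simp only [mulVec_add, mulVec_smul, dotProduct_add, dotProduct_smul, hc, hcK] at this
      simp only [dotProduct_zero, mul_zero, zero_add, add_zero, mulVec_zero, smul_eq_mul,
        mul_eq_zero] at this
      rcases this with h | h
      · exact h
      · simp [h] at hqK
    have h0 : g 0 = 0 := by
      rw [h1, h2, zero_smul, zero_smul, add_zero, add_zero] at hg
      exact (smul_eq_zero.mp hg).resolve_right hc0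
    intro i
    fin_cases i <;> assumption
  have hspan := hli.span_eq_top_of_card_eq_finrank' (by simp)
  have hy : y ∈ Submodule.span ℂ (Set.range ![c, star c, K]) := by rw [hspan]; trivial
  obtain ⟨g, hg⟩ := (Submodule.mem_span_range_iff_exists_fun ℂ).mp hy
  rw [Fin.sum_univ_three] at hg
  simp only [cons_val_zero, cons_val_one, cons_val_two, tail_cons, head_cons] at hg
  have : star y ⬝ᵥ W *ᵥ y = (normSq (g 1) : ℂ) * (star (star c) ⬝ᵥ W *ᵥ star c) +
      (normSq (g 2) : ℂ) * (star K ⬝ᵥ W *ᵥ K) := by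
    rw [← hg]
    simp only [mulVec_add, mulVec_smul, dotProduct_add, dotProduct_smul, star_add, star_smul,
      add_dotProduct, smul_dotProduct, hc, hKc, hcK, hcl, normSq_eq_conj_mul_self,
      dotProduct_zero, smul_eq_mul, Complex.star_def]
    ring
  rw [this, add_re, re_ofReal_mul, re_ofReal_mul]
  have := normSq_nonneg (g 1)
  have := normSq_nonneg (g 2)
  positivity

open Filter Topology in
/-- A simple eigenvalue of a Hermitian matrix and its eigenvector, normalized against the eigenvector
at the base point, extend smoothly along a smooth family of matrices. -/
theorem exists_contDiffAt_eigenpair {E : Type*} [NormedAddCommGroup E] [NormedSpace ℝ E]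
    [CompleteSpace E] {N : ℕ} {T : E → Matrix (Fin N) (Fin N) ℂ}
    (hT : ∀ i j, ContDiff ℝ 2 fun α => T α i j) {a : E} (ha : (T a).IsHermitian)
    {f : Fin N → ℂ} {μ₀ : ℝ} (hf : T a *ᵥ f = (μ₀ : ℂ) • f) (hunit : star f ⬝ᵥ f = 1)
    (hker : ∀ y, T a *ᵥ y = (μ₀ : ℂ) • y → star f ⬝ᵥ y = 0 → y = 0) :
    ∃ (x : E → Fin N → ℂ) (μ : E → ℂ), ContDiffAt ℝ 2 x a ∧ ContDiffAt ℝ 2 μ a ∧ x a = f ∧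
      μ a = μ₀ ∧ ∀ᶠ α in 𝓝 a, T α *ᵥ x α = μ α • x α ∧ star f ⬝ᵥ x α = 1 := by
  let F : E × ((Fin N → ℂ) × ℂ) → (Fin N → ℂ) × ℂ := fun w =>
    (fun i => ∑ j, T w.1 i j * w.2.1 j - w.2.2 * w.2.1 i, ∑ j, star (f j) * w.2.1 j)
  have hcd : ContDiff ℝ 2 F := by
    have hx : ∀ j, ContDiff ℝ 2 fun w : E × ((Fin N → ℂ) × ℂ) => w.2.1 j := fun j => by fun_prop
    have hTw : ∀ i j, ContDiff ℝ 2 fun w : E × ((Fin N → ℂ) × ℂ) => T w.1 i j :=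
      fun i j => (hT i j).comp contDiff_fst
    refine ContDiff.prodMk (contDiff_pi.mpr fun i => ?_) ?_
    · exact (ContDiff.sum fun j _ => (hTw i j).mul (hx j)).sub (by fun_prop)
    · exact ContDiff.sum fun j _ => contDiff_const.mul (hx j)
  set w₀ : E × ((Fin N → ℂ) × ℂ) := (a, (f, (μ₀ : ℂ))) with hw₀
  have hline : ∀ (y : Fin N → ℂ) (ν : ℂ), fderiv ℝ F w₀ (0, (y, ν)) =
      (fun i => ∑ j, T a i j * y j - (ν * f i + μ₀ * y i), ∑ j, star (f j) * y j) := by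
    intro y ν
    have h1 : HasDerivAt (fun s : ℝ => w₀ + s • ((0 : E), (y, ν))) (0, (y, ν)) 0 := by
      simpa using ((hasDerivAt_id (0 : ℝ)).smul_const ((0 : E), (y, ν))).const_add w₀
    have h2 : HasFDerivAt F (fderiv ℝ F w₀) (w₀ + (0 : ℝ) • ((0 : E), (y, ν))) := by
      rw [zero_smul, add_zero]
      exact (hcd.differentiable (by norm_num) _).hasFDerivAt
    have h3 := h2.comp_hasDerivAt (0 : ℝ) h1
    have hy : ∀ j, HasDerivAt (fun s : ℝ => f j + s * y j) (y j) 0 := fun j => by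
      simpa using ((hasDerivAt_id (0 : ℝ)).ofReal_comp.mul_const (y j)).const_add (f j)
    have hν : HasDerivAt (fun s : ℝ => (μ₀ : ℂ) + s * ν) ν 0 := by
      simpa using ((hasDerivAt_id (0 : ℝ)).ofReal_comp.mul_const ν).const_add (μ₀ : ℂ)
    have h4 : HasDerivAt (F ∘ fun s : ℝ => w₀ + s • ((0 : E), (y, ν)))
        (fun i => ∑ j, T a i j * y j - (ν * f i + μ₀ * y i), ∑ j, star (f j) * y j) 0 := by
      have hF : (F ∘ fun s : ℝ => w₀ + s • ((0 : E), (y, ν))) = fun s : ℝ =>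
          (fun i => ∑ j, T a i j * (f j + s * y j) - (μ₀ + s * ν) * (f i + s * y i),
            ∑ j, star (f j) * (f j + s * y j)) := by
        funext s
        simp [F, hw₀]
      rw [hF]
      refine HasDerivAt.prodMk (hasDerivAt_pi.mpr fun i => ?_) ?_
      · refine (HasDerivAt.fun_sum fun j _ => (hy j).const_mul (T a i j)).fun_sub ?_
        simpa using hν.fun_mul (hy i)
      · exact HasDerivAt.fun_sum fun j _ => (hy j).const_mul (star (f j))
    exact h3.unique h4
  have hinj : Function.Injective
      (fderiv ℝ F w₀ ∘L ContinuousLinearMap.inr ℝ E ((Fin N → ℂ) × ℂ)) := by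
    rw [injective_iff_map_eq_zero]
    rintro ⟨y, ν⟩ h
    rw [ContinuousLinearMap.comp_apply, ContinuousLinearMap.inr_apply, hline,
      Prod.mk_eq_zero] at h
    obtain ⟨h1, h2⟩ := h
    have h2' : star f ⬝ᵥ y = 0 := h2
    have h1' : T a *ᵥ y = ν • f + (μ₀ : ℂ) • y := by
      ext i
      exact sub_eq_zero.mp (congrFun h1 i)
    have hν : ν = 0 := by
      have h3 := star_quadForm_swap ha y f
      rw [h1', hf, dotProduct_smul, dotProduct_add, dotProduct_smul, dotProduct_smul, h2', hunit,
        star_smul, star_dotProduct, star_star, h2'] at h3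
      simpa using h3.symm
    refine Prod.mk_eq_zero.mpr ⟨hker y ?_ h2', hν⟩
    rw [h1', hν, zero_smul, zero_add]
  have hinv : (fderiv ℝ F w₀ ∘L ContinuousLinearMap.inr ℝ E ((Fin N → ℂ) × ℂ)).IsInvertible := by
    refine ⟨(LinearEquiv.ofInjectiveEndo _ hinj).toContinuousLinearEquiv, ?_⟩
    exact ContinuousLinearMap.ext fun w => rfl
  have hcda : ContDiffAt ℝ 2 F w₀ := hcd.contDiffAt
  have two_ne : (2 : WithTop ℕ∞) ≠ 0 := by norm_num
  set ψ := hcda.implicitFunction two_ne hinv with hψ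
  have hψcd : ContDiffAt ℝ 2 ψ a := hcda.contDiffAt_implicitFunction two_ne hinv
  have hψa : ψ a = (f, (μ₀ : ℂ)) := hcda.implicitFunction_apply_self two_ne hinv
  have hFw₀ : F w₀ = (0, 1) := by
    refine Prod.ext ?_ hunit
    ext i
    simpa [F, hw₀, mulVec, dotProduct, sub_eq_zero] using congrFun hf i
  refine ⟨fun α => (ψ α).1, fun α => (ψ α).2, hψcd.fst, hψcd.snd, by simp [hψa], by simp [hψa], ?_⟩
  filter_upwards [hcda.eventually_apply_implicitFunction two_ne hinv] with α hα
  rw [hFw₀] at hα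
  refine ⟨?_, congrArg Prod.snd hα⟩
  ext i
  exact sub_eq_zero.mp (congrFun (congrArg Prod.fst hα) i)

open Filter Topology in
/-- First and second derivative of a simple eigenvalue along a smooth curve of matrices. -/
theorem eigenvalue_deriv_deriv {N : ℕ} {M M₁ : ℝ → Matrix (Fin N) (Fin N) ℂ}
    {M₂ R : Matrix (Fin N) (Fin N) ℂ} {X : ℝ → Fin N → ℂ} {g : ℝ → ℝ} {f : Fin N → ℂ}
    (hM : ∀ s i j, HasDerivAt (fun s => M s i j) (M₁ s i j) s)
    (hM₁ : ∀ i j, HasDerivAt (fun s => M₁ s i j) (M₂ i j) 0)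
    (hX : ContDiffAt ℝ 2 X 0) (hX0 : X 0 = f) (hM0 : (M 0).IsHermitian)
    (heig : ∀ᶠ s in 𝓝 0, M s *ᵥ X s = (g s : ℂ) • X s ∧ star f ⬝ᵥ X s = 1)
    (hR : ∀ y, R *ᵥ (M 0 *ᵥ y - (g 0 : ℂ) • y) = y - (star f ⬝ᵥ y) • f) :
    deriv g 0 = (star f ⬝ᵥ M₁ 0 *ᵥ f).re ∧
      (star f ⬝ᵥ M₁ 0 *ᵥ f = 0 → deriv (deriv g) 0 =
        (star f ⬝ᵥ M₂ *ᵥ f - 2 * (star f ⬝ᵥ M₁ 0 *ᵥ (R *ᵥ (M₁ 0 *ᵥ f)))).re) := by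
  have hX1 : ∀ᶠ s in 𝓝 (0 : ℝ), ContDiffAt ℝ 2 X s := hX.eventually (by simp)
  have hXi : ∀ᶠ s in 𝓝 (0 : ℝ), ∀ i, HasDerivAt (fun s => X s i) (deriv X s i) s := by
    filter_upwards [hX1] with s hs i
    exact hasDerivAt_pi.mp (hs.differentiableAt (by norm_num)).hasDerivAt i
  have hX2 : ∀ i, HasDerivAt (fun s => deriv X s i) (deriv (deriv X) 0 i) 0 := by
    have : ContDiffAt ℝ 1 (deriv X) 0 := by
      have h := hX.fderiv_right (m := 1) (by norm_num)
      exact h.clm_apply contDiffAt_const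
    exact fun i => hasDerivAt_pi.mp (this.differentiableAt (by norm_num)).hasDerivAt i
  have heig0 := heig.self_of_nhds
  rw [hX0] at heig0
  have hleft : ∀ y, star f ⬝ᵥ M 0 *ᵥ y = g 0 * (star f ⬝ᵥ y) := by
    intro y
    rw [← star_quadForm_swap hM0, heig0.1, dotProduct_smul, smul_eq_mul, star_mul,
      star_dotProduct, star_star, dotProduct_comm]
    simp [mul_comm]
  set G : ℝ → ℂ := fun s => ∑ i, ∑ j, star (f i) * ((M s i j - M 0 i j) * X s j) with hG
  set G₁ : ℝ → ℂ := fun s => ∑ i, ∑ j, star (f i) *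
    (M₁ s i j * X s j + (M s i j - M 0 i j) * deriv X s j) with hG₁
  have hgG : ∀ᶠ s in 𝓝 (0 : ℝ), g s = (G s).re + g 0 := by
    filter_upwards [heig] with s hs
    have h1 : G s = star f ⬝ᵥ (M s - M 0) *ᵥ X s := by
      simp [hG, dotProduct, mulVec, Finset.mul_sum]
    rw [h1, sub_mulVec, dotProduct_sub, hs.1, hleft, dotProduct_smul, hs.2]
    simp
  have hGder : ∀ᶠ s in 𝓝 (0 : ℝ), HasDerivAt G (G₁ s) s := by
    filter_upwards [hXi] with s hs
    exact HasDerivAt.fun_sum fun i _ => HasDerivAt.fun_sum fun j _ =>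
      (((hM s i j).sub_const _).mul (hs j)).const_mul _
  have hgder : deriv g =ᶠ[𝓝 0] fun s => (G₁ s).re := by
    filter_upwards [hGder, hgG.eventually_nhds] with s hs hgs
    have h1 : HasDerivAt (fun s => (G s).re + g 0) (G₁ s).re s :=
      (reCLM.hasFDerivAt.comp_hasDerivAt s hs).add_const _
    exact (h1.congr_of_eventuallyEq hgs).deriv
  have hXi0 := hXi.self_of_nhds
  have hG₁0 : G₁ 0 = star f ⬝ᵥ M₁ 0 *ᵥ f := by
    simp [hG₁, dotProduct, mulVec, Finset.mul_sum, hX0]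
  refine ⟨by rw [hgder.eq_of_nhds, hG₁0], fun hcrit => ?_⟩
  have hG₁der : HasDerivAt G₁ (∑ i, ∑ j, star (f i) *
      ((M₂ i j * X 0 j + M₁ 0 i j * deriv X 0 j) +
        (M₁ 0 i j * deriv X 0 j + (M 0 i j - M 0 i j) * deriv (deriv X) 0 j))) 0 :=
    HasDerivAt.fun_sum fun i _ => HasDerivAt.fun_sum fun j _ =>
      (((hM₁ i j).mul (hXi0 j)).add (((hM 0 i j).sub_const _).mul (hX2 j))).const_mul _
  have h2 : deriv (deriv g) 0 =
      (star f ⬝ᵥ M₂ *ᵥ f + 2 * (star f ⬝ᵥ M₁ 0 *ᵥ deriv X 0)).re := by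
    rw [hgder.deriv_eq]
    have := (reCLM.hasFDerivAt.comp_hasDerivAt 0 hG₁der).deriv
    refine this.trans ?_
    rw [reCLM_apply]
    congr 1
    simp only [dotProduct, mulVec, Finset.mul_sum, hX0, ← Finset.sum_add_distrib, Pi.star_apply]
    exact Finset.sum_congr rfl fun i _ => Finset.sum_congr rfl fun j _ => by ring
  have hX' : deriv X 0 = -(R *ᵥ (M₁ 0 *ᵥ f)) := by
    have hg0 : HasDerivAt g 0 0 := by
      have h1 : HasDerivAt (fun s => (G s).re + g 0) (G₁ 0).re 0 :=
        (reCLM.hasFDerivAt.comp_hasDerivAt 0 hGder.self_of_nhds).add_const _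
      have h2 := h1.congr_of_eventuallyEq hgG
      rwa [hG₁0, hcrit, zero_re] at h2
    have horth : star f ⬝ᵥ deriv X 0 = 0 := by
      have h1 : HasDerivAt (fun s => ∑ i, star (f i) * X s i) (∑ i, star (f i) * deriv X 0 i) 0 :=
        HasDerivAt.fun_sum fun i _ => (hXi0 i).const_mul _
      have h2 : (fun s => ∑ i, star (f i) * X s i) =ᶠ[𝓝 0] fun _ => 1 := by
        filter_upwards [heig] with s hs using hs.2
      exact (h1.congr_of_eventuallyEq h2.symm).unique (hasDerivAt_const _ _)
    have hAX : M 0 *ᵥ deriv X 0 - (g 0 : ℂ) • deriv X 0 = -(M₁ 0 *ᵥ f) := by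
      ext i
      have h1 : HasDerivAt (fun s => ∑ j, M s i j * X s j)
          (∑ j, (M₁ 0 i j * X 0 j + M 0 i j * deriv X 0 j)) 0 :=
        HasDerivAt.fun_sum fun j _ => (hM 0 i j).mul (hXi0 j)
      have h2 : HasDerivAt (fun s => (g s : ℂ) * X s i)
          (((0 : ℝ) : ℂ) * X 0 i + g 0 * deriv X 0 i) 0 := hg0.ofReal_comp.mul (hXi0 i)
      have h3 : (fun s => ∑ j, M s i j * X s j) =ᶠ[𝓝 0] fun s => (g s : ℂ) * X s i := by
        filter_upwards [heig] with s hs using congrFun hs.1 i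
      have h4 := (h2.congr_of_eventuallyEq h3).unique h1
      rw [hX0, Finset.sum_add_distrib] at h4
      simp only [Pi.sub_apply, Pi.smul_apply, Pi.neg_apply, mulVec, dotProduct, smul_eq_mul]
      simp only [ofReal_zero, zero_mul, zero_add] at h4
      rw [h4]
      ring
    have h3 := hR (deriv X 0)
    rw [hAX, horth, zero_smul, sub_zero, mulVec_neg] at h3
    exact h3.symm
  rw [h2, hX', mulVec_neg, dotProduct_neg]
  congr 1
  ring

/-- `R` is the reduced resolvent of `M` at the simple eigenvalue `μ` with unit eigenvector `f`. -/
structure IsReducedResolvent {N : ℕ} (M : Matrix (Fin N) (Fin N) ℂ) (μ : ℝ) (f : Fin N → ℂ)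
    (R : Matrix (Fin N) (Fin N) ℂ) : Prop where
  isHermitian : R.IsHermitian
  mulVec_sub : ∀ y, R *ᵥ (M *ᵥ y - (μ : ℂ) • y) = y - (star f ⬝ᵥ y) • f
  sub_mulVec : ∀ y, M *ᵥ (R *ᵥ y) - (μ : ℂ) • (R *ᵥ y) = y - (star f ⬝ᵥ y) • f

theorem IsSortedDiagonalization.exists_isReducedResolvent {N : ℕ} {M : Matrix (Fin N) (Fin N) ℂ}
    {D : Fin N → ℝ} {U : Matrix (Fin N) (Fin N) ℂ} (hU : IsSortedDiagonalization M D U)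
    {n : Fin N} (hn : ∀ i, D i = D n → i = n) {f : Fin N → ℂ}
    (hf : M *ᵥ f = (D n : ℂ) • f) (hunit : star f ⬝ᵥ f = 1) :
    ∃ R, IsReducedResolvent M (D n) f R := by
  set r : Fin N → ℂ := fun i => ((D i : ℂ) - D n)⁻¹ with hr
  have hfi : ∀ i, i ≠ n → (Uᴴ *ᵥ f) i = 0 := by
    intro i hi
    have h := hU.mulVec_coord f i
    rw [hf, mulVec_smul, Pi.smul_apply, smul_eq_mul] at h
    have h0 : ((D n : ℂ) - D i) * (Uᴴ *ᵥ f) i = 0 := by rw [sub_mul, h, sub_self]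
    refine (mul_eq_zero.mp h0).resolve_left fun h1 => hi (hn i ?_)
    exact_mod_cast (sub_eq_zero.mp h1).symm
  have hfy : ∀ y, star f ⬝ᵥ y = star ((Uᴴ *ᵥ f) n) * (Uᴴ *ᵥ y) n := by
    intro y
    rw [hU.star_dotProduct_eq, dotProduct, Finset.sum_eq_single n]
    · rfl
    · intro i _ hi
      simp [hfi i hi]
    · simp
  have hproj : ∀ y i, (Uᴴ *ᵥ (y - (star f ⬝ᵥ y) • f)) i =
      ((D i : ℂ) - D n) * r i * (Uᴴ *ᵥ y) i := by
    intro y i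
    rw [mulVec_sub, mulVec_smul, Pi.sub_apply, Pi.smul_apply, smul_eq_mul, hfy]
    by_cases hi : i = n
    · subst hi
      have h1 := hfy f
      rw [hunit] at h1
      rw [sub_self, zero_mul, zero_mul]
      linear_combination (-(Uᴴ *ᵥ y) i) * (-h1)
    · have hne : (D i : ℂ) - D n ≠ 0 := by
        rw [sub_ne_zero]
        exact_mod_cast fun h => hi (hn i h)
      rw [hfi i hi, hr, mul_inv_cancel₀ hne]
      ring
  have hRi : ∀ y i, (Uᴴ *ᵥ ((U * diagonal r * Uᴴ) *ᵥ y)) i = r i * (Uᴴ *ᵥ y) i := by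
    intro y i
    rw [mulVec_mulVec, ← Matrix.mul_assoc, ← Matrix.mul_assoc, hU.star_mul, Matrix.one_mul,
      ← mulVec_mulVec, mulVec_diagonal]
  refine ⟨U * diagonal r * Uᴴ, ?_, fun y => hU.coord_injective ?_, fun y => hU.coord_injective ?_⟩
  · have : (diagonal r).IsHermitian := isHermitian_diagonal_of_self_adjoint _ (by
      ext i
      simp [hr])
    exact isHermitian_mul_mul_conjTranspose U this
  · ext i
    rw [hproj, hRi, mulVec_sub, mulVec_smul, Pi.sub_apply, hU.mulVec_coord]
    simp
    ring
  · ext i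
    rw [hproj, mulVec_sub, mulVec_smul, Pi.sub_apply, hU.mulVec_coord, Pi.smul_apply, hRi]
    simp
    ring

/-- The Hermitian matrix whose real part is half of the Hessian of a simple eigenvalue: `B j` is the
`j`-th derivative of the matrix applied to the eigenvector, `Ω` collects the second derivatives. -/
def hessianForm {N d : ℕ} (R : Matrix (Fin N) (Fin N) ℂ) (B : Fin d → Fin N → ℂ) (Ω : Fin d → ℂ) :
    Matrix (Fin d) (Fin d) ℂ :=
  diagonal Ω - of fun j k => star (B j) ⬝ᵥ R *ᵥ B k

theorem hessianForm_isHermitian {N d : ℕ} {R : Matrix (Fin N) (Fin N) ℂ} (hR : R.IsHermitian)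
    (B : Fin d → Fin N → ℂ) {Ω : Fin d → ℂ} (hΩ : ∀ j, star (Ω j) = Ω j) :
    (hessianForm R B Ω).IsHermitian := by
  refine (isHermitian_diagonal_of_self_adjoint _ (funext hΩ)).sub ?_
  ext j k
  rw [conjTranspose_apply, of_apply, of_apply, star_quadForm_swap hR]

theorem mulVec_hessianForm {N d : ℕ} (R : Matrix (Fin N) (Fin N) ℂ) (B : Fin d → Fin N → ℂ)
    (Ω : Fin d → ℂ) (c : Fin d → ℂ) (j : Fin d) :
    (hessianForm R B Ω *ᵥ c) j = Ω j * c j - star (B j) ⬝ᵥ R *ᵥ ∑ k, c k • B k := by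
  rw [hessianForm, sub_mulVec, Pi.sub_apply, mulVec_diagonal, mulVec_sum, dotProduct_sum]
  congr 1
  rw [mulVec, dotProduct]
  refine Finset.sum_congr rfl fun k _ => ?_
  rw [mulVec_smul, dotProduct_smul, of_apply, smul_eq_mul, mul_comm]

theorem quadForm_hessianForm {N d : ℕ} (R : Matrix (Fin N) (Fin N) ℂ) (B : Fin d → Fin N → ℂ)
    (Ω : Fin d → ℂ) (c : Fin d → ℂ) :
    star c ⬝ᵥ hessianForm R B Ω *ᵥ c =
      ∑ j, Ω j * (star (c j) * c j) - star (∑ k, c k • B k) ⬝ᵥ R *ᵥ ∑ k, c k • B k := by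
  rw [dotProduct, star_sum, sum_dotProduct, ← Finset.sum_sub_distrib]
  refine Finset.sum_congr rfl fun j _ => ?_
  rw [mulVec_hessianForm, star_smul, smul_dotProduct, Pi.star_apply, smul_eq_mul]
  ring

/-- If a matrix differs from `M` by a form that completes to the square of `hessianForm`, and
`hessianForm` is nonnegative, then its `n`-th eigenvalue is at least that of `M`. -/
theorem eigenvalue_le_of_hessianForm_nonneg {N d : ℕ} {M M' : Matrix (Fin N) (Fin N) ℂ}
    (hM : M.IsHermitian) {D D' : Fin N → ℝ} {U U' : Matrix (Fin N) (Fin N) ℂ}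
    (hU : IsSortedDiagonalization M D U) (hU' : IsSortedDiagonalization M' D' U') {n : Fin N}
    {f : Fin N → ℂ} {R : Matrix (Fin N) (Fin N) ℂ} (hR : IsReducedResolvent M (D n) f R)
    {B : Fin d → Fin N → ℂ} (hB : ∀ j, star f ⬝ᵥ B j = 0) {Ω : Fin d → ℂ}
    (L : Fin d → (Fin N → ℂ) →ₗ[ℂ] ℂ)
    (hL : ∀ x, star x ⬝ᵥ M' *ᵥ x = star x ⬝ᵥ M *ᵥ x + ∑ j, (star (L j x) * (star (B j) ⬝ᵥ x) +
      L j x * star (star (B j) ⬝ᵥ x) + Ω j * (star (L j x) * L j x)))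
    (hW : ∀ c, 0 ≤ (star c ⬝ᵥ hessianForm R B Ω *ᵥ c).re) : D n ≤ D' n := by
  let Φ : (Fin N → ℂ) →ₗ[ℂ] (Fin N → ℂ) :=
    LinearMap.id + R.mulVecLin ∘ₗ ∑ j, (L j).smulRight (B j)
  have hΦ : ∀ x, Φ x = x + R *ᵥ ∑ j, L j x • B j := fun x => by
    simp [Φ, mulVec_sum, mulVec_smul]
  let ι : Fin n → Fin N := Fin.castLE n.isLt.le
  refine hU'.le_of_forall_ker n (LinearMap.funLeft ℂ ℂ ι ∘ₗ Uᴴ.mulVecLin ∘ₗ Φ) fun x hx => ?_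
  have h1 := hU.quadForm_ge n (x := Φ x) fun i hi => by
    simpa [ι, LinearMap.funLeft] using congrFun hx ⟨i, hi⟩
  set b := ∑ j, L j x • B j with hb
  have hfb : star f ⬝ᵥ b = 0 := by
    rw [hb, dotProduct_sum]
    exact Finset.sum_eq_zero fun j _ => by rw [dotProduct_smul, hB, smul_zero]
  set p := R *ᵥ b with hp
  have hMp : M *ᵥ p = b + (D n : ℂ) • p := by
    have := hR.sub_mulVec b
    rw [hfb, zero_smul, sub_zero] at this
    exact sub_eq_iff_eq_add.mp this
  have hpx : star p ⬝ᵥ M *ᵥ x = star b ⬝ᵥ x + D n * (star p ⬝ᵥ x) := by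
    rw [← star_quadForm_swap hM, hMp, star_dotProduct, star_star, star_add, star_smul,
      add_dotProduct, smul_dotProduct]
    simp
  have hpb : star p ⬝ᵥ b = star b ⬝ᵥ R *ᵥ b := by
    rw [hp, star_mulVec, hR.isHermitian.eq, dotProduct_mulVec]
  have hbx : ∑ j, (star (L j x) * (star (B j) ⬝ᵥ x) + L j x * star (star (B j) ⬝ᵥ x)) =
      star b ⬝ᵥ x + star x ⬝ᵥ b := by
    rw [Finset.sum_add_distrib, hb, star_sum, sum_dotProduct, dotProduct_sum]
    congr 1 <;> refine Finset.sum_congr rfl fun j _ => ?_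
    · rw [star_smul, smul_dotProduct, smul_eq_mul]
    · rw [dotProduct_smul, smul_eq_mul, star_dotProduct, star_star]
  have hkey : star x ⬝ᵥ M' *ᵥ x - D n * (star x ⬝ᵥ x) =
      (star (Φ x) ⬝ᵥ M *ᵥ Φ x - D n * (star (Φ x) ⬝ᵥ Φ x)) +
        star (fun j => L j x) ⬝ᵥ hessianForm R B Ω *ᵥ fun j => L j x := by
    rw [hL, quadForm_hessianForm, Finset.sum_add_distrib, hbx, hΦ, ← hb, ← hp, mulVec_add, hMp]
    simp only [star_add, add_dotProduct, dotProduct_add, dotProduct_smul, smul_eq_mul, hpx, hpb]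
    ring
  have h2 := congrArg Complex.re hkey
  have h3 := hW fun j => L j x
  simp only [sub_re, add_re, re_ofReal_mul] at h2
  linarith

/-- The derivative, applied to `f`, of the hopping term `z E_{uv} + z̄ E_{vu}` in its phase. -/
def hoppingGrad {N : ℕ} (u v : Fin N) (z : ℂ) (f : Fin N → ℂ) : Fin N → ℂ :=
  Pi.single u (Complex.I * z * f v) + Pi.single v (-(Complex.I * star z * f u))

theorem star_hoppingGrad_dotProduct {N : ℕ} (u v : Fin N) (z : ℂ) (f x : Fin N → ℂ) :
    star (hoppingGrad u v z f) ⬝ᵥ x =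
      Complex.I * (z * star (f u) * x v - star z * star (f v) * x u) := by
  have hs : ∀ (i : Fin N) (a : ℂ), star (Pi.single i a : Fin N → ℂ) = Pi.single i (star a) := by
    intro i a
    ext k
    by_cases hk : k = i
    · subst hk; simp
    · simp [hk]
  rw [hoppingGrad, star_add, add_dotProduct, hs, hs, single_dotProduct, single_dotProduct]
  have hI : star Complex.I = -Complex.I := by simp
  simp only [star_mul, star_neg, star_star, hI]
  ring

/-- Changing the phase of a hopping term by a unit factor `w` is a completed square in terms of its
derivative and its second derivative at a critical phase. -/
theorem exists_hopping_linear {N : ℕ} (u v : Fin N) {z w : ℂ} (hw : w * star w = 1)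
    {f : Fin N → ℂ} (hf : f u ≠ 0 ∨ f v ≠ 0)
    (hreal : star z * f u * star (f v) = z * star (f u) * f v) :
    ∃ L : (Fin N → ℂ) →ₗ[ℂ] ℂ, ∀ x,
      star (L x) * (star (hoppingGrad u v z f) ⬝ᵥ x) +
        L x * star (star (hoppingGrad u v z f) ⬝ᵥ x) +
        -(z * star (f u) * f v) * (star (L x) * L x) =
      z * (w - 1) * (star (x u) * x v) + star z * (star w - 1) * (star (x v) * x u) := by
  have hI : star Complex.I = -Complex.I := by simp
  rcases hf with hf | hf
  · refine ⟨(Complex.I * (star w - 1) / f u) • LinearMap.proj u, fun x => ?_⟩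
    obtain ⟨q, hq⟩ : ∃ q, x u = q * f u := ⟨x u / f u, by field_simp⟩
    have hL : ((Complex.I * (star w - 1) / f u) • LinearMap.proj (R := ℂ) (φ := fun _ => ℂ) u) x =
        Complex.I * (star w - 1) * q := by
      simp only [LinearMap.smul_apply, LinearMap.proj_apply, smul_eq_mul, hq]
      field_simp
    rw [star_hoppingGrad_dotProduct, hL, hq]
    simp only [star_mul, star_sub, star_star, star_one, hI]
    linear_combination (-(w - 1) * star q * (z * star (f u) * x v - star z * star (f v) * f u * q)
      - (star w - 1) * q * (star z * f u * star (x v) - z * f v * star (f u) * star q)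
      + z * star (f u) * f v * (w - 1) * (star w - 1) * q * star q) * I_sq
      - (w - 1) * q * star q * hreal - z * star (f u) * f v * q * star q * hw
  · refine ⟨(-Complex.I * (w - 1) / f v) • LinearMap.proj v, fun x => ?_⟩
    obtain ⟨q, hq⟩ : ∃ q, x v = q * f v := ⟨x v / f v, by field_simp⟩
    have hL : ((-Complex.I * (w - 1) / f v) • LinearMap.proj (R := ℂ) (φ := fun _ => ℂ) v) x =
        -Complex.I * (w - 1) * q := by
      simp only [LinearMap.smul_apply, LinearMap.proj_apply, smul_eq_mul, hq]
      field_simp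
    rw [star_hoppingGrad_dotProduct, hL, hq]
    simp only [star_mul, star_sub, star_star, star_one, star_neg, hI]
    linear_combination ((star w - 1) * star q * (z * star (f u) * f v * q -
        star z * star (f v) * x u)
      + (w - 1) * q * (star z * f u * star (f v) * star q - z * f v * star (x u))
      + z * star (f u) * f v * (w - 1) * (star w - 1) * q * star q) * I_sq
      - (w - 1) * q * star q * hreal - z * star (f u) * f v * q * star q * hw

/-- The phase shift relating a hopping term to its complex conjugate acts on the conjugate of the
eigenvector as a multiple of the derivative. -/
theorem exists_hopping_conj {N : ℕ} (u v : Fin N) {z : ℂ} (hz : z ≠ 0)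
    {f : Fin N → ℂ} (hf : f u ≠ 0 ∨ f v ≠ 0)
    (hreal : star z * f u * star (f v) = z * star (f u) * f v) :
    ∃ c : ℂ, star (hoppingGrad u v z f) ⬝ᵥ star f = z * star (f u) * f v * c ∧
      Pi.single u ((star z - z) * star (f v)) + Pi.single v ((z - star z) * star (f u)) =
        c • hoppingGrad u v z f ∧
      (c = 0 → z.im = 0) := by
  have hz' : star z ≠ 0 := star_ne_zero.mpr hz
  have him : z - star z = 0 → z.im = 0 := fun h => by
    have := congrArg Complex.im h
    simp at this
    linarith
  rcases hf with hf | hf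
  · have hf' : star (f u) ≠ 0 := star_ne_zero.mpr hf
    refine ⟨Complex.I * (z - star z) / star z * (star (f u) / f u), ?_, ?_, fun h => him ?_⟩
    · rw [star_hoppingGrad_dotProduct, Pi.star_apply, Pi.star_apply]
      field_simp
      linear_combination (z - star z) * hreal
    · rw [hoppingGrad, smul_add, ← Pi.single_smul, ← Pi.single_smul, smul_eq_mul, smul_eq_mul]
      congr 2
      · field_simp
        linear_combination -(z - star z) * hreal - (z - star z) * z * f v * star (f u) * I_sq
      · field_simp
        linear_combination (z - star z) * I_sq
    · have h1 : z - star z = 0 ∨ z = 0 := by simpa [hz', hf, hf'] using h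
      exact h1.resolve_right hz
  · have hf' : star (f v) ≠ 0 := star_ne_zero.mpr hf
    refine ⟨Complex.I * (z - star z) / z * (star (f v) / f v), ?_, ?_, fun h => him ?_⟩
    · rw [star_hoppingGrad_dotProduct, Pi.star_apply, Pi.star_apply]
      field_simp
    · rw [hoppingGrad, smul_add, ← Pi.single_smul, ← Pi.single_smul, smul_eq_mul, smul_eq_mul]
      congr 2
      · field_simp
        linear_combination -(z - star z) * I_sq
      · field_simp
        linear_combination -(z - star z) * hreal + (z - star z) * star z * f u * star (f v) * I_sq
    · simpa [hz, hf, hf'] using h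

open Topology in
theorem IsSortedDiagonalization.continuousAt_eigenvalue {E : Type*} [TopologicalSpace E] {N : ℕ}
    {T : E → Matrix (Fin N) (Fin N) ℂ} {D : E → Fin N → ℝ}
    (hD : ∀ α, ∃ U, IsSortedDiagonalization (T α) (D α) U)
    {a : E} (hT : ∀ i j, ContinuousAt (fun α => T α i j) a) (n : Fin N) :
    ContinuousAt (fun α => D α n) a := by
  rw [ContinuousAt, Metric.tendsto_nhds]
  intro ε hε
  have hN : (0 : ℝ) < N + 1 := by positivity
  have hall : ∀ᶠ α in 𝓝 a, ∀ i j, ‖T α i j - T a i j‖ < ε / (N + 1) := by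
    refine Filter.eventually_all.mpr fun i => Filter.eventually_all.mpr fun j => ?_
    simpa [dist_eq_norm] using Metric.tendsto_nhds.mp (hT i j) _ (div_pos hε hN)
  filter_upwards [hall] with α hα
  obtain ⟨U, hU⟩ := hD α
  obtain ⟨V, hV⟩ := hD a
  have h1 := hU.eigenvalue_le_add hV (fun i j => (hα i j).le) n
  have h2 := hV.eigenvalue_le_add hU (fun i j => by rw [norm_sub_rev]; exact (hα i j).le) n
  have h3 : ε / (N + 1) * N < ε := by
    rw [div_mul_eq_mul_div, div_lt_iff₀ hN]
    nlinarith
  rw [Real.dist_eq, abs_lt]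
  constructor <;> linarith

open Topology in
/-- A simple eigenvalue in a sorted family of diagonalizations of a `C²` matrix family is `C²`, with
a `C²` eigenvector. -/
theorem IsSortedDiagonalization.exists_contDiffAt_eigenvector {E : Type*} [NormedAddCommGroup E]
    [NormedSpace ℝ E] [CompleteSpace E] {N : ℕ}
    {T : E → Matrix (Fin N) (Fin N) ℂ} {D : E → Fin N → ℝ}
    (hD : ∀ α, ∃ U, IsSortedDiagonalization (T α) (D α) U)
    (hT : ∀ i j, ContDiff ℝ 2 fun α => T α i j) {a : E} (ha : (T a).IsHermitian) {n : Fin N}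
    (hn : ∀ i, D a i = D a n → i = n) {f : Fin N → ℂ} (hf : T a *ᵥ f = (D a n : ℂ) • f)
    (hunit : star f ⬝ᵥ f = 1) :
    ∃ x : E → Fin N → ℂ, ContDiffAt ℝ 2 x a ∧ ContDiffAt ℝ 2 (fun α => D α n) a ∧ x a = f ∧
      ∀ᶠ α in 𝓝 a, T α *ᵥ x α = (D α n : ℂ) • x α ∧ star f ⬝ᵥ x α = 1 := by
  obtain ⟨U, hU⟩ := hD a
  obtain ⟨R, hR⟩ := hU.exists_isReducedResolvent hn hf hunit
  obtain ⟨x, μ, hx, hμ, hxa, hμa, hxμ⟩ := exists_contDiffAt_eigenpair hT ha hf hunit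
    fun y hy hfy => by
      have := hR.mulVec_sub y
      rwa [hy, sub_self, mulVec_zero, hfy, zero_smul, sub_zero, eq_comm] at this
  have hsep : ∀ᶠ α in 𝓝 a, ∀ i, i ≠ n → (D α i : ℂ) ≠ μ α := by
    refine Filter.eventually_all.mpr fun i => ?_
    by_cases hi : i = n
    · exact .of_forall fun _ h => (h hi).elim
    have hDi : ContinuousAt (fun α => D α i) a :=
      IsSortedDiagonalization.continuousAt_eigenvalue hD
        (fun i j => (hT i j).continuous.continuousAt) i
    have hcont := continuous_ofReal.continuousAt.comp hDi
    have hne : ((D a i : ℝ) : ℂ) ≠ μ a := by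
      rw [hμa]
      exact_mod_cast fun h => hi (hn i h)
    filter_upwards [(hcont.sub hμ.continuousAt).eventually_ne (sub_ne_zero.mpr hne)] with α hα _
    exact sub_ne_zero.mp hα
  have heq : ∀ᶠ α in 𝓝 a, (D α n : ℂ) = μ α := by
    filter_upwards [hsep, hxμ] with α hα hxα
    obtain ⟨V, hV⟩ := hD α
    obtain ⟨i, hi⟩ := hV.eigenvalue_mem (fun h => by simp [h] at hxα) hxα.1
    by_cases hin : i = n
    · rw [← hin, hi]
    · exact (hα i hin hi).elim
  refine ⟨x, hx, ?_, hxa, ?_⟩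
  · have : ContDiffAt ℝ 2 (fun α => (μ α).re) a := reCLM.contDiff.contDiffAt.comp a hμ
    refine this.congr_of_eventuallyEq ?_
    filter_upwards [heq] with α hα
    rw [← hα, ofReal_re]
  · filter_upwards [heq, hxμ] with α hα hxα
    rwa [hα]

open Topology in
theorem ContDiffAt.deriv_line {E : Type*} [NormedAddCommGroup E] [NormedSpace ℝ E] {g : E → ℝ}
    {a : E} (hg : ContDiffAt ℝ 2 g a) (t : E) :
    ∀ᶠ s in 𝓝 (0 : ℝ), deriv (fun s : ℝ => g (a + s • t)) s = fderiv ℝ g (a + s • t) t := by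
  have hline : Filter.Tendsto (fun s : ℝ => a + s • t) (𝓝 0) (𝓝 a) := by
    have : Continuous fun s : ℝ => a + s • t := by fun_prop
    simpa using this.tendsto 0
  filter_upwards [hline.eventually (hg.eventually (by simp))] with s hs
  have h1 : HasDerivAt (fun s : ℝ => a + s • t) t s := by
    simpa using ((hasDerivAt_id s).smul_const t).const_add a
  exact ((hs.differentiableAt (by norm_num)).hasFDerivAt.comp_hasDerivAt s h1).deriv

open Topology in
theorem ContDiffAt.deriv_deriv_line {d : ℕ} {g : (Fin d → ℝ) → ℝ} {a : Fin d → ℝ}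
    (hg : ContDiffAt ℝ 2 g a) (t : Fin d → ℝ) :
    deriv (deriv fun s : ℝ => g (a + s • t)) 0 = ∑ j, ∑ k, t j * t k *
      fderiv ℝ (fun β => fderiv ℝ g β (Pi.single k 1)) a (Pi.single j 1) := by
  have ht : ∀ L : (Fin d → ℝ) →L[ℝ] ℝ, L t = ∑ k, t k * L (Pi.single k 1) := by
    intro L
    conv_lhs => rw [pi_eq_sum_univ' t, map_sum]
    refine Finset.sum_congr rfl fun k _ => ?_
    rw [map_smul, smul_eq_mul]
  have hd : ∀ k : Fin d, DifferentiableAt ℝ (fun β => fderiv ℝ g β (Pi.single k 1)) a := fun k =>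
    ((hg.fderiv_right (m := 1) (by norm_num)).differentiableAt (by norm_num)).clm_apply
      (differentiableAt_const _)
  have hev : deriv (fun s : ℝ => g (a + s • t)) =ᶠ[𝓝 0]
      fun s => ∑ k, t k * fderiv ℝ g (a + s • t) (Pi.single k 1) := by
    filter_upwards [hg.deriv_line t] with s hs
    rw [hs, ht]
  have h1 : HasDerivAt (fun s : ℝ => a + s • t) t 0 := by
    simpa using ((hasDerivAt_id (0 : ℝ)).smul_const t).const_add a
  have h2 : ∀ k ∈ Finset.univ, HasDerivAt
      (fun s : ℝ => t k * fderiv ℝ g (a + s • t) (Pi.single k 1))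
      (t k * fderiv ℝ (fun β => fderiv ℝ g β (Pi.single k 1)) a t) 0 := fun k _ => by
    have h3 : HasFDerivAt (fun β => fderiv ℝ g β (Pi.single k 1))
      (fderiv ℝ (fun β => fderiv ℝ g β (Pi.single k 1)) a) (a + (0 : ℝ) • t) := by
        simpa using (hd k).hasFDerivAt
    exact (h3.comp_hasDerivAt (0 : ℝ) h1).const_mul (t k)
  rw [hev.deriv_eq, (HasDerivAt.fun_sum h2).deriv, Finset.sum_comm]
  refine Finset.sum_congr rfl fun k _ => ?_
  rw [ht, Finset.mul_sum]
  exact Finset.sum_congr rfl fun j _ => by ring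

/-- The Hermitian hopping term `z E_{uv} + z̄ E_{vu}`. -/
def hoppingTerm {N : ℕ} (u v : Fin N) (z : ℂ) : Matrix (Fin N) (Fin N) ℂ :=
  Matrix.single u v z + Matrix.single v u (star z)

theorem hoppingTerm_isHermitian {N : ℕ} (u v : Fin N) (z : ℂ) :
    (hoppingTerm u v z).IsHermitian := by
  rw [hoppingTerm, IsHermitian, conjTranspose_add, conjTranspose_single, conjTranspose_single,
    star_star, add_comm]

theorem hoppingTerm_mulVec {N : ℕ} (u v : Fin N) (z : ℂ) (x : Fin N → ℂ) :
    hoppingTerm u v z *ᵥ x = Pi.single u (z * x v) + Pi.single v (star z * x u) := by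
  rw [hoppingTerm, add_mulVec, single_mulVec, single_mulVec]
  rfl

theorem hoppingGrad_eq_mulVec {N : ℕ} (u v : Fin N) (z : ℂ) (f : Fin N → ℂ) :
    hoppingGrad u v z f = hoppingTerm u v (Complex.I * z) *ᵥ f := by
  rw [hoppingTerm_mulVec, hoppingGrad]
  congr 2
  simp [mul_comm]

theorem quadForm_hoppingTerm {N : ℕ} (u v : Fin N) (z : ℂ) (x : Fin N → ℂ) :
    star x ⬝ᵥ hoppingTerm u v z *ᵥ x =
      z * (star (x u) * x v) + star z * (star (x v) * x u) := by
  rw [hoppingTerm_mulVec, dotProduct_add, dotProduct_single, dotProduct_single, Pi.star_apply,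
    Pi.star_apply]
  ring

theorem hoppingTerm_smul_I {N : ℕ} (u v : Fin N) (z : ℂ) (t : ℝ) (f : Fin N → ℂ) :
    hoppingTerm u v (Complex.I * t * z) *ᵥ f = (t : ℂ) • hoppingGrad u v z f := by
  rw [hoppingGrad_eq_mulVec, hoppingTerm_mulVec, hoppingTerm_mulVec, smul_add, ← Pi.single_smul,
    ← Pi.single_smul]
  congr 2
  · rw [smul_eq_mul]
    ring
  · simp
    ring

theorem map_star_hoppingTerm {N : ℕ} (u v : Fin N) (z : ℂ) :
    (hoppingTerm u v z).map star = hoppingTerm u v (star z) := by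
  ext i j
  simp only [hoppingTerm, map_apply, Matrix.add_apply, Matrix.single_apply, star_add]
  congr 1 <;> split_ifs <;> simp

theorem star_mulVec_eq_map {N : ℕ} (M : Matrix (Fin N) (Fin N) ℂ) (x : Fin N → ℂ) :
    star (M *ᵥ x) = M.map star *ᵥ star x := by
  ext i
  simp [mulVec, dotProduct]

theorem HasDerivAt.hoppingTerm {N : ℕ} (u v : Fin N) {z : ℝ → ℂ} {z' : ℂ} {s : ℝ}
    (hz : HasDerivAt z z' s) (i j : Fin N) :
    HasDerivAt (fun s => hoppingTerm u v (z s) i j) (hoppingTerm u v z' i j) s := by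
  simp only [_root_.hoppingTerm, Matrix.add_apply, Matrix.single_apply]
  refine HasDerivAt.add ?_ ?_
  · split_ifs
    exacts [hz, hasDerivAt_const _ _]
  · split_ifs
    exacts [hz.star, hasDerivAt_const _ _]

theorem ContDiff.hoppingTerm {E : Type*} [NormedAddCommGroup E] [NormedSpace ℝ E] {N : ℕ}
    (u v : Fin N) {z : E → ℂ} (hz : ContDiff ℝ 2 z) (i j : Fin N) :
    ContDiff ℝ 2 fun α => hoppingTerm u v (z α) i j := by
  simp only [_root_.hoppingTerm, Matrix.add_apply, Matrix.single_apply]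
  refine ContDiff.add ?_ ?_
  · split_ifs
    exacts [hz, contDiff_const]
  · split_ifs
    exacts [conjCLE.contDiff.comp hz, contDiff_const]

/-- The matrix family `T₀ + ∑ j, (h_j e^{iα_j} E_{u_j v_j} + h̄_j e^{-iα_j} E_{v_j u_j})`. -/
def hoppingFamily {N d : ℕ} (T0 : Matrix (Fin N) (Fin N) ℂ) (u v : Fin d → Fin N) (h : Fin d → ℂ)
    (α : Fin d → ℝ) : Matrix (Fin N) (Fin N) ℂ :=
  T0 + ∑ j, hoppingTerm (u j) (v j) (h j * Complex.exp (Complex.I * α j))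

section Family

variable {N d : ℕ} {T0 : Matrix (Fin N) (Fin N) ℂ} {u v : Fin d → Fin N} {h : Fin d → ℂ}

theorem hoppingFamily_isHermitian (hT0 : T0.IsHermitian) (α : Fin d → ℝ) :
    (hoppingFamily T0 u v h α).IsHermitian := by
  rw [hoppingFamily]
  refine hT0.add ?_
  rw [IsHermitian, conjTranspose_sum]
  exact Finset.sum_congr rfl fun j _ => hoppingTerm_isHermitian _ _ _

theorem contDiff_hoppingFamily (i k : Fin N) :
    ContDiff ℝ 2 fun α => hoppingFamily T0 u v h α i k := by
  simp only [hoppingFamily, Matrix.add_apply, Matrix.sum_apply]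
  refine contDiff_const.add (ContDiff.sum fun j _ => ContDiff.hoppingTerm _ _ ?_ i k)
  have : ContDiff ℝ 2 fun α : Fin d → ℝ => ((α j : ℝ) : ℂ) :=
    ofRealCLM.contDiff.comp (contDiff_apply ℝ ℝ j)
  exact contDiff_const.mul (contDiff_const.mul this).cexp

variable {D : (Fin d → ℝ) → Fin N → ℝ} {n : Fin N} {α0 : Fin d → ℝ} {f : Fin N → ℂ}
  {R : Matrix (Fin N) (Fin N) ℂ}

theorem star_dotProduct_hoppingGrad_eq_zero_iff {u v : Fin N} {z : ℂ} :
    star f ⬝ᵥ hoppingGrad u v z f = 0 ↔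
      star z * f u * star (f v) = z * star (f u) * f v := by
  rw [← star_eq_zero, star_dotProduct, star_star, star_hoppingGrad_dotProduct, mul_eq_zero,
    sub_eq_zero]
  constructor
  · intro h
    linear_combination -(h.resolve_left I_ne_zero)
  · intro h
    right
    linear_combination -h

open Topology in
/-- First and second derivative of a simple eigenvalue of a hopping family along a line. -/
theorem hoppingFamily_deriv_line
    (hD : ∀ α, ∃ U, IsSortedDiagonalization (hoppingFamily T0 u v h α) (D α) U)
    (hT0 : T0.IsHermitian) (hn : ∀ i, D α0 i = D α0 n → i = n)
    (hf : hoppingFamily T0 u v h α0 *ᵥ f = (D α0 n : ℂ) • f) (hunit : star f ⬝ᵥ f = 1)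
    (hR : IsReducedResolvent (hoppingFamily T0 u v h α0) (D α0 n) f R)
    {z : Fin d → ℂ} (hz : ∀ j, z j = h j * Complex.exp (Complex.I * α0 j)) (t : Fin d → ℝ) :
    deriv (fun s : ℝ => D (α0 + s • t) n) 0 =
        (star f ⬝ᵥ ∑ j, (t j : ℂ) • hoppingGrad (u j) (v j) (z j) f).re ∧
      ((∀ j, star f ⬝ᵥ hoppingGrad (u j) (v j) (z j) f = 0) →
        deriv (deriv fun s : ℝ => D (α0 + s • t) n) 0 = 2 * (star (fun j => (t j : ℂ)) ⬝ᵥ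
          hessianForm R (fun j => hoppingGrad (u j) (v j) (z j) f)
            (fun j => -(z j * star (f (u j)) * f (v j))) *ᵥ fun j => (t j : ℂ)).re) := by
  obtain ⟨x, hx, -, hx0, hxeig⟩ := IsSortedDiagonalization.exists_contDiffAt_eigenvector hD
    contDiff_hoppingFamily (hoppingFamily_isHermitian hT0 α0) hn hf hunit
  set Z : Fin d → ℝ → ℂ := fun j s => h j * Complex.exp (Complex.I * ((α0 + s • t) j : ℝ)) with hZ
  have hZ0 : ∀ j, Z j 0 = z j := fun j => by simp [hZ, hz]
  have hZ' : ∀ j s, HasDerivAt (Z j) (Complex.I * t j * Z j s) s := by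
    intro j s
    have h1 : HasDerivAt (fun s : ℝ => (((α0 + s • t) j : ℝ) : ℂ)) (t j : ℂ) s := by
      refine HasDerivAt.ofReal_comp ?_
      simpa using ((hasDerivAt_id s).mul_const (t j)).const_add (α0 j)
    have h2 := ((h1.const_mul Complex.I).cexp).const_mul (h j)
    refine h2.congr_deriv ?_
    simp only [hZ]
    ring
  set M₁ : ℝ → Matrix (Fin N) (Fin N) ℂ :=
    fun s => ∑ j, hoppingTerm (u j) (v j) (Complex.I * t j * Z j s) with hM₁
  set M₂ : Matrix (Fin N) (Fin N) ℂ :=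
    ∑ j, hoppingTerm (u j) (v j) (Complex.I * t j * (Complex.I * t j * Z j 0)) with hM₂
  have hline : Filter.Tendsto (fun s : ℝ => α0 + s • t) (𝓝 0) (𝓝 α0) := by
    have : Continuous fun s : ℝ => α0 + s • t := by fun_prop
    simpa using this.tendsto 0
  have hX : ContDiffAt ℝ 2 (fun s : ℝ => x (α0 + s • t)) 0 := by
    refine ContDiffAt.comp (0 : ℝ) (g := x) (f := fun s : ℝ => α0 + s • t) ?_ (by fun_prop)
    simpa using hx
  have hmain := eigenvalue_deriv_deriv (M := fun s => hoppingFamily T0 u v h (α0 + s • t))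
    (M₁ := M₁) (M₂ := M₂) (R := R) (X := fun s => x (α0 + s • t))
    (g := fun s => D (α0 + s • t) n) (f := f)
    (fun s i k => by
      simp only [hoppingFamily, hM₁, Matrix.add_apply, Matrix.sum_apply]
      exact (HasDerivAt.fun_sum fun j _ =>
        HasDerivAt.hoppingTerm _ _ (hZ' j s) i k).const_add (T0 i k))
    (fun i k => by
      simp only [hM₁, hM₂, Matrix.sum_apply]
      exact HasDerivAt.fun_sum fun j _ =>
        HasDerivAt.hoppingTerm _ _ ((hZ' j 0).const_mul _) i k)
    hX (by simpa using hx0) (hoppingFamily_isHermitian hT0 _)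
    (hline.eventually hxeig) (by simpa using hR.mulVec_sub)
  have hM₁f : M₁ 0 *ᵥ f = ∑ j, (t j : ℂ) • hoppingGrad (u j) (v j) (z j) f := by
    simp only [hM₁, sum_mulVec, hoppingTerm_smul_I, hZ0]
  rw [hM₁f] at hmain
  refine ⟨hmain.1, fun hB => ?_⟩
  have hfb : star f ⬝ᵥ ∑ j, (t j : ℂ) • hoppingGrad (u j) (v j) (z j) f = 0 := by
    rw [dotProduct_sum]
    exact Finset.sum_eq_zero fun j _ => by rw [dotProduct_smul, hB, smul_zero]
  rw [hmain.2 hfb, quadForm_hessianForm]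
  have hM₁H : (M₁ 0).IsHermitian := by
    rw [IsHermitian, conjTranspose_sum]
    exact Finset.sum_congr rfl fun j _ => hoppingTerm_isHermitian _ _ _
  set b := ∑ j, (t j : ℂ) • hoppingGrad (u j) (v j) (z j) f with hb
  have h1 : star f ⬝ᵥ M₁ 0 *ᵥ (R *ᵥ b) = star b ⬝ᵥ R *ᵥ b := by
    rw [dotProduct_mulVec, ← hM₁f, star_mulVec, hM₁H.eq]
  have h2 : star f ⬝ᵥ M₂ *ᵥ f =
      2 * ∑ j, -(z j * star (f (u j)) * f (v j)) * (star (t j : ℂ) * t j) := by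
    rw [hM₂, sum_mulVec, dotProduct_sum, Finset.mul_sum]
    refine Finset.sum_congr rfl fun j _ => ?_
    have h3 := star_dotProduct_hoppingGrad_eq_zero_iff.mp (hB j)
    have h4 : star (t j : ℂ) = t j := conj_ofReal _
    have hI : star Complex.I = -Complex.I := by simp
    rw [quadForm_hoppingTerm, hZ0]
    simp only [star_mul, hI, h4]
    linear_combination (t j : ℂ) ^ 2 * (z j * star (f (u j)) * f (v j) +
      star (z j) * star (f (v j)) * f (u j)) * I_sq - (t j : ℂ) ^ 2 * h3
  rw [h1, h2, ← mul_sub, ← re_ofReal_mul]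
  norm_num

end Family

theorem map_star_add_sum_hoppingTerm {N d : ℕ} (T0 : Matrix (Fin N) (Fin N) ℂ)
    (u v : Fin d → Fin N) (z : Fin d → ℂ) :
    (T0 + ∑ j, hoppingTerm (u j) (v j) (z j)).map star =
      T0.map star + ∑ j, hoppingTerm (u j) (v j) (star (z j)) := by
  simp only [← map_star_hoppingTerm]
  ext i k
  simp [Matrix.sum_apply]

section TimeReversal

variable {N d : ℕ} {T0 M R : Matrix (Fin N) (Fin N) ℂ} {u v : Fin d → Fin N} {z : Fin d → ℂ}
  {f : Fin N → ℂ} {μ : ℝ}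

/-- Complex conjugation of the eigenvector produces a null vector of the Hermitian form, which is
nontrivial unless all hopping amplitudes are real. -/
theorem exists_hessianForm_mulVec_eq_zero (hT0 : T0.map star = T0)
    (hM : M = T0 + ∑ j, hoppingTerm (u j) (v j) (z j)) (hf : M *ᵥ f = (μ : ℂ) • f)
    (hR : IsReducedResolvent M μ f R) (hz : ∀ j, z j ≠ 0)
    (hnv : ∀ j, f (u j) ≠ 0 ∨ f (v j) ≠ 0)
    (hB : ∀ j, star f ⬝ᵥ hoppingGrad (u j) (v j) (z j) f = 0) :
    ∃ c : Fin d → ℂ, hessianForm R (fun j => hoppingGrad (u j) (v j) (z j) f)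
        (fun j => -(z j * star (f (u j)) * f (v j))) *ᵥ c = 0 ∧
      (c = 0 → ∀ j, (z j).im = 0) := by
  choose c hc₁ hc₂ hc₃ using fun j => exists_hopping_conj (u j) (v j) (hz j) (hnv j)
    (star_dotProduct_hoppingGrad_eq_zero_iff.mp (hB j))
  refine ⟨c, ?_, fun h j => hc₃ j (congrFun h j)⟩
  have hmap : M.map star = M + ∑ j, (hoppingTerm (u j) (v j) (star (z j)) -
      hoppingTerm (u j) (v j) (z j)) := by
    rw [hM, map_star_add_sum_hoppingTerm, hT0, Finset.sum_sub_distrib]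
    abel
  have hconj : M *ᵥ star f - (μ : ℂ) • star f =
      -∑ j, c j • hoppingGrad (u j) (v j) (z j) f := by
    have h1 : M.map star *ᵥ star f = (μ : ℂ) • star f := by
      rw [← star_mulVec_eq_map, hf, star_smul]
      simp
    rw [← h1, hmap, add_mulVec, sum_mulVec, ← sub_sub, sub_self, zero_sub]
    congr 1
    refine Finset.sum_congr rfl fun j _ => ?_
    rw [← hc₂, sub_mulVec, hoppingTerm_mulVec, hoppingTerm_mulVec, add_sub_add_comm,
      ← Pi.single_sub, ← Pi.single_sub, star_star, sub_mul, sub_mul]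
    rfl
  have hRb := hR.mulVec_sub (star f)
  rw [hconj, mulVec_neg, neg_eq_iff_eq_neg] at hRb
  ext j
  have hBf : star (hoppingGrad (u j) (v j) (z j) f) ⬝ᵥ f = 0 := by
    rw [star_dotProduct, hB, star_zero]
  rw [mulVec_hessianForm, hRb, dotProduct_neg, dotProduct_sub, dotProduct_smul, hBf, hc₁,
    Pi.zero_apply, smul_zero]
  ring

/-- If the matrix and all hopping amplitudes are real, so is the Hermitian form. -/
theorem hessianForm_im_eq_zero (hT0 : T0.map star = T0)
    (hM : M = T0 + ∑ j, hoppingTerm (u j) (v j) (z j)) (hf : M *ᵥ f = (μ : ℂ) • f)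
    (hunit : star f ⬝ᵥ f = 1)
    (hR : IsReducedResolvent M μ f R) (hz : ∀ j, (z j).im = 0)
    (hB : ∀ j, star f ⬝ᵥ hoppingGrad (u j) (v j) (z j) f = 0) (j k : Fin d) :
    (hessianForm R (fun j => hoppingGrad (u j) (v j) (z j) f)
        (fun j => -(z j * star (f (u j)) * f (v j))) j k).im = 0 := by
  have hz' : ∀ j, star (z j) = z j := fun j => conj_eq_iff_im.mpr (hz j)
  have hmap : M.map star = M := by
    simp only [hM, map_star_add_sum_hoppingTerm, hT0, hz']
  have hMstar : ∀ y, star (M *ᵥ y - (μ : ℂ) • y) = M *ᵥ star y - (μ : ℂ) • star y := by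
    intro y
    rw [star_sub, star_mulVec_eq_map, hmap, star_smul]
    simp
  set ω := star f ⬝ᵥ star f with hω
  have hfω : star f = ω • f := by
    have h1 := hR.mulVec_sub (star f)
    rw [← hMstar, hf, sub_self, star_zero, mulVec_zero] at h1
    exact sub_eq_zero.mp h1.symm
  have hω1 : star ω * ω = 1 := by
    have h2 := congrArg star hfω
    rw [star_star, star_smul] at h2
    calc star ω * ω = star f ⬝ᵥ (star ω • star f) := by rw [dotProduct_smul, smul_eq_mul]
      _ = 1 := by rw [← h2, hunit]
  set B : Fin d → Fin N → ℂ := fun j => hoppingGrad (u j) (v j) (z j) f with hBdef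
  have hBstar : ∀ j, star (B j) = -ω • B j := by
    intro j
    have h1 : star (Complex.I * z j) = -(Complex.I * z j) := by simp [hz' j]
    simp only [hBdef]
    rw [hoppingGrad_eq_mulVec, star_mulVec_eq_map, map_star_hoppingTerm, hfω, mulVec_smul, h1,
      neg_smul, ← smul_neg]
    congr 1
    rw [hoppingTerm_mulVec, hoppingTerm_mulVec, neg_add, ← Pi.single_neg, ← Pi.single_neg, star_neg,
      neg_mul, neg_mul]
  have hBf : star (B j) ⬝ᵥ f = 0 := by
    rw [star_dotProduct, hB, star_zero]
  have hp : star (R *ᵥ B k) = -ω • (R *ᵥ B k) + (star f ⬝ᵥ star (R *ᵥ B k)) • f := by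
    have h1 := hR.sub_mulVec (B k)
    rw [hB, zero_smul, sub_zero] at h1
    have h2 := hR.mulVec_sub (star (R *ᵥ B k))
    rw [← hMstar, h1, hBstar, mulVec_smul] at h2
    rw [h2, sub_add_cancel]
  have hentry : star (star (B j) ⬝ᵥ R *ᵥ B k) = star (B j) ⬝ᵥ R *ᵥ B k := by
    have h1 : B j = -star ω • star (B j) := by
      have := congrArg star (hBstar j)
      rwa [star_star, star_smul, star_neg] at this
    have h2 : star (star (B j) ⬝ᵥ R *ᵥ B k) = B j ⬝ᵥ star (R *ᵥ B k) := by
      rw [star_dotProduct, star_star, dotProduct_comm]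
    rw [h2, hp]
    conv_lhs => rw [h1]
    rw [smul_dotProduct, dotProduct_add, dotProduct_smul, dotProduct_smul, hBf]
    simp only [smul_eq_mul]
    linear_combination (star (B j) ⬝ᵥ R *ᵥ B k) * hω1
  have hreal := star_dotProduct_hoppingGrad_eq_zero_iff.mp (hB j)
  have hΩ : star (z j * star (f (u j)) * f (v j)) = z j * star (f (u j)) * f (v j) := by
    rw [← hreal]
    simp only [star_mul, star_star]
    linear_combination -hreal
  rw [hessianForm, Matrix.sub_apply, of_apply, sub_im, conj_eq_iff_im.mp hentry, sub_zero,
    diagonal_apply]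
  split_ifs
  · rw [neg_im, conj_eq_iff_im.mp hΩ, neg_zero]
  · rfl

end TimeReversal

/-- For a real hopping family with three phases, a nondegenerate local minimum of a simple eigenvalue
is a global minimum. -/
theorem hoppingFamily_le_of_isLocalMin {N : ℕ} {T0 : Matrix (Fin N) (Fin N) ℂ}
    (hT0 : T0.IsHermitian) (hT0real : T0.map star = T0) {u v : Fin 3 → Fin N} {h : Fin 3 → ℂ}
    (hh : ∀ j, h j ≠ 0) {D : (Fin 3 → ℝ) → Fin N → ℝ}
    (hD : ∀ α, ∃ U, IsSortedDiagonalization (hoppingFamily T0 u v h α) (D α) U) {n : Fin N}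
    {α0 : Fin 3 → ℝ} (hn : ∀ i, D α0 i = D α0 n → i = n) {f : Fin N → ℂ}
    (hf : hoppingFamily T0 u v h α0 *ᵥ f = (D α0 n : ℂ) • f) (hunit : star f ⬝ᵥ f = 1)
    (hnv : ∀ j, f (u j) ≠ 0 ∨ f (v j) ≠ 0) (hmin : IsLocalMin (fun α => D α n) α0)
    {Hess : Matrix (Fin 3) (Fin 3) ℝ} (hHess : ∀ j k : Fin 3, Hess j k =
      fderiv ℝ (fun β => fderiv ℝ (fun α => D α n) β (Pi.single k 1)) α0 (Pi.single j 1))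
    (hpd : Hess.PosDef) (α : Fin 3 → ℝ) : D α0 n ≤ D α n := by
  obtain ⟨U, hU⟩ := hD α0
  obtain ⟨V, hV⟩ := hD α
  obtain ⟨R, hR⟩ := hU.exists_isReducedResolvent hn hf hunit
  obtain ⟨-, -, hsmooth, -, -⟩ := IsSortedDiagonalization.exists_contDiffAt_eigenvector hD
    contDiff_hoppingFamily (hoppingFamily_isHermitian hT0 α0) hn hf hunit
  obtain ⟨z, hz⟩ : ∃ z : Fin 3 → ℂ, ∀ j, z j = h j * Complex.exp (Complex.I * α0 j) :=
    ⟨_, fun _ => rfl⟩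
  have hline := hoppingFamily_deriv_line hD hT0 hn hf hunit hR hz
  have hz0 : ∀ j, z j ≠ 0 := fun j => by
    rw [hz]
    exact mul_ne_zero (hh j) (exp_ne_zero _)
  have hB : ∀ j, star f ⬝ᵥ hoppingGrad (u j) (v j) (z j) f = 0 := by
    intro j
    have h1 := (hline (Pi.single j 1)).1
    have h2 : ∑ k, (((Pi.single j 1 : Fin 3 → ℝ) k : ℝ) : ℂ) • hoppingGrad (u k) (v k) (z k) f =
        hoppingGrad (u j) (v j) (z j) f := by
      rw [Finset.sum_eq_single j]
      · simp
      · intro k _ hk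
        simp [hk]
      · simp
    rw [h2, (hsmooth.deriv_line _).self_of_nhds, zero_smul, add_zero, hmin.fderiv_eq_zero,
      _root_.zero_apply] at h1
    have h3 := star_quadForm_swap (hoppingTerm_isHermitian (u j) (v j) (Complex.I * z j)) f f
    rw [← hoppingGrad_eq_mulVec] at h3
    exact Complex.ext h1.symm (conj_eq_iff_im.mp h3)
  set W := hessianForm R (fun j => hoppingGrad (u j) (v j) (z j) f)
    (fun j => -(z j * star (f (u j)) * f (v j))) with hWdef
  have hreal := fun j => star_dotProduct_hoppingGrad_eq_zero_iff.mp (hB j)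
  have hWH : W.IsHermitian := hessianForm_isHermitian hR.isHermitian _ fun j => by
    simp only [star_neg, star_mul, star_star]
    linear_combination -hreal j
  have hWpos : ∀ t : Fin 3 → ℝ, t ≠ 0 →
      0 < (star (fun i => (t i : ℂ)) ⬝ᵥ W *ᵥ fun i => (t i : ℂ)).re := by
    intro t ht
    have h1 := (hline t).2 hB
    rw [hsmooth.deriv_deriv_line] at h1
    have h2 := hpd.dotProduct_mulVec_pos ht
    have h3 : star t ⬝ᵥ Hess *ᵥ t = ∑ j, ∑ k, t j * t k *
        fderiv ℝ (fun β => fderiv ℝ (fun α => D α n) β (Pi.single k 1)) α0 (Pi.single j 1) := by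
      simp only [dotProduct, mulVec, Finset.mul_sum, ← hHess]
      refine Finset.sum_congr rfl fun j _ => Finset.sum_congr rfl fun k _ => ?_
      simp
      ring
    rw [h3, h1] at h2
    linarith
  have hM : hoppingFamily T0 u v h α0 = T0 + ∑ j, hoppingTerm (u j) (v j) (z j) := by
    simp only [hoppingFamily, hz]
  have hWnonneg : ∀ y, 0 ≤ (star y ⬝ᵥ W *ᵥ y).re := by
    obtain ⟨c, hc, hc0⟩ := exists_hessianForm_mulVec_eq_zero hT0real hM hf hR hz0 hnv hB
    by_cases hcz : c = 0
    · refine quadForm_nonneg_of_real_s13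
        (hessianForm_im_eq_zero hT0real hM hf hunit hR (hc0 hcz) hB) fun t => ?_
      by_cases ht : t = 0
      · simp [ht, dotProduct, mulVec]
      · exact (hWpos t ht).le
    · exact quadForm_nonneg_of_mulVec_eq_zero hWH hWpos hcz hc
  set w : Fin 3 → ℂ := fun j => Complex.exp (Complex.I * (α j - α0 j)) with hw
  have hw1 : ∀ j, w j * star (w j) = 1 := by
    intro j
    have : w j = Complex.exp (((α j - α0 j : ℝ) : ℂ) * Complex.I) := by
      simp only [hw]
      push_cast
      ring_nf
    rw [Complex.star_def, mul_conj, normSq_eq_norm_sq, this, norm_exp_ofReal_mul_I]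
    simp
  choose L hL using fun j => exists_hopping_linear (u j) (v j) (hw1 j) (hnv j) (hreal j)
  refine eigenvalue_le_of_hessianForm_nonneg (hoppingFamily_isHermitian hT0 α0) hU hV hR hB L
    (fun x => ?_) hWnonneg
  have hzw : ∀ j, h j * Complex.exp (Complex.I * α j) = z j * w j := by
    intro j
    rw [hz, hw, mul_assoc, ← Complex.exp_add]
    ring_nf
  simp only [hL]
  rw [hM, hoppingFamily, add_mulVec, add_mulVec, dotProduct_add, dotProduct_add, sum_mulVec,
    sum_mulVec, dotProduct_sum, dotProduct_sum, add_assoc, ← Finset.sum_add_distrib]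
  congr 1
  refine Finset.sum_congr rfl fun j _ => ?_
  rw [hzw, quadForm_hoppingTerm, quadForm_hoppingTerm, star_mul]
  ring

theorem hoppingFamily_neg {N d : ℕ} (T0 : Matrix (Fin N) (Fin N) ℂ) (u v : Fin d → Fin N)
    (h : Fin d → ℂ) (α : Fin d → ℝ) :
    hoppingFamily (-T0) u v (-h) α = -hoppingFamily T0 u v h α := by
  have hterm : ∀ (i j : Fin N) (z : ℂ), hoppingTerm i j (-z) = -hoppingTerm i j z := by
    intro i j z
    rw [hoppingTerm, hoppingTerm, star_neg, ← single_neg, ← single_neg, neg_add]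
  simp only [hoppingFamily, Pi.neg_apply, neg_mul, hterm, Finset.sum_neg_distrib, neg_add]

/-- Theorem 1.5(3) of the paper: in the time-reversal symmetric case with `d = 3`, any
non-degenerate local extremum of the band (Hessian definite; simple eigenvalue,
eigenvector non-vanishing on crossing edges) is a global extremum. -/
theorem nondegenerate_local_extremum_is_global_dim_three
    (d N : ℕ) (hd : 0 < d) (hN : 0 < N)
    (u v : Fin d → Fin N) (h : Fin d → ℂ) (hh : ∀ j, h j ≠ 0)
    (T0 : Matrix (Fin N) (Fin N) ℂ) (hT0 : T0.IsHermitian)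
    (T : (Fin d → ℝ) → Matrix (Fin N) (Fin N) ℂ)
    (hT : ∀ α : Fin d → ℝ, T α = T0 + ∑ j : Fin d,
      (Matrix.single (u j) (v j) (h j * Complex.exp (Complex.I * (α j : ℂ))) +
       Matrix.single (v j) (u j)
         ((starRingEnd ℂ) (h j) * Complex.exp (-(Complex.I * (α j : ℂ))))))
    (n : Fin N)
    (hT0real : ∀ i j, (T0 i j).im = 0) (hhreal : ∀ j, (h j).im = 0)
    (α0 : Fin d → ℝ) (f : Fin N → ℂ)
    (hsimple : Nat.card {i : Fin N // sortedEigs (T α0) i = sortedEigs (T α0) n} = 1)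
    (hunit : star f ⬝ᵥ f = (1 : ℂ))
    (heig : (T α0).mulVec f = ((sortedEigs (T α0) n : ℝ) : ℂ) • f)
    (hnv : ∀ j, f (u j) ≠ 0 ∨ f (v j) ≠ 0)
    (lam : (Fin d → ℝ) → ℝ) (hlam : ∀ α, lam α = sortedEigs (T α) n)
    (hdim : d = 3)
    (Hess : Matrix (Fin d) (Fin d) ℝ)
    (hHess : ∀ j k : Fin d, Hess j k =
      fderiv ℝ (fun β => fderiv ℝ lam β (Pi.single k 1)) α0 (Pi.single j 1)) :
    ((IsLocalMin lam α0 ∧ Hess.PosDef) → ∀ α : Fin d → ℝ, lam α0 ≤ lam α) ∧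
    ((IsLocalMax lam α0 ∧ (-Hess).PosDef) → ∀ α : Fin d → ℝ, lam α ≤ lam α0) := by
  subst hdim
  obtain rfl : T = hoppingFamily T0 u v h := by
    ext1 α
    rw [hT, hoppingFamily]
    congr 1
    refine Finset.sum_congr rfl fun j _ => ?_
    rw [hoppingTerm, star_mul, Complex.star_def, ← Complex.exp_conj, mul_comm (Complex.exp _)]
    simp
  have hD := fun α => exists_isSortedDiagonalization (hoppingFamily_isHermitian (u := u) (v := v)
    (h := h) hT0 α)
  have hn : ∀ i, sortedEigs (hoppingFamily T0 u v h α0) i =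
      sortedEigs (hoppingFamily T0 u v h α0) n → i = n := by
    intro i hi
    have := (Nat.card_eq_one_iff_unique.mp hsimple).1
    exact congrArg Subtype.val (this.elim ⟨i, hi⟩ ⟨n, rfl⟩)
  have hreal : T0.map star = T0 := by
    ext i j
    exact conj_eq_iff_im.mpr (hT0real i j)
  obtain rfl : lam = fun α => sortedEigs (hoppingFamily T0 u v h α) n := funext hlam
  refine ⟨fun hmin α => hoppingFamily_le_of_isLocalMin hT0 hreal hh hD hn heig hunit hnv hmin.1
    hHess hmin.2 α, fun hmax α => ?_⟩
  have hmapneg : (-T0).map star = -T0 := by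
    conv_rhs => rw [← hreal]
    ext i j
    simp
  have key := hoppingFamily_le_of_isLocalMin (T0 := -T0) (u := u) (v := v) (h := -h) (n := n.rev)
    (D := fun α i => -sortedEigs (hoppingFamily T0 u v h α) i.rev) (α0 := α0) (f := f)
    (Hess := -Hess) hT0.neg hmapneg
    (fun j => neg_ne_zero.mpr (hh j))
    (fun α => by
      obtain ⟨U, hU⟩ := hD α
      rw [hoppingFamily_neg]
      exact ⟨_, hU.neg⟩)
    (fun i hi => by
      rw [neg_inj, Fin.rev_rev] at hi
      rw [← hn _ hi, Fin.rev_rev])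
    (by
      rw [hoppingFamily_neg, neg_mulVec, heig, Fin.rev_rev, ofReal_neg, neg_smul])
    hunit hnv (by simpa only [Fin.rev_rev] using hmax.1.neg)
    (fun j k => by
      rw [Matrix.neg_apply, hHess]
      simp only [Fin.rev_rev, fderiv_fun_neg, _root_.neg_apply])
    hmax.2 α
  simpa using key
end
end

section
/- Assume the time-reversal symmetric case (T_0 real, all h_j real). Let α° ∈ {0, π}^d and assume λ(α°) is a simple eigenvalue of T(α°), with eigenvector f° chosen real and of unit norm. Then α° is a critical point of λ (∇λ(α°) = 0), and the matrix W = Ω − B*(T(α°) − λ(α°)I)⁺B has real entries (W = Re W). -/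
noncomputable section

open Matrix Complex
open scoped ComplexOrder

theorem sortedEigs_transpose {n : ℕ} (A : Matrix (Fin n) (Fin n) ℂ) :
    sortedEigs Aᵀ = sortedEigs A := by
  by_cases hA : A.IsHermitian
  · have hev : hA.transpose.eigenvalues = hA.eigenvalues :=
      (hA.transpose.eigenvalues_eq_eigenvalues_iff hA).2 A.charpoly_transpose
    rw [sortedEigs, sortedEigs, dif_pos hA.transpose, dif_pos hA, hev]
  · have hAt : ¬ Aᵀ.IsHermitian := fun h => hA (by simpa using h.transpose)
    rw [sortedEigs, sortedEigs, dif_neg hAt, dif_neg hA]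

/-- A function that is symmetric about a point has vanishing derivative there. -/
theorem fderiv_eq_zero_of_reflection_invariant {E F : Type*} [NormedAddCommGroup E]
    [NormedSpace ℝ E] [NormedAddCommGroup F] [NormedSpace ℝ F] (g : E → F) (a : E)
    (hg : ∀ x, g (a + a - x) = g x) : fderiv ℝ g a = 0 := by
  by_cases hd : DifferentiableAt ℝ g a
  · have hs : HasFDerivAt (fun x : E => a + a - x) (-ContinuousLinearMap.id ℝ E) a :=
      (hasFDerivAt_id a).const_sub (a + a)
    have hg' : HasFDerivAt g (fderiv ℝ g a) (a + a - a) := by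
      simpa using hd.hasFDerivAt
    have hc := hg'.comp a hs
    rw [show g ∘ (fun x : E => a + a - x) = g from funext hg] at hc
    have hneg : fderiv ℝ g a = -fderiv ℝ g a := by
      simpa using hd.hasFDerivAt.unique hc
    have htwo : (2 : ℝ) • fderiv ℝ g a = 0 := by
      rw [two_smul]
      exact eq_neg_iff_add_eq_zero.1 hneg
    exact (smul_eq_zero_iff_right two_ne_zero).1 htwo
  · exact fderiv_zero_of_not_differentiableAt hd

/-- Commuting reflexive generalized inverses are unique. -/
theorem commuting_generalized_inverse_unique {R : Type*} [Semigroup R] {a p q : R}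
    (hpc : p * a = a * p) (hpa : a * p * a = a) (hp : p * a * p = p)
    (hqc : q * a = a * q) (hqa : a * q * a = a) (hq : q * a * q = q) : p = q := by
  have h : p * a = a * q := by
    calc p * a = p * (a * q * a) := by rw [hqa]
      _ = (p * a) * (q * a) := by simp only [mul_assoc]
      _ = (a * p * a) * q := by rw [hpc, hqc]; simp only [mul_assoc]
      _ = a * q := by rw [hpa]
  calc p = p * a * p := hp.symm
    _ = q * (a * p) := by rw [h, ← hqc, mul_assoc]
    _ = q * a * q := by rw [← hpc, h, mul_assoc]
    _ = q := hq

theorem pinvH_isGeneralizedInverse {m : Type*} [Fintype m] [DecidableEq m] {A : Matrix m m ℂ}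
    (hA : A.IsHermitian) :
    pinvH A * A = A * pinvH A ∧ A * pinvH A * A = A ∧ pinvH A * A * pinvH A = pinvH A := by
  obtain ⟨U, D, P, hU, hAeq, hPeq, hcomm, hD, hP⟩ : ∃ U D P : Matrix m m ℂ,
      star U * U = 1 ∧ A = U * D * star U ∧ pinvH A = U * P * star U ∧
      P * D = D * P ∧ D * P * D = D ∧ P * D * P = P := by
    refine ⟨hA.eigenvectorUnitary, diagonal (RCLike.ofReal ∘ hA.eigenvalues),
      diagonal (fun i => if hA.eigenvalues i = 0 then 0 else ((hA.eigenvalues i : ℂ))⁻¹),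
      Unitary.coe_star_mul_self _, ?_, by rw [pinvH, dif_pos hA], ?_, ?_, ?_⟩
    · exact hA.spectral_theorem
    all_goals
      simp only [diagonal_mul_diagonal]
      congr 1
      funext i
      by_cases hi : hA.eigenvalues i = 0 <;> simp [hi]
  have hmul (X Y : Matrix m m ℂ) : U * X * star U * (U * Y * star U) = U * (X * Y) * star U := by
    calc _ = U * X * (star U * U) * Y * star U := by simp only [mul_assoc]
      _ = _ := by rw [hU]; simp only [mul_assoc, one_mul]
  rw [hPeq, hAeq]
  simp only [hmul]
  exact ⟨by rw [hcomm], by rw [hD], by rw [hP]⟩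

theorem pinvH_map_conj {m : Type*} [Fintype m] [DecidableEq m] {A : Matrix m m ℂ}
    (hA : A.map (starRingEnd ℂ) = A) : (pinvH A).map (starRingEnd ℂ) = pinvH A := by
  by_cases hH : A.IsHermitian
  · obtain ⟨hc, ha, hp⟩ := pinvH_isGeneralizedInverse hH
    have hc' := congrArg (fun M => M.map (starRingEnd ℂ)) hc
    have ha' := congrArg (fun M => M.map (starRingEnd ℂ)) ha
    have hp' := congrArg (fun M => M.map (starRingEnd ℂ)) hp
    simp only [Matrix.map_mul, hA] at hc' ha' hp'
    exact commuting_generalized_inverse_unique hc' ha' hp' hc ha hp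
  · ext i j
    simp [pinvH, dif_neg hH]

/-- Lemma 4.1 of the paper: in the time-reversal symmetric case, every corner point
`α° ∈ {0, π}^d` at which the eigenvalue is simple (with real unit eigenvector `f°`) is
a critical point of the band, and the corresponding test matrix `W` is real. -/
theorem corner_point_is_critical_and_W_real
    (d N : ℕ) (hd : 0 < d) (hN : 0 < N)
    (u v : Fin d → Fin N) (h : Fin d → ℂ) (hh : ∀ j, h j ≠ 0)
    (T0 : Matrix (Fin N) (Fin N) ℂ) (hT0 : T0.IsHermitian)
    (T : (Fin d → ℝ) → Matrix (Fin N) (Fin N) ℂ)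
    (hT : ∀ α : Fin d → ℝ, T α = T0 + ∑ j : Fin d,
      (Matrix.single (u j) (v j) (h j * Complex.exp (Complex.I * (α j : ℂ))) +
       Matrix.single (v j) (u j)
         ((starRingEnd ℂ) (h j) * Complex.exp (-(Complex.I * (α j : ℂ))))))
    (n : Fin N)
    (hT0real : ∀ i j, (T0 i j).im = 0) (hhreal : ∀ j, (h j).im = 0)
    (α0 : Fin d → ℝ) (f : Fin N → ℂ)
    (hcorner : ∀ j : Fin d, α0 j = 0 ∨ α0 j = Real.pi)
    (hsimple : Nat.card {i : Fin N // sortedEigs (T α0) i = sortedEigs (T α0) n} = 1)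
    (hfreal : ∀ i, (f i).im = 0)
    (hunit : star f ⬝ᵥ f = (1 : ℂ))
    (heig : (T α0).mulVec f = ((sortedEigs (T α0) n : ℝ) : ℂ) • f)
    (B : Matrix (Fin N) (Fin d) ℂ)
    (hB : B = Matrix.of fun i j => Complex.I *
      (h j * Complex.exp (Complex.I * (α0 j : ℂ)) * f (v j) * (if i = u j then 1 else 0) -
       (starRingEnd ℂ) (h j) * Complex.exp (-(Complex.I * (α0 j : ℂ))) * f (u j) *
         (if i = v j then 1 else 0)))
    (Ω : Matrix (Fin d) (Fin d) ℂ)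
    (hΩ : Ω = Matrix.diagonal fun j =>
      (((-(h j * Complex.exp (Complex.I * (α0 j : ℂ)) * f (v j) *
        (starRingEnd ℂ) (f (u j)))).re : ℝ) : ℂ))
    (W : Matrix (Fin d) (Fin d) ℂ)
    (hW : W = Ω - Bᴴ * pinvH (T α0 - ((sortedEigs (T α0) n : ℝ) : ℂ) •
      (1 : Matrix (Fin N) (Fin N) ℂ)) * B)
    :
    (∀ j : Fin d, fderiv ℝ (fun β => sortedEigs (T β) n) α0 (Pi.single j 1) = 0) ∧
    (∀ j k : Fin d, (W j k).im = 0) := by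
  have hcT0 (i j : Fin N) : (starRingEnd ℂ) (T0 i j) = T0 i j := conj_eq_iff_im.2 (hT0real i j)
  have hch (j : Fin d) : (starRingEnd ℂ) (h j) = h j := conj_eq_iff_im.2 (hhreal j)
  have hcf (i : Fin N) : (starRingEnd ℂ) (f i) = f i := conj_eq_iff_im.2 (hfreal i)
  have hexp (j : Fin d) : exp (I * (α0 j : ℂ)) = 1 ∨ exp (I * (α0 j : ℂ)) = -1 := by
    rcases hcorner j with hj | hj
    · left; simp [hj]
    · right; rw [hj, mul_comm, exp_pi_mul_I]
  have hexpneg (j : Fin d) : exp (-(I * (α0 j : ℂ))) = exp (I * (α0 j : ℂ)) := by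
    rw [Complex.exp_neg]
    rcases hexp j with hj | hj <;> rw [hj] <;> norm_num
  have hcexp (j : Fin d) :
      (starRingEnd ℂ) (exp (I * (α0 j : ℂ))) = exp (I * (α0 j : ℂ)) := by
    rcases hexp j with hj | hj <;> rw [hj] <;> simp
  constructor
  · have hT0t : T0ᵀ = T0 := by
      ext i j
      rw [transpose_apply, ← hcT0 j i]
      exact hT0.apply i j
    have hrefl (β : Fin d → ℝ) : T (α0 + α0 - β) = (T β)ᵀ := by
      rw [hT, hT, transpose_add, hT0t, transpose_sum]
      congr 1
      refine Finset.sum_congr rfl fun j _ => ?_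
      have hplus : exp (I * (((α0 + α0 - β) j : ℝ) : ℂ)) = exp (-(I * (β j : ℂ))) := by
        have hsplit : I * (((α0 + α0 - β) j : ℝ) : ℂ) =
            I * (α0 j : ℂ) + I * (α0 j : ℂ) + -(I * (β j : ℂ)) := by
          simp only [Pi.sub_apply, Pi.add_apply]
          push_cast
          ring
        rw [hsplit, Complex.exp_add, Complex.exp_add]
        rcases hexp j with hj | hj <;> rw [hj] <;> norm_num
      have hminus : exp (-(I * (((α0 + α0 - β) j : ℝ) : ℂ))) = exp (I * (β j : ℂ)) := by
        rw [Complex.exp_neg, hplus, ← Complex.exp_neg, neg_neg]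
      rw [hplus, hminus, transpose_add, transpose_single, transpose_single, hch, add_comm]
    have hzero := fderiv_eq_zero_of_reflection_invariant (fun β => sortedEigs (T β) n) α0
      fun β => by rw [hrefl, sortedEigs_transpose]
    intro j
    rw [hzero]
    rfl
  · have hAreal : (T α0 - ((sortedEigs (T α0) n : ℝ) : ℂ) •
        (1 : Matrix (Fin N) (Fin N) ℂ)).map (starRingEnd ℂ) =
        T α0 - ((sortedEigs (T α0) n : ℝ) : ℂ) • (1 : Matrix (Fin N) (Fin N) ℂ) := by
      generalize sortedEigs (T α0) n = l
      ext i k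
      simp only [hT, map_apply, Matrix.sub_apply, Matrix.add_apply, Matrix.smul_apply,
        Matrix.sum_apply, single_apply, one_apply, smul_eq_mul, map_sub, map_add, map_mul, map_sum, conj_ofReal, hcT0, hch,
        hcexp, hexpneg, apply_ite (starRingEnd ℂ), map_zero, map_one]
    have hPreal := pinvH_map_conj hAreal
    have hBimag : B.map (starRingEnd ℂ) = -B := by
      rw [hB]
      ext i k
      simp only [map_apply, of_apply, Matrix.neg_apply, map_mul, map_sub, conj_I, hch, hcexp, hexpneg,
        hcf, apply_ite (starRingEnd ℂ), map_zero, map_one, neg_mul]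
    have hBHimag : Bᴴ.map (starRingEnd ℂ) = -Bᴴ := by
      rw [conjTranspose_map (starRingEnd ℂ) (fun _ => rfl), hBimag, conjTranspose_neg]
    have hΩreal : Ω.map (starRingEnd ℂ) = Ω := by
      rw [hΩ, diagonal_map (map_zero _)]
      simp only [conj_ofReal]
    have hWreal : W.map (starRingEnd ℂ) = W := by
      rw [hW, Matrix.map_sub _ (map_sub _), Matrix.map_mul, Matrix.map_mul, hPreal, hBimag,
        hBHimag, hΩreal, Matrix.neg_mul, Matrix.neg_mul, Matrix.mul_neg, neg_neg]
    intro j k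
    exact conj_eq_iff_im.1 (congrFun (congrFun hWreal j) k)
end
end

section
/- Assume the time-reversal symmetric case (T_0 real, all h_j real). Suppose α° is a critical point of λ, λ(α°) is a simple eigenvalue of T(α°), and its unit eigenvector f° is non-vanishing on crossing edges. If α° ∉ {0, π}^d (modulo 2π in each coordinate), then i_0(W) ≥ 1, i.e. 0 is an eigenvalue of W and det W = 0. -/
noncomputable section

open Matrix Complex
open scoped ComplexOrder

/-- The pseudoinverse is a generalized inverse. -/
theorem mul_pinvH_mul_self {m : Type*} [Fintype m] [DecidableEq m] {A : Matrix m m ℂ}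
    (hA : A.IsHermitian) : A * pinvH A * A = A := by
  set U : Matrix m m ℂ := (hA.eigenvectorUnitary : Matrix m m ℂ) with hU
  set D : Matrix m m ℂ := Matrix.diagonal (fun i => (hA.eigenvalues i : ℂ)) with hD
  set E : Matrix m m ℂ := Matrix.diagonal
    (fun i => if hA.eigenvalues i = 0 then 0 else ((hA.eigenvalues i : ℂ))⁻¹) with hE
  have hUU : star U * U = 1 := Unitary.coe_star_mul_self hA.eigenvectorUnitary
  have hspec : A = U * D * star U := hA.spectral_theorem
  have hP : pinvH A = U * E * star U := by
    rw [pinvH, dif_pos hA]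
  have hDED : D * E * D = D := by
    rw [hD, hE, Matrix.diagonal_mul_diagonal, Matrix.diagonal_mul_diagonal]
    congr 1
    funext i
    by_cases h0 : hA.eigenvalues i = 0
    · simp [h0]
    · simp [h0]
  calc A * pinvH A * A
      = U * D * (star U * U) * E * (star U * U) * D * star U := by
        rw [hP]; nth_rewrite 1 2 [hspec]; simp only [Matrix.mul_assoc]
    _ = U * (D * E * D) * star U := by
        rw [hUU]; simp only [Matrix.mul_assoc, Matrix.one_mul]
    _ = A := by rw [hDED, ← hspec]

/-- The eigenspace of a simple eigenvalue is spanned by any of its eigenvectors. -/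
theorem exists_eq_smul_of_simple_eigenvalue {N : ℕ} {A : Matrix (Fin N) (Fin N) ℂ}
    (hA : A.IsHermitian) {μ : ℝ} (hsimple : Nat.card {i : Fin N // sortedEigs A i = μ} = 1)
    {f g : Fin N → ℂ} (hf0 : f ≠ 0) (hf : A *ᵥ f = (μ : ℂ) • f) (hg : A *ᵥ g = (μ : ℂ) • g) :
    ∃ c : ℂ, g = c • f := by
  set U : Matrix (Fin N) (Fin N) ℂ := (hA.eigenvectorUnitary : Matrix (Fin N) (Fin N) ℂ) with hU
  set D : Matrix (Fin N) (Fin N) ℂ := Matrix.diagonal (fun i => (hA.eigenvalues i : ℂ)) with hD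
  have hUU : star U * U = 1 := Unitary.coe_star_mul_self hA.eigenvectorUnitary
  have hUU' : U * star U = 1 := Unitary.coe_mul_star_self hA.eigenvectorUnitary
  have hspec : A = U * D * star U := hA.spectral_theorem
  have coord : ∀ w : Fin N → ℂ, A *ᵥ w = (μ : ℂ) • w →
      ∀ i, hA.eigenvalues i ≠ μ → (star U *ᵥ w) i = 0 := by
    intro w hw i hi
    have h1 : D *ᵥ (star U *ᵥ w) = (μ : ℂ) • (star U *ᵥ w) := by
      rw [← Matrix.mulVec_smul, ← hw]
      nth_rewrite 1 [hspec]
      rw [Matrix.mulVec_mulVec, Matrix.mulVec_mulVec, ← Matrix.mul_assoc, ← Matrix.mul_assoc,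
        hUU, Matrix.one_mul]
    have h2 := congrFun h1 i
    rw [hD, Matrix.mulVec_diagonal, Pi.smul_apply, smul_eq_mul] at h2
    have h3 : ((hA.eigenvalues i : ℂ) - μ) * (star U *ᵥ w) i = 0 := by
      rw [sub_mul, h2, sub_self]
    exact (mul_eq_zero.mp h3).resolve_left (sub_ne_zero.mpr (by exact_mod_cast hi))
  obtain ⟨hsub, -⟩ := Nat.card_eq_one_iff_unique.mp hsimple
  have huniq : ∀ i j, hA.eigenvalues i = μ → hA.eigenvalues j = μ → i = j := by
    intro i j hi hj
    have key : ∀ k, hA.eigenvalues k = μ →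
        sortedEigs A ((Tuple.sort hA.eigenvalues).symm k) = μ := by
      intro k hk
      rw [sortedEigs, dif_pos hA]
      simpa using hk
    have := hsub.elim ⟨_, key i hi⟩ ⟨_, key j hj⟩
    simpa using this
  have back : ∀ w : Fin N → ℂ, U *ᵥ (star U *ᵥ w) = w := by
    intro w
    rw [Matrix.mulVec_mulVec, hUU', Matrix.one_mulVec]
  obtain ⟨k, hk⟩ : ∃ k, (star U *ᵥ f) k ≠ 0 := by
    by_contra! hall
    apply hf0
    rw [← back f, show star U *ᵥ f = 0 from funext hall, Matrix.mulVec_zero]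
  have hkμ : hA.eigenvalues k = μ := by
    by_contra hne
    exact hk (coord f hf k hne)
  refine ⟨(star U *ᵥ g) k / (star U *ᵥ f) k, ?_⟩
  suffices hcoord : star U *ᵥ g = ((star U *ᵥ g) k / (star U *ᵥ f) k) • (star U *ᵥ f) by
    nth_rewrite 1 [← back g, hcoord]
    rw [Matrix.mulVec_smul, back f]
  funext i
  rw [Pi.smul_apply, smul_eq_mul]
  by_cases hi : hA.eigenvalues i = μ
  · rw [huniq i k hi hkμ, div_mul_cancel₀ _ hk]
  · rw [coord g hg i hi, coord f hf i hi, mul_zero]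

/-- If the block matrix `[A, B; Bᴴ, Ω]` annihilates `(y, x)` and `Bᴴ` annihilates `ker A`, then the
generalized Schur complement `Ω - Bᴴ A⁺ B` annihilates `x`. -/
theorem schur_pinvH_mulVec_eq_zero {m k : Type*} [Fintype m] [DecidableEq m] [Fintype k]
    {A : Matrix m m ℂ} (hA : A.IsHermitian) {B : Matrix m k ℂ} {Ω : Matrix k k ℂ}
    (hker : ∀ w, A *ᵥ w = 0 → Bᴴ *ᵥ w = 0) {y : m → ℂ} {x : k → ℂ}
    (hAB : A *ᵥ y + B *ᵥ x = 0) (hBΩ : Bᴴ *ᵥ y + Ω *ᵥ x = 0) :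
    (Ω - Bᴴ * pinvH A * B) *ᵥ x = 0 := by
  have hBx : B *ᵥ x = -(A *ᵥ y) := (neg_eq_of_add_eq_zero_right hAB).symm
  have hw : A *ᵥ (pinvH A *ᵥ (A *ᵥ y) - y) = 0 := by
    rw [Matrix.mulVec_sub, Matrix.mulVec_mulVec, Matrix.mulVec_mulVec,
      mul_pinvH_mul_self hA, sub_self]
  have h1 := hker _ hw
  rw [Matrix.mulVec_sub, sub_eq_zero] at h1
  rw [Matrix.sub_mulVec, ← Matrix.mulVec_mulVec, ← Matrix.mulVec_mulVec, hBx, Matrix.mulVec_neg,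
    Matrix.mulVec_neg, h1, sub_neg_eq_add, add_comm, hBΩ]

/-- A singular Hermitian matrix has a zero eigenvalue. -/
theorem one_le_iZero_of_det_eq_zero {m : Type*} [Fintype m] [DecidableEq m] {A : Matrix m m ℂ}
    (hA : A.IsHermitian) (hdet : A.det = 0) : 1 ≤ iZero A := by
  rw [hA.det_eq_prod_eigenvalues, Finset.prod_eq_zero_iff] at hdet
  obtain ⟨i, -, hi⟩ := hdet
  rw [iZero, dif_pos hA]
  have : Nonempty {i // hA.eigenvalues i = 0} := ⟨⟨i, RCLike.ofReal_eq_zero.mp hi⟩⟩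
  exact Nat.card_pos

/-- The pseudoinverse of a Hermitian matrix is Hermitian. -/
theorem isHermitian_pinvH {m : Type*} [Fintype m] [DecidableEq m] (A : Matrix m m ℂ) :
    (pinvH A).IsHermitian := by
  unfold pinvH
  split_ifs with hA
  · rw [Matrix.star_eq_conjTranspose]
    apply Matrix.isHermitian_mul_mul_conjTranspose
    rw [Matrix.isHermitian_diagonal_iff]
    intro i
    split_ifs
    · exact IsSelfAdjoint.zero _
    · simp [IsSelfAdjoint]
  · exact Matrix.isHermitian_zero

/-- If `e * a * conj b` is real for a phase `e` with inverse `e'`, and `a`, `b` are not both zero,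
then `(conj a, conj b)` is a nonzero multiple of `(e * a, e' * b)`. -/
theorem exists_common_phase {e e' a b : ℂ} (hee : e * e' = 1)
    (hreal : e * a * (starRingEnd ℂ) b = e' * (starRingEnd ℂ) a * b) (hab : b ≠ 0 ∨ a ≠ 0) :
    ∃ c : ℂ, c ≠ 0 ∧ (starRingEnd ℂ) a = c * (e * a) ∧ (starRingEnd ℂ) b = c * (e' * b) := by
  have he : e ≠ 0 := left_ne_zero_of_mul_eq_one hee
  have he' : e' ≠ 0 := right_ne_zero_of_mul_eq_one hee
  rcases hab with hb | ha
  · refine ⟨(starRingEnd ℂ) b * e / b, ?_, ?_, ?_⟩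
    · simp [hb, he]
    · field_simp
      linear_combination (-(starRingEnd ℂ) a * b) * hee - e * hreal
    · field_simp
      linear_combination (-(starRingEnd ℂ) b) * hee
  · refine ⟨(starRingEnd ℂ) a * e' / a, ?_, ?_, ?_⟩
    · simp [ha, he']
    · field_simp
      linear_combination (-(starRingEnd ℂ) a) * hee
    · field_simp
      linear_combination (-(starRingEnd ℂ) b * a) * hee + e' * hreal

/-- Theorem 4.4 of the paper: in the time-reversal symmetric case, at a critical point
`α°` which is not a corner point modulo `2π` (simple eigenvalue, eigenvector
non-vanishing on crossing edges), the test matrix `W` is degenerate: `i_0(W) ≥ 1`,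
i.e. `0` is an eigenvalue of `W` and `det W = 0`. -/
theorem W_degenerate_at_interior_critical_point
    (d N : ℕ) (hd : 0 < d) (hN : 0 < N)
    (u v : Fin d → Fin N) (h : Fin d → ℂ) (hh : ∀ j, h j ≠ 0)
    (T0 : Matrix (Fin N) (Fin N) ℂ) (hT0 : T0.IsHermitian)
    (T : (Fin d → ℝ) → Matrix (Fin N) (Fin N) ℂ)
    (hT : ∀ α : Fin d → ℝ, T α = T0 + ∑ j : Fin d,
      (Matrix.single (u j) (v j) (h j * Complex.exp (Complex.I * (α j : ℂ))) +
       Matrix.single (v j) (u j)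
         ((starRingEnd ℂ) (h j) * Complex.exp (-(Complex.I * (α j : ℂ))))))
    (n : Fin N)
    (hT0real : ∀ i j, (T0 i j).im = 0) (hhreal : ∀ j, (h j).im = 0)
    (α0 : Fin d → ℝ) (f : Fin N → ℂ)
    (hsimple : Nat.card {i : Fin N // sortedEigs (T α0) i = sortedEigs (T α0) n} = 1)
    (hunit : star f ⬝ᵥ f = (1 : ℂ))
    (heig : (T α0).mulVec f = ((sortedEigs (T α0) n : ℝ) : ℂ) • f)
    (hcrit : ∀ j, (h j * Complex.exp (Complex.I * (α0 j : ℂ)) * f (v j) *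
      (starRingEnd ℂ) (f (u j))).im = 0)
    (hnv : ∀ j, f (u j) ≠ 0 ∨ f (v j) ≠ 0)
    (B : Matrix (Fin N) (Fin d) ℂ)
    (hB : B = Matrix.of fun i j => Complex.I *
      (h j * Complex.exp (Complex.I * (α0 j : ℂ)) * f (v j) * (if i = u j then 1 else 0) -
       (starRingEnd ℂ) (h j) * Complex.exp (-(Complex.I * (α0 j : ℂ))) * f (u j) *
         (if i = v j then 1 else 0)))
    (Ω : Matrix (Fin d) (Fin d) ℂ)
    (hΩ : Ω = Matrix.diagonal fun j =>
      (((-(h j * Complex.exp (Complex.I * (α0 j : ℂ)) * f (v j) *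
        (starRingEnd ℂ) (f (u j)))).re : ℝ) : ℂ))
    (W : Matrix (Fin d) (Fin d) ℂ)
    (hW : W = Ω - Bᴴ * pinvH (T α0 - ((sortedEigs (T α0) n : ℝ) : ℂ) •
      (1 : Matrix (Fin N) (Fin N) ℂ)) * B)
    (hnotcorner : ∃ j : Fin d, ∀ k : ℤ, α0 j ≠ k * Real.pi) :
    1 ≤ iZero W ∧ W.det = 0 := by
  set μ : ℝ := sortedEigs (T α0) n with hμ
  set e : Fin d → ℂ := fun j => Complex.exp (Complex.I * (α0 j : ℂ)) with he
  set e' : Fin d → ℂ := fun j => Complex.exp (-(Complex.I * (α0 j : ℂ))) with he'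
  have hee : ∀ j, e j * e' j = 1 := fun j => by
    rw [he, he', ← Complex.exp_add, add_neg_cancel, Complex.exp_zero]
  have hce : ∀ j, (starRingEnd ℂ) (e j) = e' j := fun j => by
    simp [he, he', ← Complex.exp_conj]
  have hce' : ∀ j, (starRingEnd ℂ) (e' j) = e j := fun j => by
    rw [← hce, Complex.conj_conj]
  have hch : ∀ j, (starRingEnd ℂ) (h j) = h j := fun j => Complex.conj_eq_iff_im.mpr (hhreal j)
  have hcT : ∀ i j, (starRingEnd ℂ) (T0 i j) = T0 i j := fun i j =>
    Complex.conj_eq_iff_im.mpr (hT0real i j)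
  have hreal : ∀ j, e j * f (v j) * (starRingEnd ℂ) (f (u j)) =
      e' j * (starRingEnd ℂ) (f (v j)) * f (u j) := by
    intro j
    have h1 := Complex.conj_eq_iff_im.mpr (hcrit j)
    change (starRingEnd ℂ) (h j * e j * f (v j) * (starRingEnd ℂ) (f (u j))) =
      h j * e j * f (v j) * (starRingEnd ℂ) (f (u j)) at h1
    simp only [map_mul, Complex.conj_conj, hch, hce] at h1
    apply mul_left_cancel₀ (hh j)
    linear_combination -h1
  choose c hc0 hcv hcu using fun j => exists_common_phase (hee j) (hreal j) (hnv j)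
  have hΩx : ∀ x j, (Ω *ᵥ x) j = -(h j * e j * f (v j) * (starRingEnd ℂ) (f (u j))) * x j := by
    intro x j
    have h1 := Complex.conj_eq_iff_re.mp (Complex.conj_eq_iff_im.mpr (hcrit j))
    rw [hΩ, Matrix.mulVec_diagonal, Complex.neg_re, Complex.ofReal_neg, h1]
  have hTα : ∀ w i, (T α0 *ᵥ w) i = (T0 *ᵥ w) i + ∑ j,
      ((if i = u j then h j * e j * w (v j) else 0) +
        (if i = v j then h j * e' j * w (u j) else 0)) := by
    intro w i
    rw [hT, Matrix.add_mulVec, Pi.add_apply, Matrix.sum_mulVec, Finset.sum_apply]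
    congr 1
    refine Finset.sum_congr rfl fun j _ => ?_
    rw [Matrix.add_mulVec, Pi.add_apply, hch]
    simp only [Matrix.mulVec, dotProduct, Matrix.single_apply]
    simp [he, he', ite_and, eq_comm]
  have hTherm : (T α0).IsHermitian := by
    rw [hT]
    refine hT0.add ?_
    rw [Matrix.IsHermitian, Matrix.conjTranspose_sum]
    refine Finset.sum_congr rfl fun j _ => ?_
    have h1 := hce j
    have h2 := hce' j
    simp only [he, he'] at h1 h2
    rw [Matrix.conjTranspose_add, Matrix.conjTranspose_single, Matrix.conjTranspose_single,
      add_comm]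
    simp only [star_mul', Complex.star_def, Complex.conj_conj, h1, h2]
  have hAherm : (T α0 - (μ : ℂ) • (1 : Matrix (Fin N) (Fin N) ℂ)).IsHermitian := by
    refine hTherm.sub ?_
    rw [Matrix.IsHermitian, Matrix.conjTranspose_smul, Matrix.conjTranspose_one]
    simp
  have hBij : ∀ i j, B i j = Complex.I * (h j * e j * f (v j) * (if i = u j then 1 else 0) -
      h j * e' j * f (u j) * (if i = v j then 1 else 0)) := by
    intro i j
    rw [hB, Matrix.of_apply, hch]
  have hBstar : ∀ w j, (Bᴴ *ᵥ w) j = -Complex.I *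
      (h j * e' j * (starRingEnd ℂ) (f (v j)) * w (u j) -
        h j * e j * (starRingEnd ℂ) (f (u j)) * w (v j)) := by
    intro w j
    have hcol : ∀ i, (starRingEnd ℂ) (B i j) = -Complex.I *
        (h j * e' j * (starRingEnd ℂ) (f (v j)) * (if i = u j then 1 else 0) -
          h j * e j * (starRingEnd ℂ) (f (u j)) * (if i = v j then 1 else 0)) := by
      intro i
      simp only [hBij, map_mul, map_sub, Complex.conj_I, apply_ite (starRingEnd ℂ), map_one,
        map_zero, hch, hce, hce']
    simp only [Matrix.mulVec, dotProduct, Matrix.conjTranspose_apply, Complex.star_def, hcol]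
    simp only [mul_assoc, sub_mul, ← Finset.mul_sum, Finset.sum_sub_distrib]
    simp
  have hBx : ∀ x i, (B *ᵥ x) i = ∑ j, Complex.I *
      ((if i = u j then h j * e j * f (v j) * x j else 0) -
        (if i = v j then h j * e' j * f (u j) * x j else 0)) := by
    intro x i
    simp only [Matrix.mulVec, dotProduct, hBij]
    refine Finset.sum_congr rfl fun j _ => ?_
    split_ifs <;> ring
  have hker : ∀ w, (T α0 - (μ : ℂ) • (1 : Matrix (Fin N) (Fin N) ℂ)) *ᵥ w = 0 →
      Bᴴ *ᵥ w = 0 := by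
    intro w hw
    have hf0 : f ≠ 0 := by
      rintro rfl
      simp at hunit
    rw [Matrix.sub_mulVec, Matrix.smul_mulVec, Matrix.one_mulVec, sub_eq_zero] at hw
    obtain ⟨t, rfl⟩ := exists_eq_smul_of_simple_eigenvalue hTherm hsimple hf0 heig hw
    funext j
    rw [hBstar, Pi.smul_apply, Pi.smul_apply, Pi.zero_apply, smul_eq_mul, smul_eq_mul]
    linear_combination Complex.I * h j * t * hreal j
  have hWherm : W.IsHermitian := by
    rw [hW]
    refine Matrix.IsHermitian.sub ?_ (Matrix.isHermitian_conjTranspose_mul_mul _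
      (isHermitian_pinvH _))
    rw [hΩ, Matrix.isHermitian_diagonal_iff]
    exact fun j => Complex.conj_ofReal _
  set x : Fin d → ℂ := fun j => Complex.I * (e j - e' j) * c j with hx
  have hx0 : x ≠ 0 := by
    obtain ⟨j, hj⟩ := hnotcorner
    intro h0
    have h1 : e j - e' j = 0 := by
      have h2 := congrFun h0 j
      simpa [hx, hc0 j] using h2
    have h3 : Complex.sin (α0 j) = 0 := by
      rw [Complex.sin, ← neg_sub]
      have h4 : Complex.exp ((α0 j : ℂ) * Complex.I) - Complex.exp (-(α0 j : ℂ) * Complex.I) = 0 := by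
        simpa [he, he', mul_comm] using h1
      rw [h4]
      simp
    rw [← Complex.ofReal_sin, Complex.ofReal_eq_zero, Real.sin_eq_zero_iff] at h3
    obtain ⟨k, hk⟩ := h3
    exact hj k hk.symm
  have hWx : W *ᵥ x = 0 := by
    rw [hW]
    refine schur_pinvH_mulVec_eq_zero hAherm hker (y := fun i => (starRingEnd ℂ) (f i)) ?_ ?_
    · funext i
      have hconj := congrArg (starRingEnd ℂ) (congrFun heig i)
      rw [hTα, Pi.smul_apply, smul_eq_mul, map_add, map_sum, map_mul, Complex.conj_ofReal] at hconj
      have hT0f : (starRingEnd ℂ) ((T0 *ᵥ f) i) = (T0 *ᵥ fun i => (starRingEnd ℂ) (f i)) i := by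
        simp only [Matrix.mulVec, dotProduct, map_sum, map_mul, hcT]
      rw [Matrix.sub_mulVec, Matrix.smul_mulVec, Matrix.one_mulVec, Pi.add_apply, Pi.sub_apply,
        Pi.smul_apply, smul_eq_mul, hTα, hBx, ← hconj, hT0f, Pi.zero_apply, add_sub_add_left_eq_sub,
        ← Finset.sum_sub_distrib, ← Finset.sum_add_distrib]
      refine Finset.sum_eq_zero fun j _ => ?_
      simp only [map_add, apply_ite (starRingEnd ℂ), map_mul, map_zero, hch, hce, hce', hx, hcv,
        hcu]
      split_ifs
      · linear_combination
          (h j * (e j - e' j) * c j * (e j * f (v j) - e' j * f (u j))) * Complex.I_mul_I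
      · linear_combination (h j * (e j - e' j) * c j * (e j * f (v j))) * Complex.I_mul_I
      · linear_combination (-h j * (e j - e' j) * c j * (e' j * f (u j))) * Complex.I_mul_I
      · ring
    · funext j
      rw [Pi.add_apply, hBstar, hΩx, hcv, hcu, Pi.zero_apply]
      ring
  have hdet : W.det = 0 := Matrix.exists_mulVec_eq_zero_iff.mp ⟨x, hx0, hWx⟩
  exact ⟨one_le_iZero_of_det_eq_zero hWherm hdet, hdet⟩
end
end
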